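/- Let X ⊆ P^{n-1} be an irreducible complex projective variety of projective dimension m-1 with X ≠ P^{n-1}. Then the Kalman variety K(X) ⊆ P^{n²-1} is irreducible, has codimension n-m in P^{n²-1}, and has degree deg(X)·binom(n, m-1). Moreover, a generic matrix class [A] ∈ K(X) admits exactly one eigenpoint on X, so the projection from the incidence variety {([A],x) : x ∈ X is an eigenpoint of A} onto K(X) is birational. -/

import Mathlib

noncomputable section

/-! ## Zariski topology on complex affine space -/

/-- The Zariski topology on the affine space `ι → ℂ`: the basic open sets are the
complements of hypersurfaces. -/
def zTop (ι : Type*) : TopologicalSpace (ι → ℂ) :=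
  TopologicalSpace.generateFrom
    {U | ∃ p : MvPolynomial ι ℂ, U = {x | MvPolynomial.eval x p ≠ 0}}

/-- Zariski open subset of affine space. -/
def zOpen {ι : Type*} (U : Set (ι → ℂ)) : Prop := @IsOpen _ (zTop ι) U

/-- Zariski closed subset of affine space. -/
def zClosed {ι : Type*} (Z : Set (ι → ℂ)) : Prop := @IsClosed _ (zTop ι) Z

/-- Zariski density. -/
def zDense {ι : Type*} (S : Set (ι → ℂ)) : Prop := @Dense _ (zTop ι) S

/-- Zariski closure. -/
def zClosure {ι : Type*} (S : Set (ι → ℂ)) : Set (ι → ℂ) := @closure _ (zTop ι) S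

/-- Irreducibility in the Zariski topology. -/
def zIrred {ι : Type*} (S : Set (ι → ℂ)) : Prop := @IsIrreducible _ (zTop ι) S

/-- The dimension of a subset of affine space: the topological Krull dimension of the
subspace topology induced by the Zariski topology. -/
def zDim {ι : Type*} (S : Set (ι → ℂ)) : WithBot ℕ∞ :=
  @topologicalKrullDim S (TopologicalSpace.induced Subtype.val (zTop ι))

/-- The common zero set of a family of polynomials. -/
def vanishSet {ι : Type*} (S : Set (MvPolynomial ι ℂ)) : Set (ι → ℂ) :=
  {x | ∀ p ∈ S, MvPolynomial.eval x p = 0}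

/-- The ideal of all polynomials vanishing on a subset of affine space. -/
def vanishingIdealOf {ι : Type*} (X : Set (ι → ℂ)) : Ideal (MvPolynomial ι ℂ) where
  carrier := {p | ∀ x ∈ X, MvPolynomial.eval x p = 0}
  add_mem' := by
    intro a b ha hb x hx
    simp [ha x hx, hb x hx]
  zero_mem' := by
    intro x hx
    simp
  smul_mem' := by
    intro c p hp x hx
    simp [smul_eq_mul, hp x hx]

/-- A subset of `ι → ℂ` is a cone if it is stable under scalar multiplication. -/
def IsCone {ι : Type*} (X : Set (ι → ℂ)) : Prop :=
  ∀ (c : ℂ) (v : ι → ℂ), v ∈ X → c • v ∈ X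

/-- The affine-linear subspace cut out by `k` affine-linear equations whose coefficients are
recorded by `a` (the `none` coordinate records the constant term). -/
def affSlice {ι : Type*} [Fintype ι] {k : ℕ} (a : Fin k × Option ι → ℂ) : Set (ι → ℂ) :=
  {x | ∀ j : Fin k, a (j, none) + ∑ i : ι, a (j, some i) * x i = 0}

/-- `hasConeDegree C k δ` : the projective variety with affine cone `C ⊆ ℂ^ι` and projective
dimension `k` has degree `δ`, expressed by saying that a generic affine-linear slice of `C` of
codimension `k + 1` consists of exactly `δ` points. -/
def hasConeDegree {ι : Type*} [Fintype ι] (C : Set (ι → ℂ)) (k δ : ℕ) : Prop :=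
  ∃ U : Set (Fin (k + 1) × Option ι → ℂ), zOpen U ∧ zDense U ∧
    ∀ a ∈ U, (C ∩ affSlice a).ncard = δ

/-! ## Eigenvectors and the Kalman variety -/

/-- `v` is an eigenvector of the matrix `A`. -/
def IsEigenvector {n : ℕ} (A : Matrix (Fin n) (Fin n) ℂ) (v : Fin n → ℂ) : Prop :=
  v ≠ 0 ∧ ∃ lam : ℂ, A.mulVec v = lam • v

/-- The space of `n × n` complex matrices, presented as an affine space. -/
abbrev MatSpace (n : ℕ) := Fin n × Fin n → ℂ

/-- The matrix corresponding to a point of `MatSpace n`. -/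
def toMat {n : ℕ} (A : MatSpace n) : Matrix (Fin n) (Fin n) ℂ :=
  Matrix.of fun i j => A (i, j)

/-- The affine cone over the Kalman variety `𝒦(X)` of the projective variety whose affine
cone is `X`: all matrices having an eigenvector lying on `X`. -/
def kalmanCone {n : ℕ} (X : Set (Fin n → ℂ)) : Set (MatSpace n) :=
  {A | ∃ v ∈ X, IsEigenvector (toMat A) v}



/-! ## Symmetric powers of matrices and Kalman matrices -/

/-- Index set for the monomials of degree `d` in `n` variables. -/
abbrev MonIdx (n d : ℕ) := Sym (Fin n) d

/-- The exponent vector of the monomial indexed by `σ`. -/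
def monExp {n d : ℕ} (σ : MonIdx n d) : Fin n →₀ ℕ :=
  Multiset.toFinsupp (σ : Multiset (Fin n))

/-- The generic `n × n` matrix, whose entries are the variables of `ℂ[A]`. -/
def genMat (n : ℕ) : Matrix (Fin n) (Fin n) (MvPolynomial (Fin n × Fin n) ℂ) :=
  Matrix.of fun i j => MvPolynomial.X (i, j)

/-- The `d`-th symmetric power `ρ_d(A)` of a square matrix `A`, i.e. the matrix (in the basis of
monomials of degree `d`) of the induced action of `A` on forms of degree `d`: the entry at
`(τ, σ)` is the coefficient of `x^σ` in `(A·x)^τ`. -/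
def symPow {R : Type*} [CommRing R] {n : ℕ} (d : ℕ) (A : Matrix (Fin n) (Fin n) R) :
    Matrix (MonIdx n d) (MonIdx n d) R :=
  Matrix.of fun τ σ =>
    MvPolynomial.coeff (monExp σ)
      (∏ j : Fin n, (∑ k : Fin n, MvPolynomial.C (A j k) * MvPolynomial.X k) ^ (monExp τ j))

/-- The coefficient vector of a form of degree `d`. -/
def coeffVec {n : ℕ} (d : ℕ) (f : MvPolynomial (Fin n) ℂ) : MonIdx n d → ℂ :=
  fun σ => MvPolynomial.coeff (monExp σ) f

/-- The form of degree `d` with coefficient vector `c`. -/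
def polyOf {n d : ℕ} (c : MonIdx n d → ℂ) : MvPolynomial (Fin n) ℂ :=
  ∑ σ : MonIdx n d, MvPolynomial.monomial (monExp σ) (c σ)

/-- The rectangular Kalman matrix of order `d` associated with a `p × N` coefficient matrix `C`:
its rows are the rows of `C`, `C·ρ_d(A)`, ..., `C·ρ_d(A)^{t-1}` for the generic matrix `A`. -/
def kalmanMat {n d p : ℕ} (t : ℕ) (C : Matrix (Fin p) (MonIdx n d) ℂ) :
    Matrix (Fin t × Fin p) (MonIdx n d) (MvPolynomial (Fin n × Fin n) ℂ) :=
  Matrix.of fun r τ =>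
    ∑ κ : MonIdx n d, MvPolynomial.C (C r.2 κ) * ((symPow d (genMat n)) ^ (r.1 : ℕ)) κ τ

/-- The square Kalman matrix `K_d(f)` of a form `f` with coefficient vector `c`: the rows are
`C_f ρ_d(A)^i` for `i = 0, …, N - 1` (indexed by monomials through a fixed enumeration). -/
def kalmanSq {n : ℕ} (d : ℕ) (c : MonIdx n d → ℂ) :
    Matrix (MonIdx n d) (MonIdx n d) (MvPolynomial (Fin n × Fin n) ℂ) :=
  Matrix.of fun σ τ =>
    ∑ κ : MonIdx n d, MvPolynomial.C (c κ) *
      ((symPow d (genMat n)) ^ ((Fintype.equivFin (MonIdx n d)) σ : ℕ)) κ τ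

/-- The determinant of the square Kalman matrix of order `d`. -/
def kalmanDet {n : ℕ} (d : ℕ) (c : MonIdx n d → ℂ) : MvPolynomial (Fin n × Fin n) ℂ :=
  (kalmanSq d c).det

/-- The locus of matrices at which all maximal minors of a (rectangular) matrix of polynomials
in `ℂ[A]` vanish. -/
def maxMinorsZeroSet {n d : ℕ} {ridx : Type*}
    (M : Matrix ridx (MonIdx n d) (MvPolynomial (Fin n × Fin n) ℂ)) : Set (MatSpace n) :=
  {A | ∀ e : MonIdx n d → ridx, Function.Injective e →
    MvPolynomial.eval A (Matrix.det (Matrix.of fun σ τ => M (e σ) τ)) = 0}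



/-! ## Polarizations and μ-Kalman varieties -/

/-- Evaluation of the multihomogeneous polarization `f_μ` of `f` at a tuple of vectors
`v_1, …, v_s` (up to a nonzero rational normalization constant): the coefficient of `t^μ`
in `f(t_1 v_1 + ⋯ + t_s v_s)`. -/
def polarEval {n s : ℕ} (f : MvPolynomial (Fin n) ℂ) (μ : Fin s → ℕ)
    (v : Fin s → Fin n → ℂ) : ℂ :=
  MvPolynomial.coeff (Finsupp.equivFunOnFinite.symm μ)
    (MvPolynomial.eval₂ MvPolynomial.C
      (fun k => ∑ i : Fin s, MvPolynomial.C (v i k) * MvPolynomial.X i) f)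

/-- The affine cone over the `μ`-Kalman variety `𝒦_μ(f)`: the Zariski closure of the set of
matrices admitting linearly independent eigenvectors `v_1, …, v_s` with `f_μ(v_1, …, v_s) = 0`. -/
def muKalmanCone {n : ℕ} (f : MvPolynomial (Fin n) ℂ) {s : ℕ} (μ : Fin s → ℕ) :
    Set (MatSpace n) :=
  zClosure {A | ∃ v : Fin s → (Fin n → ℂ),
    (∀ i, IsEigenvector (toMat A) (v i)) ∧ LinearIndependent ℂ v ∧ polarEval f μ v = 0}

/-- The parts of a partition of `d`, listed as a tuple. -/
def partTuple (d : ℕ) (μ : Nat.Partition d) : Fin (Multiset.card μ.parts) → ℕ :=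
  fun i => μ.parts.toList.get (i.cast (Multiset.length_toList _).symm)

/-- The multiset of nonzero exponents of the monomial indexed by `σ`. -/
def expMultiset {n d : ℕ} (σ : Sym (Fin n) d) : Multiset ℕ :=
  Multiset.filter (fun e => e ≠ 0)
    (Multiset.map (fun i => Multiset.toFinsupp (σ : Multiset (Fin n)) i) Finset.univ.val)

/-! ## Tangent spaces, smooth points and singular loci -/

/-- The Zariski tangent space of `X ⊆ ℂ^ι` at `x`: the common kernel of the differentials at
`x` of all polynomials vanishing on `X`. -/
def tangentSpace {ι : Type*} [Fintype ι] (X : Set (ι → ℂ)) (x : ι → ℂ) :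
    Submodule ℂ (ι → ℂ) where
  carrier := {u | ∀ p : MvPolynomial ι ℂ, (∀ y ∈ X, MvPolynomial.eval y p = 0) →
      ∑ i : ι, u i * MvPolynomial.eval x (MvPolynomial.pderiv i p) = 0}
  add_mem' := by
    intro a b ha hb p hp
    have h1 := ha p hp
    have h2 := hb p hp
    simp only [Pi.add_apply, add_mul, Finset.sum_add_distrib, h1, h2, add_zero]
  zero_mem' := by
    intro p hp
    simp
  smul_mem' := by
    intro c u hu p hp
    have h1 := hu p hp
    simp only [Pi.smul_apply, smul_eq_mul, mul_assoc, ← Finset.mul_sum, h1, mul_zero]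

/-- The local dimension of `X` at `x`, in the Zariski topology. -/
def zLocalDim {ι : Type*} (X : Set (ι → ℂ)) (x : ι → ℂ) : WithBot ℕ∞ :=
  ⨅ (U : Set (ι → ℂ)) (_ : zOpen U) (_ : x ∈ U), zDim (X ∩ U)

/-- `x` is a smooth point of `X`: the Zariski tangent space has dimension equal to the local
dimension of `X` at `x`. -/
def smoothAt {ι : Type*} [Fintype ι] (X : Set (ι → ℂ)) (x : ι → ℂ) : Prop :=
  ((Module.finrank ℂ (tangentSpace X x) : ℕ∞) : WithBot ℕ∞) = zLocalDim X x

/-- The affine cone over the singular locus of the projective variety whose affine cone is `X`: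
the nonzero points of `X` that are not smooth points. -/
def projSingCone {ι : Type*} [Fintype ι] (X : Set (ι → ℂ)) : Set (ι → ℂ) :=
  {x | x ∈ X ∧ x ≠ 0 ∧ ¬ smoothAt X x}

/-- The affine cone over the (reduced) singular locus of the Kalman variety of the projective
variety with affine cone `X`. -/
def singKalmanCone {n : ℕ} (X : Set (Fin n → ℂ)) : Set (MatSpace n) :=
  zClosure (projSingCone (zClosure (kalmanCone X)))



/-! ## The spaces `ℙ_s = ℙ^{n²-1} × (ℙ^{n-1})^s` (as multicones) -/

/-- Coordinates for the multicone over `ℙ^{n²-1} × (ℙ^{n-1})^{×s}`. -/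
abbrev MIdx (n s : ℕ) := (Fin n × Fin n) ⊕ (Fin s × Fin n)

/-- The matrix component of a point of the multicone. -/
def matPart {n s : ℕ} (x : MIdx n s → ℂ) : MatSpace n := fun ij => x (Sum.inl ij)

/-- The `i`-th vector component of a point of the multicone. -/
def vecPart {n s : ℕ} (x : MIdx n s → ℂ) (i : Fin s) : Fin n → ℂ := fun k => x (Sum.inr (i, k))

/-- A partition of `{1, …, s}` into `k` (indexed) nonempty pairwise disjoint blocks. -/
structure IdxPartition (s k : ℕ) where
  block : Fin k → Finset (Fin s)
  nonempty : ∀ i, (block i).Nonempty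
  disj : ∀ i j, i ≠ j → Disjoint (block i) (block j)
  cover : ∀ p : Fin s, ∃ i, p ∈ block i

/-- The minimal representative of the `i`-th block. -/
def IdxPartition.rep {s k : ℕ} (P : IdxPartition s k) (i : Fin k) : Fin s :=
  (P.block i).min' (P.nonempty i)

/-- The finest partition, all of whose blocks are singletons. -/
def singletonPartition (s : ℕ) : IdxPartition s s where
  block i := {i}
  nonempty i := ⟨i, by simp⟩
  disj i j h := Finset.disjoint_singleton.2 h
  cover p := ⟨p, by simp⟩

/-- A tuple of nonzero vectors is `P`-compatible: vectors within each block of `P` are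
proportional, and representatives of the distinct blocks are linearly independent. -/
def PCompatible {n s k : ℕ} (P : IdxPartition s k) (v : Fin s → Fin n → ℂ) : Prop :=
  (∀ p, v p ≠ 0) ∧
  (∀ i, ∀ p ∈ P.block i, ∀ q ∈ P.block i, ∃ c : ℂ, v p = c • v q) ∧
  (∀ r : Fin k → Fin s, (∀ i, r i ∈ P.block i) → LinearIndependent ℂ (fun i => v (r i)))

/-- The multicone over `W_s`: tuples `(A, v_1, …, v_s)` where each `v_i` is an eigenvector of
the (nonzero) matrix `A`. -/
def Wcone (n s : ℕ) : Set (MIdx n s → ℂ) :=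
  {x | matPart x ≠ 0 ∧ ∀ i, IsEigenvector (toMat (matPart x)) (vecPart x i)}

/-- The multicone over `W_{s,P}`: the Zariski closure of the set of tuples in `W_s` whose
vector part is `P`-compatible. -/
def WsPcone (n : ℕ) {s k : ℕ} (P : IdxPartition s k) : Set (MIdx n s → ℂ) :=
  zClosure {x | x ∈ Wcone n s ∧ PCompatible P (fun i => vecPart x i)}

/-! ## Multidegrees -/

/-- Parameter space for a multiprojective slice of multidegree type `γ`. -/
abbrev MSliceParam (n s : ℕ) (γ : Fin (s + 1) → ℕ) : Type :=
  (Fin (n ^ 2 - γ 0) × Option (Fin n × Fin n)) ⊕ ((Σ j : Fin s, Fin (n - γ j.succ)) × Option (Fin n))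

/-- The multiprojective affine-linear slice with parameters `a`: it cuts the matrix factor by
`n² - γ 0` affine-linear equations and the `j`-th vector factor by `n - γ (j+1)` affine-linear
equations. -/
def mSlice {n s : ℕ} (γ : Fin (s + 1) → ℕ) (a : MSliceParam n s γ → ℂ) :
    Set (MIdx n s → ℂ) :=
  {x | (∀ r : Fin (n ^ 2 - γ 0),
          a (Sum.inl (r, none)) +
            ∑ ij : Fin n × Fin n, a (Sum.inl (r, some ij)) * x (Sum.inl ij) = 0) ∧
       (∀ j : Fin s, ∀ r : Fin (n - γ j.succ),
          a (Sum.inr (⟨j, r⟩, none)) +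
            ∑ k : Fin n, a (Sum.inr (⟨j, r⟩, some k)) * x (Sum.inr (j, k)) = 0)}

/-- `hasMD W γ δ` : the coefficient of the monomial `h_0^{γ 0} h_1^{γ 1} ⋯ h_s^{γ s}` in the
Chow class of the multiprojective variety with multicone `W ⊆ ℂ^{n²} × (ℂ^n)^s` equals `δ`:
a generic multiprojective slice of type `γ` meets `W` in exactly `δ` points. -/
def hasMD {n s : ℕ} (W : Set (MIdx n s → ℂ)) (γ : Fin (s + 1) → ℕ) (δ : ℕ) : Prop :=
  ∃ U : Set (MSliceParam n s γ → ℂ), zOpen U ∧ zDense U ∧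
    ∀ a ∈ U, (W ∩ mSlice γ a).ncard = δ

/-- The exponent vector of the monomial `h_0 · h_1^{n-1} ⋯ h_i^{n-2} ⋯ h_s^{n-1}`. -/
def specialExp (n s : ℕ) (i : Fin s) : Fin (s + 1) → ℕ :=
  fun j => if j = 0 then 1 else if j = i.succ then n - 2 else n - 1

/-- `γ` lies in the box of admissible exponents of the Chow ring of `ℙ^{n²-1} × (ℙ^{n-1})^s`. -/
def inBox (n s : ℕ) (γ : Fin (s + 1) → ℕ) : Prop :=
  γ 0 < n ^ 2 ∧ ∀ j : Fin s, γ j.succ < n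

/-- `representsClass W c q` : the polynomial `q` represents the Chow class of the
multiprojective variety with multicone `W`, of codimension `c`: its coefficients in the
admissible box in degree `c` are the multidegrees of `W`, and all other coefficients vanish. -/
def representsClass {n s : ℕ} (W : Set (MIdx n s → ℂ)) (c : ℕ)
    (q : MvPolynomial (Fin (s + 1)) ℤ) : Prop :=
  (∀ γ : Fin (s + 1) → ℕ, inBox n s γ → (∑ j, γ j) = c →
      ∃ δ : ℕ, q.coeff (Finsupp.equivFunOnFinite.symm γ) = (δ : ℤ) ∧ hasMD W γ δ) ∧
  (∀ γ : Fin (s + 1) → ℕ, ¬ (inBox n s γ ∧ (∑ j, γ j) = c) →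
      q.coeff (Finsupp.equivFunOnFinite.symm γ) = 0)

/-! ## The Chow ring of `ℙ^{n²-1} × (ℙ^{n-1})^s` -/

/-- The defining ideal of the Chow ring `ℤ[h_0, …, h_s]/(h_0^{n²}, h_1^n, …, h_s^n)`. -/
def chowIdeal (n s : ℕ) : Ideal (MvPolynomial (Fin (s + 1)) ℤ) :=
  Ideal.span ({MvPolynomial.X 0 ^ n ^ 2} ∪
    Set.range fun j : Fin s => MvPolynomial.X j.succ ^ n)

/-- The Chow ring `A^*(ℙ_s) = ℤ[h_0, …, h_s]/(h_0^{n²}, h_1^n, …, h_s^n)`. -/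
abbrev ChowRing (n s : ℕ) := MvPolynomial (Fin (s + 1)) ℤ ⧸ chowIdeal n s

/-- The variable substitution `h_0 ↦ t_0`, `h_i ↦ t_{q_i}` underlying `φ_P`. -/
def blockVarMap {s k : ℕ} (P : IdxPartition s k) : Fin (k + 1) → Fin (s + 1) :=
  Fin.cases 0 fun i => (P.rep i).succ

lemma phiP_aux {n s k : ℕ} (P : IdxPartition s k) :
    ∀ a ∈ chowIdeal n k,
      ((Ideal.Quotient.mk (chowIdeal n s)).comp
        (MvPolynomial.rename (R := ℤ) (blockVarMap P)).toRingHom) a = 0 := by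
  intro a ha
  rw [RingHom.comp_apply, Ideal.Quotient.eq_zero_iff_mem]
  have hmap : (MvPolynomial.rename (R := ℤ) (blockVarMap P)).toRingHom a ∈
      Ideal.map (MvPolynomial.rename (R := ℤ) (blockVarMap P)).toRingHom
        (chowIdeal n k) :=
    Ideal.mem_map_of_mem _ ha
  have hle : Ideal.map
      (MvPolynomial.rename (R := ℤ) (blockVarMap P)).toRingHom
      (chowIdeal n k) ≤ chowIdeal n s := by
    rw [chowIdeal, Ideal.map_span, Ideal.span_le]
    rintro q ⟨p, hp, rfl⟩
    rcases hp with hp | ⟨j, rfl⟩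
    · rw [Set.mem_singleton_iff] at hp
      subst hp
      simp only [AlgHom.toRingHom_eq_coe, RingHom.coe_coe, map_pow, MvPolynomial.rename_X,
        Fin.cases_zero]
      exact Ideal.subset_span (Or.inl rfl)
    · simp only [AlgHom.toRingHom_eq_coe, RingHom.coe_coe, map_pow, MvPolynomial.rename_X,
        Fin.cases_succ]
      exact Ideal.subset_span (Or.inr ⟨P.rep j, rfl⟩)
  exact hle hmap

/-- The ring map `φ_P : A^*(ℙ_k) → A^*(ℙ_s)` sending `h_0 ↦ t_0` and `h_i ↦ t_{q_i}`. -/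
def phiP (n : ℕ) {s k : ℕ} (P : IdxPartition s k) : ChowRing n k →+* ChowRing n s :=
  Ideal.Quotient.lift (chowIdeal n k)
    ((Ideal.Quotient.mk (chowIdeal n s)).comp
      (MvPolynomial.rename (R := ℤ) (blockVarMap P)).toRingHom)
    (phiP_aux P)



/-! ## Discriminants of characteristic polynomials -/

/-- `∏_{i<j} (l i - l j)^2` for a list `l`. -/
def listPairProdSq (l : List ℂ) : ℂ :=
  ∏ p ∈ Finset.univ.filter (fun p : Fin l.length × Fin l.length => p.1 < p.2),
    (l.get p.1 - l.get p.2) ^ 2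

/-- The product of the squared differences of all pairs of elements of a multiset; applied to
the multiset of roots of a characteristic polynomial this is the discriminant. -/
def pairProdSq (m : Multiset ℂ) : ℂ := listPairProdSq m.toList

/-- The coordinate vector (for the action of the symmetric power `ρ_d`) of the symmetric
product `v_1 ⋯ v_d` of the vectors `v i`: its `σ`-th coordinate is the coefficient of
`t_1 ⋯ t_d` in `∏_k (∑_i t_i v i k)^{σ_k}`. -/
def symProdVec {n d : ℕ} (v : Fin d → Fin n → ℂ) : MonIdx n d → ℂ := fun σ =>
  MvPolynomial.coeff (Finsupp.equivFunOnFinite.symm fun _ : Fin d => 1)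
    (∏ k : Fin n, (∑ i : Fin d, MvPolynomial.C (v i k) * MvPolynomial.X i) ^ (monExp σ k))

section
open Polynomial in
/-- A primitive integral element. -/
theorem exists_prim {P B : Type} [CommRing P] [IsDomain P] [CharZero P] [CommRing B] [IsDomain B]
    [Algebra P B] [FaithfulSMul P B] [Algebra.IsAlgebraic P B] [Algebra.FiniteType P B] :
    ∃ θ : B, IsIntegral P θ ∧ ∀ x : B, ∃ p : P, p ≠ 0 ∧ p • x ∈ Algebra.adjoin P {θ} := by
  let F := FractionRing P
  let L := FractionRing B
  have : FaithfulSMul P L := FaithfulSMul.trans P B L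
  let _ : Algebra F L := FractionRing.liftAlgebra P L
  have : IsScalarTower P F L := inferInstance
  have hinjPB : Function.Injective (algebraMap P B) := FaithfulSMul.algebraMap_injective P B
  have hinjBL : Function.Injective (algebraMap B L) := IsFractionRing.injective B L
  have halgPL : Algebra.IsAlgebraic P L := (IsFractionRing.isAlgebraic_iff' P B L).1 inferInstance
  have : Algebra.IsAlgebraic F L :=
    ⟨fun x => (IsFractionRing.isAlgebraic_iff P F L).1 (halgPL.isAlgebraic x)⟩
  have : CharZero F := charZero_of_injective_algebraMap (IsFractionRing.injective P F)
  have hfin : FiniteDimensional F L := by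
    obtain ⟨s, hs⟩ := Algebra.FiniteType.out (R := P) (A := B)
    have htop : IntermediateField.adjoin F ((algebraMap B L) '' (s : Set B)) = ⊤ := by
      rw [eq_top_iff]
      intro x _
      have hB : ∀ b : B, algebraMap B L b ∈ IntermediateField.adjoin F ((algebraMap B L) '' (s : Set B)) := by
        intro b
        have hb : b ∈ Algebra.adjoin P (s : Set B) := hs ▸ Algebra.mem_top
        induction hb using Algebra.adjoin_induction with
        | mem x hx => exact IntermediateField.subset_adjoin _ _ ⟨x, hx, rfl⟩
        | algebraMap r =>
          rw [← IsScalarTower.algebraMap_apply P B L, IsScalarTower.algebraMap_apply P F L]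
          exact IntermediateField.algebraMap_mem _ _
        | add x y _ _ hx hy => rw [map_add]; exact add_mem hx hy
        | mul x y _ _ hx hy => rw [map_mul]; exact mul_mem hx hy
      obtain ⟨a, b, hb, rfl⟩ := IsFractionRing.div_surjective (A := B) x
      exact div_mem (hB a) (hB b)
    have : Finite ((algebraMap B L) '' (s : Set B)) := (s.finite_toSet.image _).to_subtype
    have h2 : FiniteDimensional F (IntermediateField.adjoin F ((algebraMap B L) '' (s : Set B))) :=
      IntermediateField.finiteDimensional_adjoin fun x _ => (Algebra.IsAlgebraic.isAlgebraic x).isIntegral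
    rw [htop] at h2
    exact Module.Finite.equiv (IntermediateField.topEquiv (F := F) (E := L)).toLinearEquiv
  obtain ⟨α, hα⟩ := Field.exists_primitive_element F L
  obtain ⟨a, b, hb, hab⟩ := IsFractionRing.div_surjective (A := B) α
  obtain ⟨r, hr, c, hc⟩ := (Algebra.IsAlgebraic.isAlgebraic (R := P) b).exists_nonzero_dvd hb
  obtain ⟨y, hy, h_integral⟩ := (Algebra.IsAlgebraic.isAlgebraic (R := P) (a * c)).exists_integral_multiple
  refine ⟨y • (a * c), h_integral, ?_⟩
  set θ := y • (a * c) with hθ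
  have hyr : y * r ≠ 0 := mul_ne_zero hy hr
  have hbL : algebraMap B L b ≠ 0 := by
    intro h
    exact nonZeroDivisors.ne_zero hb (hinjBL (by rw [h, map_zero]))
  have hθα : algebraMap B L θ = algebraMap F L (algebraMap P F (y * r)) * α := by
    rw [← hab, ← IsScalarTower.algebraMap_apply P F L, IsScalarTower.algebraMap_apply P B L, hθ,
      Algebra.smul_def, map_mul (algebraMap P B) y r, hc]
    simp only [map_mul]
    rw [← mul_div_assoc, eq_div_iff hbL]
    ring
  have hFyr : algebraMap P F (y * r) ≠ 0 := by
    intro h; exact hyr (IsFractionRing.injective P F (by rw [h, map_zero]))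
  have hprim : IntermediateField.adjoin F {algebraMap B L θ} = ⊤ := by
    rw [eq_top_iff, ← hα, IntermediateField.adjoin_simple_le_iff]
    have hα' : α = algebraMap F L (algebraMap P F (y * r))⁻¹ * algebraMap B L θ := by
      rw [hθα, ← mul_assoc, ← map_mul, inv_mul_cancel₀ hFyr, map_one, one_mul]
    rw [hα']
    exact mul_mem (IntermediateField.algebraMap_mem _ _) (IntermediateField.mem_adjoin_simple_self _ _)
  intro x
  have hx : algebraMap B L x ∈ Algebra.adjoin F {algebraMap B L θ} := by
    rw [← IntermediateField.adjoin_simple_toSubalgebra_of_isAlgebraic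
      (Algebra.IsAlgebraic.isAlgebraic (algebraMap B L θ)), hprim]
    exact Algebra.mem_top
  rw [Algebra.adjoin_singleton_eq_range_aeval] at hx
  obtain ⟨w, hw⟩ := hx
  obtain ⟨p, hp, hpw⟩ := IsLocalization.integerNormalization_spec (nonZeroDivisors P) w
  refine ⟨p, nonZeroDivisors.ne_zero hp, ?_⟩
  rw [Algebra.adjoin_singleton_eq_range_aeval]
  refine ⟨IsLocalization.integerNormalization (nonZeroDivisors P) w, hinjBL ?_⟩
  clear_value θ
  have h1 := congrArg (aeval (algebraMap B L θ)) hpw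
  have hw' : aeval (algebraMap B L θ) w = algebraMap B L x := hw
  rw [aeval_map_algebraMap] at h1
  have h2 : aeval (algebraMap B L θ) (p • w) = p • aeval (algebraMap B L θ) w := by
    rw [← algebraMap_smul F p w, map_smul, algebraMap_smul]
  rw [h2, hw', aeval_algebraMap_apply] at h1
  refine Eq.trans h1 ?_
  rw [Algebra.smul_def, Algebra.smul_def, map_mul, ← IsScalarTower.algebraMap_apply]
end

section
open Polynomial in
/-- Generic fibre cardinality, abstract version. -/
theorem gfc_core {P B : Type} [CommRing P] [IsDomain P] [CharZero P] [IsIntegrallyClosed P]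
    [CommRing B] [IsDomain B]
    [Algebra P B] [FaithfulSMul P B] [Algebra.IsAlgebraic P B] [Algebra.FiniteType P B]
    [Algebra ℂ P] [Algebra ℂ B] [IsScalarTower ℂ P B] :
    ∃ (δ : ℕ) (q : P), q ≠ 0 ∧
      (∀ ev : P →ₐ[ℂ] ℂ, ev q ≠ 0 →
        Nat.card {χ : B →ₐ[ℂ] ℂ // ∀ p, χ (algebraMap P B p) = ev p} = δ) ∧
      ∃ b : Fin δ → B, LinearIndependent P b ∧
        ∀ x, ∃ p : P, p ≠ 0 ∧ p • x ∈ Submodule.span P (Set.range b) := by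
  obtain ⟨θ, h_integral, hθ⟩ := exists_prim (P := P) (B := B)
  have hθ' : ∀ x : B, ∃ p : P, p ≠ 0 ∧ ∃ w : P[X], p • x = aeval θ w := by
    intro x
    obtain ⟨p, hp, h⟩ := hθ x
    rw [Algebra.adjoin_singleton_eq_range_aeval] at h
    obtain ⟨w, hw⟩ := h
    exact ⟨p, hp, w, hw.symm⟩
  set h := minpoly P θ with hh
  have hmonic : h.Monic := minpoly.monic h_integral
  have hroot : aeval θ h = 0 := minpoly.aeval P θ
  have hdvd : ∀ w : P[X], aeval θ w = 0 → h ∣ w := fun w hw => minpoly.isIntegrallyClosed_dvd h_integral hw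
  -- separability
  obtain ⟨q1, hq1, a1, b1, hab⟩ : ∃ q1 : P, q1 ≠ 0 ∧ ∃ a1 b1 : P[X],
      a1 * h + b1 * derivative h = C q1 := by
    let F := FractionRing P
    let L := FractionRing B
    have : FaithfulSMul P L := FaithfulSMul.trans P B L
    let _ : Algebra F L := FractionRing.liftAlgebra P L
    have : IsScalarTower P F L := inferInstance
    have : CharZero F := charZero_of_injective_algebraMap (IsFractionRing.injective P F)
    have hirr : Irreducible (h.map (algebraMap P F)) := by
      have h1 := minpoly.isIntegrallyClosed_eq_field_fractions F L h_integral
      rw [← h1]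
      refine minpoly.irreducible ?_
      have h2 : IsIntegral P (algebraMap B L θ) := h_integral.algebraMap
      exact h2.tower_top
    obtain ⟨a, b, hab⟩ := hirr.separable
    obtain ⟨ca, hca, ha⟩ := IsLocalization.integerNormalization_spec (nonZeroDivisors P) a
    obtain ⟨cb, hcb, hb⟩ := IsLocalization.integerNormalization_spec (nonZeroDivisors P) b
    refine ⟨ca * cb, mul_ne_zero (nonZeroDivisors.ne_zero hca) (nonZeroDivisors.ne_zero hcb),
      C cb * IsLocalization.integerNormalization (nonZeroDivisors P) a,
      C ca * IsLocalization.integerNormalization (nonZeroDivisors P) b, ?_⟩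
    apply Polynomial.map_injective (algebraMap P F) (IsFractionRing.injective P F)
    have hsm : ∀ (c : P) (f : F[X]), c • f = C (algebraMap P F c) * f := by
      intro c f
      rw [← algebraMap_smul F c f, smul_eq_C_mul]
    rw [Polynomial.map_add, Polynomial.map_mul, Polynomial.map_mul, Polynomial.map_mul,
      Polynomial.map_mul, ha, hb, hsm, hsm, ← derivative_map, Polynomial.map_C, Polynomial.map_C,
      Polynomial.map_C, map_mul, C_mul]
    linear_combination (C (algebraMap P F ca) * C (algebraMap P F cb)) * hab
  -- denominators
  obtain ⟨q2, hq2, hden⟩ : ∃ q2 : P, q2 ≠ 0 ∧ ∀ x : B, ∃ (k : ℕ) (w : P[X]),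
      q2 ^ k • x = aeval θ w := by
    obtain ⟨s, hs⟩ := Algebra.FiniteType.out (R := P) (A := B)
    choose p hp w hw using hθ'
    refine ⟨∏ x ∈ s, p x, Finset.prod_ne_zero_iff.2 fun x _ => hp x, ?_⟩
    intro x
    have hb : x ∈ Algebra.adjoin P (s : Set B) := hs ▸ Algebra.mem_top
    induction hb using Algebra.adjoin_induction with
    | mem x hx =>
      obtain ⟨c, hc⟩ := Finset.dvd_prod_of_mem p hx
      refine ⟨1, C c * w x, ?_⟩
      rw [pow_one, hc, mul_comm, mul_smul, hw, map_mul, aeval_C, Algebra.smul_def]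
    | algebraMap r => exact ⟨0, C r, by simp⟩
    | add x y _ _ hx hy =>
      obtain ⟨k, u, hu⟩ := hx
      obtain ⟨l, v, hv⟩ := hy
      refine ⟨k + l, C ((∏ x ∈ s, p x) ^ l) * u + C ((∏ x ∈ s, p x) ^ k) * v, ?_⟩
      rw [map_add, map_mul, map_mul, ← hu, ← hv, aeval_C, aeval_C, ← Algebra.smul_def,
        ← Algebra.smul_def, smul_smul, smul_smul, ← pow_add, ← pow_add, smul_add, add_comm l k]
    | mul x y _ _ hx hy =>
      obtain ⟨k, u, hu⟩ := hx
      obtain ⟨l, v, hv⟩ := hy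
      refine ⟨k + l, u * v, ?_⟩
      rw [map_mul, ← hu, ← hv, smul_mul_smul_comm, pow_add]
  refine ⟨h.natDegree, q1 * q2, mul_ne_zero hq1 hq2, ?_, fun i => θ ^ (i : ℕ), ?_, ?_⟩
  · intro ev hev
    rw [map_mul] at hev
    have hev1 : ev q1 ≠ 0 := left_ne_zero_of_mul hev
    have hev2 : ev q2 ≠ 0 := right_ne_zero_of_mul hev
    let er : P →+* ℂ := ev
    set g := h.map er with hg
    have hsep : g.Separable := by
      have := congrArg (Polynomial.map er) hab
      rw [Polynomial.map_add, Polynomial.map_mul, Polynomial.map_mul, ← derivative_map, Polynomial.map_C] at this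
      refine ⟨C (ev q1)⁻¹ * a1.map er, C (ev q1)⁻¹ * b1.map er, ?_⟩
      rw [mul_assoc, mul_assoc, ← mul_add, this, ← C_mul]
      change C ((ev q1)⁻¹ * ev q1) = 1
      rw [inv_mul_cancel₀ hev1, C_1]
    have hgm : g.Monic := hmonic.map er
    have hgd : g.natDegree = h.natDegree := hmonic.natDegree_map er
    have hcard : Nat.card {z : ℂ // z ∈ g.roots.toFinset} = h.natDegree := by
      rw [Nat.card_eq_fintype_card, Fintype.card_coe, Multiset.toFinset_card_of_nodup (nodup_roots hsep),
        ← hgd]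
      exact splits_iff_card_roots.1 (IsAlgClosed.splits g)
    rw [← hcard]
    have hev₂ : ∀ (χ : B →ₐ[ℂ] ℂ), (∀ p, χ (algebraMap P B p) = ev p) → ∀ w : P[X],
        χ (aeval θ w) = eval₂ er (χ θ) w := by
      intro χ hχ w
      rw [aeval_def, ← AlgHom.coe_toRingHom, hom_eval₂]
      congr 1
      ext p
      exact hχ p
    have hmem : ∀ z : ℂ, z ∈ g.roots.toFinset ↔ eval₂ er z h = 0 := by
      intro z
      rw [Multiset.mem_toFinset, mem_roots hgm.ne_zero, IsRoot.def, hg, eval_map]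
    refine Nat.card_congr (Equiv.ofBijective (fun χ => ⟨χ.1 θ, ?_⟩) ⟨?_, ?_⟩)
    · rw [hmem, ← hev₂ χ.1 χ.2, hroot, map_zero]
    · rintro ⟨χ, hχ⟩ ⟨χ', hχ'⟩ heq
      have heq' : χ θ = χ' θ := by simpa using heq
      apply Subtype.ext
      ext x
      obtain ⟨k, w, hw⟩ := hden x
      have e1 := congrArg χ hw
      have e2 := congrArg χ' hw
      rw [hev₂ χ hχ, Algebra.smul_def, map_mul, hχ] at e1
      rw [hev₂ χ' hχ', Algebra.smul_def, map_mul, hχ', ← heq', ← e1, map_pow] at e2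
      exact (mul_left_cancel₀ (pow_ne_zero k hev2) e2).symm
    · rintro ⟨z, hz⟩
      rw [hmem] at hz
      have key0 : ∀ w : P[X], aeval θ w = 0 → eval₂ er z w = 0 := by
        intro w hw
        obtain ⟨c, rfl⟩ := hdvd w hw
        rw [eval₂_mul, hz, zero_mul]
      choose K W hKW using hden
      let f : B → ℂ := fun x => eval₂ er z (W x) / ev q2 ^ (K x)
      have key : ∀ (x : B) (k : ℕ) (w : P[X]), q2 ^ k • x = aeval θ w →
          f x = eval₂ er z w / ev q2 ^ k := by
        intro x k w hw
        have h0 : aeval θ (C (q2 ^ k) * W x - C (q2 ^ (K x)) * w) = 0 := by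
          rw [map_sub, map_mul, map_mul, ← hKW, ← hw, aeval_C, aeval_C, ← Algebra.smul_def,
            ← Algebra.smul_def, smul_smul, smul_smul, mul_comm, sub_self]
        have h1 := key0 _ h0
        rw [eval₂_sub, eval₂_mul, eval₂_mul, eval₂_C, eval₂_C, map_pow, map_pow] at h1
        change ev q2 ^ k * _ - ev q2 ^ K x * _ = 0 at h1
        simp only [f]
        rw [div_eq_div_iff (pow_ne_zero _ hev2) (pow_ne_zero _ hev2)]
        linear_combination h1
      have hP : ∀ p : P, f (algebraMap P B p) = ev p := by
        intro p
        rw [key _ 0 (C p) (by simp), eval₂_C, pow_zero, div_one]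
        rfl
      let χ : B →ₐ[ℂ] ℂ :=
        { toFun := f
          map_one' := by
            have := hP 1
            rwa [map_one, map_one] at this
          map_zero' := by
            have := hP 0
            rwa [map_zero, map_zero] at this
          map_add' := by
            intro x y
            rw [key (x + y) (K x + K y) (C (q2 ^ K y) * W x + C (q2 ^ K x) * W y) (by
              rw [map_add, map_mul, map_mul, ← hKW, ← hKW, aeval_C, aeval_C, ← Algebra.smul_def,
                ← Algebra.smul_def, smul_smul, smul_smul, ← pow_add, ← pow_add, smul_add, add_comm (K y) (K x)])]
            simp only [f]
            rw [eval₂_add, eval₂_mul, eval₂_mul, eval₂_C, eval₂_C, map_pow, map_pow]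
            change (ev q2 ^ _ * _ + ev q2 ^ _ * _) / _ = _
            rw [div_add_div _ _ (pow_ne_zero _ hev2) (pow_ne_zero _ hev2), pow_add]
            congr 1
            ring
          map_mul' := by
            intro x y
            rw [key (x * y) (K x + K y) (W x * W y) (by
              rw [map_mul, ← hKW, ← hKW, smul_mul_smul_comm, pow_add])]
            simp only [f]
            rw [eval₂_mul, div_mul_div_comm, pow_add]
          commutes' := by
            intro c
            change f _ = _
            rw [IsScalarTower.algebraMap_apply ℂ P B, hP]
            exact ev.commutes c }
      refine ⟨⟨χ, hP⟩, ?_⟩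
      apply Subtype.ext
      change f θ = z
      rw [key θ 0 X (by simp)]
      simp
  · rw [linearIndependent_iff']
    intro s c hc i hi
    have h0 : aeval θ (∑ i ∈ s, C (c i) * X ^ (i : ℕ)) = 0 := by
      rw [map_sum, ← hc]
      refine Finset.sum_congr rfl fun i _ => ?_
      rw [map_mul, aeval_C, map_pow, aeval_X, Algebra.smul_def]
    have h1 := hdvd _ h0
    have h2 : (∑ i ∈ s, C (c i) * X ^ (i : ℕ) : P[X]) = 0 := by
      by_contra hne
      have hdeg : (∑ i ∈ s, C (c i) * X ^ (i : ℕ) : P[X]).degree < h.degree := by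
        rw [degree_eq_natDegree hmonic.ne_zero]
        refine lt_of_le_of_lt (degree_sum_le _ _) ?_
        rw [Finset.sup_lt_iff (WithBot.bot_lt_coe _)]
        intro j _
        refine lt_of_le_of_lt (degree_C_mul_X_pow_le _ _) ?_
        exact_mod_cast j.2
      exact hmonic.not_dvd_of_degree_lt hne hdeg h1
    have h3 := congrArg (fun p => coeff p (i : ℕ)) h2
    simp only [finsetSum_coeff, coeff_C_mul, coeff_X_pow, coeff_zero] at h3
    rw [Finset.sum_eq_single i] at h3
    · simpa using h3
    · intro j _ hj
      rw [if_neg (fun h => hj (Fin.ext h.symm)), mul_zero]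
    · exact fun h => absurd hi h
  · intro x
    obtain ⟨p, hp, w, hw⟩ := hθ' x
    refine ⟨p, hp, ?_⟩
    rw [hw, ← modByMonic_add_div w h, map_add, map_mul, hroot, zero_mul, add_zero]
    by_cases hd : h.natDegree = 0
    · have : h = 1 := Polynomial.eq_one_of_monic_natDegree_zero hmonic hd
      rw [this, modByMonic_one, map_zero]
      exact zero_mem _
    · rw [aeval_eq_sum_range' (n := h.natDegree) (natDegree_modByMonic_lt w hmonic
        (fun h1 => hd (by rw [h1, natDegree_one])))]
      refine Submodule.sum_mem _ fun i hi => Submodule.smul_mem _ _ (Submodule.subset_span ?_)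
      exact ⟨⟨i, Finset.mem_range.1 hi⟩, rfl⟩
end

section
theorem isAlg_mv {B τ : Type} [CommRing B] [IsDomain B] [Algebra ℂ B] [Fintype τ] (g : τ → B)
    (hg : AlgebraicIndependent ℂ g) (htr : Algebra.trdeg ℂ B ≤ Fintype.card τ) :
    @Algebra.IsAlgebraic (MvPolynomial τ ℂ) B _ _ (MvPolynomial.aeval g).toAlgebra := by
  have h1 : IsTranscendenceBasis ℂ g :=
    hg.isTranscendenceBasis_of_trdeg_le_of_finite (by simpa using htr)
  have h2 := h1.isAlgebraic
  let _ := (MvPolynomial.aeval (R := ℂ) g).toAlgebra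
  refine Algebra.IsAlgebraic.of_ringHom_of_comp_eq
    (hg.aevalEquiv : MvPolynomial τ ℂ →+* Algebra.adjoin ℂ (Set.range g)) (RingHom.id B)
    hg.aevalEquiv.surjective Function.injective_id ?_
  ext p
  · simp [RingHom.algebraMap_toAlgebra]
  · simp [RingHom.algebraMap_toAlgebra]

theorem exists_rel {B τ : Type} [CommRing B] [Algebra ℂ B] (g : τ → B)
    (hg : ¬ AlgebraicIndependent ℂ g) : ∃ q : MvPolynomial τ ℂ, q ≠ 0 ∧ MvPolynomial.aeval g q = 0 := by
  rw [algebraicIndependent_iff] at hg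
  push Not at hg
  obtain ⟨p, hp, hp0⟩ := hg
  exact ⟨p, hp0, hp⟩

theorem alghom_aeval {B τ : Type} [CommRing B] [Algebra ℂ B] (g : τ → B) (χ : B →ₐ[ℂ] ℂ)
    (p : MvPolynomial τ ℂ) : χ (MvPolynomial.aeval g p) = MvPolynomial.eval (fun j => χ (g j)) p := by
  rw [← AlgHom.comp_apply, MvPolynomial.comp_aeval, MvPolynomial.aeval_eq_eval]

theorem gfc_a {B τ : Type} [CommRing B] [IsDomain B] [Algebra ℂ B] [Fintype τ] (g : τ → B)
    (htr : Algebra.trdeg ℂ B ≤ Fintype.card τ) (p : B) (hp : p ≠ 0) :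
    ∃ q : MvPolynomial τ ℂ, q ≠ 0 ∧ ∀ χ : B →ₐ[ℂ] ℂ,
      MvPolynomial.eval (fun j => χ (g j)) q ≠ 0 → χ p ≠ 0 := by
  by_cases hg : AlgebraicIndependent ℂ g
  · have h := isAlg_mv g hg htr
    let _ := (MvPolynomial.aeval (R := ℂ) g).toAlgebra
    obtain ⟨r, hr, c, hc⟩ := (h.isAlgebraic p).exists_nonzero_dvd (mem_nonZeroDivisors_of_ne_zero hp)
    refine ⟨r, hr, fun χ hχ h0 => hχ ?_⟩
    rw [← alghom_aeval]
    have : MvPolynomial.aeval g r = p * c := hc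
    rw [this, map_mul, h0, zero_mul]
  · obtain ⟨q, hq, hq0⟩ := exists_rel g hg
    refine ⟨q, hq, fun χ hχ => absurd ?_ hχ⟩
    rw [← alghom_aeval, hq0, map_zero]

theorem gfc {B τ : Type} [CommRing B] [IsDomain B] [Algebra ℂ B] [Algebra.FiniteType ℂ B] [Fintype τ]
    (g : τ → B) (htr : Algebra.trdeg ℂ B ≤ Fintype.card τ) :
    ∃ (δ : ℕ) (q : MvPolynomial τ ℂ), q ≠ 0 ∧
      (∀ a : τ → ℂ, MvPolynomial.eval a q ≠ 0 →
        Nat.card {χ : B →ₐ[ℂ] ℂ // ∀ j, χ (g j) = a j} = δ) ∧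
      (AlgebraicIndependent ℂ g → ∃ b : Fin δ → B,
        (∀ p : Fin δ → MvPolynomial τ ℂ, ∑ i, MvPolynomial.aeval g (p i) * b i = 0 → p = 0) ∧
        ∀ x : B, ∃ p0 : MvPolynomial τ ℂ, p0 ≠ 0 ∧ ∃ p : Fin δ → MvPolynomial τ ℂ,
          MvPolynomial.aeval g p0 * x = ∑ i, MvPolynomial.aeval g (p i) * b i) := by
  by_cases hg : AlgebraicIndependent ℂ g
  · have h := isAlg_mv g hg htr
    let _ := (MvPolynomial.aeval (R := ℂ) g).toAlgebra
    have hst : IsScalarTower ℂ (MvPolynomial τ ℂ) B := by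
      refine IsScalarTower.of_algebraMap_eq fun x => ?_
      simp [RingHom.algebraMap_toAlgebra]
    have hf : FaithfulSMul (MvPolynomial τ ℂ) B := by
      rw [faithfulSMul_iff_algebraMap_injective]
      exact hg
    have hft : Algebra.FiniteType (MvPolynomial τ ℂ) B :=
      Algebra.FiniteType.of_restrictScalars_finiteType ℂ (MvPolynomial τ ℂ) B
    have hsm : ∀ (p : MvPolynomial τ ℂ) (x : B), p • x = MvPolynomial.aeval g p * x :=
      fun p x => Algebra.smul_def p x
    obtain ⟨δ, q, hq, hc, b, hb, hb'⟩ := gfc_core (P := MvPolynomial τ ℂ) (B := B)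
    refine ⟨δ, q, hq, ?_, fun _ => ⟨b, ?_, ?_⟩⟩
    · intro a ha
      rw [← hc (MvPolynomial.aeval a) (by rwa [MvPolynomial.aeval_eq_eval])]
      refine Nat.card_congr (Equiv.subtypeEquivRight fun χ => ⟨fun hχ p => ?_, fun hχ j => ?_⟩)
      · change χ (MvPolynomial.aeval g p) = _
        rw [alghom_aeval, MvPolynomial.aeval_eq_eval]
        congr 2
        funext j
        exact hχ j
      · have := hχ (MvPolynomial.X j)
        change χ (MvPolynomial.aeval g (MvPolynomial.X j)) = _ at this
        simpa using this
    · intro p hp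
      rw [Fintype.linearIndependent_iff] at hb
      funext i
      exact hb p (by simpa only [hsm] using hp) i
    · intro x
      obtain ⟨p, hp, hx⟩ := hb' x
      rw [Submodule.mem_span_range_iff_exists_fun] at hx
      obtain ⟨c, hc⟩ := hx
      exact ⟨p, hp, c, by simpa only [hsm] using hc.symm⟩
  · obtain ⟨q, hq, hq0⟩ := exists_rel g hg
    refine ⟨0, q, hq, ?_, fun h => absurd h hg⟩
    intro a ha
    rw [Nat.card_eq_zero]
    left
    refine ⟨fun ⟨χ, hχ⟩ => ha ?_⟩
    have := alghom_aeval g χ q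
    rw [hq0, map_zero] at this
    rw [this]
    congr 2
    funext j
    exact (hχ j).symm
end

section
noncomputable section
theorem card_deg_le (D k : ℕ) : Nat.card {n : Fin D →₀ ℕ | n.degree ≤ k} = (k + D).choose D := by
  have h2 : Nat.card {n : Fin D →₀ ℕ | n.degree ≤ k} = (D + 1).multichoose k := by
    have hset : ∀ k : ℕ, {n : Fin D →₀ ℕ | n.degree ≤ k} =
        ((Finset.range (k + 1)).biUnion (fun j => (Finset.univ : Finset (Fin D)).finsuppAntidiag j) : Finset (Fin D →₀ ℕ)) := by
      intro k
      ext n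
      simp only [Finset.coe_biUnion, Set.mem_iUnion, Set.mem_ofPred_eq, Finset.mem_coe, Finset.mem_range,
        Finset.mem_finsuppAntidiag, Finset.subset_univ, and_true, exists_prop, Nat.lt_succ_iff]
      rw [Finsupp.degree_eq_sum]
      constructor
      · intro h; exact ⟨_, h, rfl⟩
      · rintro ⟨i, hi, h⟩; rw [h]; exact hi
    have hsum : ∀ k : ℕ, ∑ j ∈ Finset.range (k + 1), D.multichoose j = (D + 1).multichoose k := by
      intro k
      induction k with
      | zero => simp
      | succ k ih => rw [Finset.sum_range_succ, ih, Nat.multichoose_succ_succ, add_comm]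
    rw [hset, Nat.card_coe_set_eq, Set.ncard_coe_finset, Finset.card_biUnion, ← hsum]
    · refine Finset.sum_congr rfl fun j _ => ?_
      rw [Finset.card_finsuppAntidiag_nat_eq_multichoose, Finset.card_univ, Fintype.card_fin]
    · intro i _ j _ hij
      rw [Function.onFun, Finset.disjoint_left]
      intro n hn hn'
      rw [Finset.mem_finsuppAntidiag] at hn hn'
      exact hij (hn.1.symm.trans hn'.1)
  rw [h2, Nat.multichoose_eq]
  rw [show D + 1 + k - 1 = k + D by omega]
  exact Nat.choose_symm_add

open MvPolynomial in
theorem finrank_rtd (D k : ℕ) :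
    Module.finrank ℂ (restrictTotalDegree (Fin D) ℂ k) = (k + D).choose D := by
  have h1 : Module.finrank ℂ (restrictTotalDegree (Fin D) ℂ k) =
      Nat.card {n : Fin D →₀ ℕ | n.degree ≤ k} :=
    Module.finrank_eq_nat_card_basis (basisRestrictSupport ℂ {n : Fin D →₀ ℕ | n.degree ≤ k})
  rw [h1, card_deg_le]

open MvPolynomial in
theorem aeval_mem_pow {B : Type} [CommRing B] [Algebra ℂ B] {τ : Type} (g : τ → B)
    (V : Submodule ℂ B) (h1 : (1 : B) ∈ V) (hV : ∀ i, g i ∈ V) (k : ℕ) (p : MvPolynomial τ ℂ)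
    (hp : p.totalDegree ≤ k) : aeval g p ∈ V ^ k := by
  have hmono : ∀ a b : ℕ, a ≤ b → V ^ a ≤ V ^ b := fun a b hab =>
    pow_le_pow_right₀ (by rwa [Submodule.one_le]) hab
  rw [p.as_sum, map_sum]
  refine Submodule.sum_mem _ fun s hs => ?_
  rw [aeval_monomial, ← Algebra.smul_def]
  refine Submodule.smul_mem _ _ ?_
  have hs' : s.degree ≤ k := (le_totalDegree hs).trans hp
  refine hmono _ _ hs' ?_
  clear hs' hs
  induction s using Finsupp.induction with
  | zero => simpa using Submodule.mem_one.2 ⟨1, by simp⟩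
  | single_add a n f ha hn ih =>
    rw [Finsupp.prod_add_index' (by simp) (by intros; rw [pow_add]), map_add, pow_add,
      Finsupp.prod_single_index (by simp), Finsupp.degree_single]
    exact Submodule.mul_mem_mul (Submodule.pow_mem_pow _ (hV a) _) ih

/-- linear combinations of `b` with coefficients polynomials in `g` of degree at most `k`. -/
def combMap {B : Type} [CommRing B] [Algebra ℂ B] {D δ : ℕ} (g : Fin D → B) (b : Fin δ → B) (k : ℕ) :
    (Fin δ → MvPolynomial.restrictTotalDegree (Fin D) ℂ k) →ₗ[ℂ] B where
  toFun p := ∑ i, MvPolynomial.aeval g (p i : MvPolynomial (Fin D) ℂ) * b i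
  map_add' p q := by simp [add_mul, Finset.sum_add_distrib]
  map_smul' c p := by simp [Finset.smul_sum]

open MvPolynomial in
/-- Hilbert function estimate. -/
theorem hilb {B : Type} [CommRing B] [IsDomain B] [Algebra ℂ B] {D δ : ℕ}
    (V : Submodule ℂ B) [FiniteDimensional ℂ V] (h1 : (1 : B) ∈ V) (hgen : ∀ x : B, ∃ s : ℕ, x ∈ V ^ s)
    (g : Fin D → B) (hg : AlgebraicIndependent ℂ g) (hgV : ∀ i, g i ∈ V) (e : ℕ)
    (hW : V ^ (e + 1) ≤ V ^ e * Submodule.span ℂ (insert 1 (Set.range g)))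
    (b : Fin δ → B)
    (hb : ∀ p : Fin δ → MvPolynomial (Fin D) ℂ, ∑ i, MvPolynomial.aeval g (p i) * b i = 0 → p = 0)
    (hb' : ∀ x : B, ∃ p0 : MvPolynomial (Fin D) ℂ, p0 ≠ 0 ∧ ∃ p : Fin δ → MvPolynomial (Fin D) ℂ,
          MvPolynomial.aeval g p0 * x = ∑ i, MvPolynomial.aeval g (p i) * b i) :
    ∃ s : ℕ, ∀ k : ℕ, δ * (k + D).choose D ≤ Module.finrank ℂ (V ^ (k + s) : Submodule ℂ B) ∧
      Module.finrank ℂ (V ^ k : Submodule ℂ B) ≤ δ * (k + s + D).choose D := by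
  have hmono : ∀ a b : ℕ, a ≤ b → V ^ a ≤ V ^ b := fun a b hab =>
    pow_le_pow_right₀ (by rwa [Submodule.one_le]) hab
  have hfin : ∀ k : ℕ, FiniteDimensional ℂ (V ^ k : Submodule ℂ B) := fun k =>
    Module.Finite.iff_fg.2 ((Module.Finite.iff_fg.1 ‹_›).pow k)
  have hdim : ∀ k, Module.finrank ℂ (Fin δ → restrictTotalDegree (Fin D) ℂ k) = δ * (k + D).choose D := by
    intro k
    rw [Module.finrank_pi_fintype, Finset.sum_const, finrank_rtd, Finset.card_univ, Fintype.card_fin,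
      smul_eq_mul]
  -- lower bound
  obtain ⟨s1, hs1⟩ : ∃ s : ℕ, ∀ i, b i ∈ V ^ s := by
    choose S hS using fun i => hgen (b i)
    exact ⟨Finset.univ.sup S, fun i => hmono _ _ (Finset.le_sup (Finset.mem_univ i)) (hS i)⟩
  have hlow : ∀ s k : ℕ, s1 ≤ s → δ * (k + D).choose D ≤ Module.finrank ℂ (V ^ (k + s) : Submodule ℂ B) := by
    intro s k hs
    rw [← hdim k]
    have hmem : ∀ p, combMap g b k p ∈ V ^ (k + s) := by
      intro p
      change ∑ i, MvPolynomial.aeval g (p i : MvPolynomial (Fin D) ℂ) * b i ∈ _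
      refine Submodule.sum_mem _ fun i _ => ?_
      rw [pow_add]
      exact Submodule.mul_mem_mul (aeval_mem_pow g V h1 hgV k _ ((mem_restrictTotalDegree _ _ _).1 (p i).2))
        (hmono _ _ hs (hs1 i))
    refine LinearMap.finrank_le_finrank_of_injective (f := (combMap g b k).codRestrict _ hmem) ?_
    rw [← LinearMap.ker_eq_bot, LinearMap.ker_codRestrict, LinearMap.ker_eq_bot']
    intro p hp
    have := hb (fun i => p i) hp
    funext i
    exact Subtype.ext (congrFun this i)
  -- upper bound
  obtain ⟨q, hq, h, hqh⟩ : ∃ q : B, q ≠ 0 ∧ ∃ h : ℕ, ∀ x ∈ V ^ e, q * x ∈ LinearMap.range (combMap g b h) := by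
    obtain ⟨t, ht⟩ := Module.Finite.iff_fg.1 (hfin e)
    choose p0 hp0 p hp using hb'
    classical
    refine ⟨aeval g (∏ x ∈ t, p0 x), ?_, (∑ x ∈ t, (p0 x).totalDegree) + t.sup (fun x => Finset.univ.sup fun i => (p x i).totalDegree), ?_⟩
    · intro h0
      have := (algebraicIndependent_iff.1 hg) _ h0
      exact (Finset.prod_ne_zero_iff.2 fun x _ => hp0 x) this
    · intro x hx
      rw [← ht] at hx
      induction hx using Submodule.span_induction with
      | mem x hx =>
        refine ⟨fun i => ⟨(∏ y ∈ t.erase x, p0 y) * p x i, ?_⟩, ?_⟩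
        · rw [mem_restrictTotalDegree]
          refine (totalDegree_mul _ _).trans (add_le_add ?_ ?_)
          · exact (totalDegree_finsetProd _ _).trans
              (Finset.sum_le_sum_of_subset (Finset.erase_subset _ _))
          · exact (Finset.le_sup (f := fun i => (p x i).totalDegree) (Finset.mem_univ i)).trans
              (Finset.le_sup (f := fun x => Finset.univ.sup fun i => (p x i).totalDegree) hx)
        · rw [← Finset.mul_prod_erase _ _ hx, map_mul, mul_comm (aeval g (p0 x)), mul_assoc, hp, Finset.mul_sum]
          simp only [combMap, LinearMap.coe_mk, AddHom.coe_mk, map_mul, mul_assoc]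
      | zero => rw [mul_zero]; exact zero_mem _
      | add x y _ _ hx hy => rw [mul_add]; exact add_mem hx hy
      | smul c x _ hx => rw [mul_smul_comm]; exact Submodule.smul_mem _ _ hx
  have hstep : ∀ k : ℕ, ∀ x ∈ V ^ (e + k), q * x ∈ LinearMap.range (combMap g b (h + k)) := by
    intro k
    induction k with
    | zero => exact hqh
    | succ k ih =>
      intro x hx
      have hle : V ^ (e + (k + 1)) ≤ V ^ (e + k) * Submodule.span ℂ (insert 1 (Set.range g)) := by
        calc V ^ (e + (k + 1)) = V ^ k * V ^ (e + 1) := by rw [← pow_add]; congr 1; omega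
          _ ≤ V ^ k * (V ^ e * Submodule.span ℂ (insert 1 (Set.range g))) := by gcongr
          _ = _ := by rw [← mul_assoc, ← pow_add, add_comm k e]
      refine Submodule.mul_induction_on (hle hx) ?_ ?_
      · intro m hm w hw
        obtain ⟨p, hp⟩ := ih m hm
        rw [← mul_assoc, ← hp]
        induction hw using Submodule.span_induction with
        | mem w hw =>
          obtain ⟨z, hz, rfl⟩ : ∃ z : MvPolynomial (Fin D) ℂ, z.totalDegree ≤ 1 ∧ aeval g z = w := by
            rcases hw with rfl | ⟨i, rfl⟩
            · exact ⟨1, by simp, by simp⟩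
            · exact ⟨X i, by simp, by simp⟩
          refine ⟨fun i => ⟨z * p i, ?_⟩, ?_⟩
          · rw [mem_restrictTotalDegree]
            have := (mem_restrictTotalDegree _ _ _).1 (p i).2
            refine (totalDegree_mul _ _).trans ?_
            omega
          · simp only [combMap, LinearMap.coe_mk, AddHom.coe_mk, map_mul, Finset.sum_mul]
            refine Finset.sum_congr rfl fun i _ => by ring
        | zero => rw [mul_zero]; exact zero_mem _
        | add x y _ _ hx hy => rw [mul_add]; exact add_mem hx hy
        | smul c x _ hx => rw [mul_smul_comm]; exact Submodule.smul_mem _ _ hx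
      · intro x y hx hy
        rw [mul_add]; exact add_mem hx hy
  have hup : ∀ k : ℕ, Module.finrank ℂ (V ^ k : Submodule ℂ B) ≤ δ * (k + h + D).choose D := by
    intro k
    have hle : V ^ k ≤ V ^ (e + k) := hmono _ _ (by omega)
    refine (Submodule.finrank_mono hle).trans ?_
    rw [add_comm k h, ← hdim]
    refine le_trans ?_ (LinearMap.finrank_range_le (combMap g b (h + k)))
    let μ : (V ^ (e + k) : Submodule ℂ B) →ₗ[ℂ] LinearMap.range (combMap g b (h + k)) :=
      ((LinearMap.mulLeft ℂ q).domRestrict _).codRestrict _ (fun x => hstep k x.1 x.2)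
    refine LinearMap.finrank_le_finrank_of_injective (f := μ) ?_
    intro x y hxy
    have : q * x = q * y := congrArg Subtype.val hxy
    exact Subtype.ext (mul_left_cancel₀ hq this)
  refine ⟨max s1 h, fun k => ⟨hlow _ k (le_max_left _ _), (hup k).trans ?_⟩⟩
  gcongr
  exact le_max_right _ _
end
end

section
noncomputable section
open Filter Topology in
theorem choose_lim (D a : ℕ) :
    Tendsto (fun k : ℕ => ((k + a).choose D : ℝ) / (k : ℝ) ^ D) atTop (𝓝 ((D.factorial : ℝ)⁻¹)) := by
  have hz : ∀ᶠ n : ℕ in atTop, ((n : ℝ) ^ D / D.factorial : ℝ) ≠ 0 := by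
    filter_upwards [eventually_gt_atTop 0] with n hn
    have : (0 : ℝ) < n := by exact_mod_cast hn
    positivity
  have h1 := (Asymptotics.isEquivalent_iff_tendsto_one hz).1 (isEquivalent_choose D)
  have h2 := (tendsto_add_atTop_iff_nat a).2 h1
  have h3 : Tendsto (fun k : ℕ => (((k : ℝ) + a) / k) ^ D) atTop (𝓝 1) := by
    have h4 : Tendsto (fun k : ℕ => 1 + (a : ℝ) / (k : ℝ)) atTop (𝓝 (1 + 0)) :=
      tendsto_const_nhds.add (tendsto_const_div_atTop_nhds_zero_nat (a : ℝ))
    have h5 := h4.pow D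
    rw [add_zero, one_pow] at h5
    refine h5.congr' ?_
    filter_upwards [eventually_gt_atTop 0] with n hn
    have : (0 : ℝ) < n := by exact_mod_cast hn
    congr 1
    field_simp
  have h6 := (h2.mul h3).mul_const ((D.factorial : ℝ)⁻¹)
  rw [one_mul, one_mul] at h6
  refine h6.congr' ?_
  filter_upwards [eventually_gt_atTop 0] with n hn
  have h7 : (0 : ℝ) < n := by exact_mod_cast hn
  have h8 : (0 : ℝ) < D.factorial := by exact_mod_cast D.factorial_pos
  have h9 : (0 : ℝ) < (n : ℝ) + a := by positivity
  simp only [Pi.div_apply]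
  push_cast
  rw [div_pow]
  field_simp

theorem deg_compare (δ δ' D E s : ℕ)
    (h1 : ∀ k, δ' * (k + (D + E)).choose (D + E) ≤ δ * (k + s + D).choose D * (k + s + E).choose E)
    (h2 : ∀ k, δ * (k + D).choose D * (k + E).choose E ≤ δ' * (k + s + (D + E)).choose (D + E)) :
    δ' = δ * (D + E).choose D := by
  have l1 := (choose_lim (D + E) (D + E)).const_mul (δ' : ℝ)
  have l1' := (choose_lim (D + E) (s + (D + E))).const_mul (δ' : ℝ)
  have l2 := ((choose_lim D (s + D)).mul (choose_lim E (s + E))).const_mul (δ : ℝ)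
  have l2' := ((choose_lim D D).mul (choose_lim E E)).const_mul (δ : ℝ)
  have e1 : (δ' : ℝ) * ((D + E).factorial : ℝ)⁻¹ ≤ δ * ((D.factorial : ℝ)⁻¹ * (E.factorial : ℝ)⁻¹) := by
    refine le_of_tendsto_of_tendsto l1 l2 ?_
    filter_upwards [Filter.eventually_gt_atTop 0] with k hk
    have hk' : (0 : ℝ) < k := by exact_mod_cast hk
    rw [div_mul_div_comm, ← pow_add, ← mul_div_assoc, ← mul_div_assoc]
    refine div_le_div_of_nonneg_right ?_ (by positivity)
    have := h1 k
    rw [add_assoc, add_assoc, mul_assoc] at this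
    exact_mod_cast this
  have e2 : δ * ((D.factorial : ℝ)⁻¹ * (E.factorial : ℝ)⁻¹) ≤ (δ' : ℝ) * ((D + E).factorial : ℝ)⁻¹ := by
    refine le_of_tendsto_of_tendsto l2' l1' ?_
    filter_upwards [Filter.eventually_gt_atTop 0] with k hk
    have hk' : (0 : ℝ) < k := by exact_mod_cast hk
    rw [div_mul_div_comm, ← pow_add, ← mul_div_assoc, ← mul_div_assoc]
    refine div_le_div_of_nonneg_right ?_ (by positivity)
    have := h2 k
    rw [add_assoc, mul_assoc] at this
    exact_mod_cast this
  have e := le_antisymm e1 e2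
  have hc : ((D + E).choose D : ℝ) * D.factorial * E.factorial = (D + E).factorial := by
    have := Nat.add_choose_mul_factorial_mul_factorial D E
    rw [Nat.choose_symm_add.symm] at this
    exact_mod_cast this
  have p1 : (0 : ℝ) < D.factorial := by exact_mod_cast D.factorial_pos
  have p2 : (0 : ℝ) < E.factorial := by exact_mod_cast E.factorial_pos
  have p3 : (0 : ℝ) < (D + E).factorial := by exact_mod_cast (D + E).factorial_pos
  have : (δ' : ℝ) = δ * ((D + E).choose D : ℝ) := by
    field_simp at e
    rw [← hc] at e
    have p4 : (D.factorial : ℝ) * E.factorial ≠ 0 := by positivity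
    apply mul_right_cancel₀ p4
    linarith
  exact_mod_cast this
end
end

section
noncomputable section
open MvPolynomial

/-- polynomials of degree at most `d` with coefficients in `W`. -/
def polyIn {B : Type} [CommRing B] [Algebra ℂ B] (E : ℕ) (W : Submodule ℂ B) (d : ℕ) :
    Submodule ℂ (MvPolynomial (Fin E) B) where
  carrier := {p | p.totalDegree ≤ d ∧ ∀ n, coeff n p ∈ W}
  add_mem' := by
    rintro p q ⟨hp, hp'⟩ ⟨hq, hq'⟩
    exact ⟨(totalDegree_add _ _).trans (max_le hp hq), fun n => by rw [coeff_add]; exact add_mem (hp' n) (hq' n)⟩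
  zero_mem' := ⟨by simp, fun n => by simp⟩
  smul_mem' := by
    rintro c p ⟨hp, hp'⟩
    exact ⟨(totalDegree_smul_le _ _).trans hp, fun n => by rw [coeff_smul]; exact Submodule.smul_mem _ _ (hp' n)⟩

theorem finrank_polyIn {B : Type} [CommRing B] [Algebra ℂ B] (E : ℕ) (W : Submodule ℂ B)
    [FiniteDimensional ℂ W] (d : ℕ) :
    Module.finrank ℂ (polyIn E W d) = Module.finrank ℂ W * (d + E).choose E := by
  have hcard := card_deg_le E d
  have hfin : Finite {n : Fin E →₀ ℕ | n.degree ≤ d} :=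
    Nat.finite_of_card_ne_zero (by rw [hcard]; exact (Nat.choose_pos (by omega)).ne')
  let _ := Fintype.ofFinite {n : Fin E →₀ ℕ | n.degree ≤ d}
  let φ : polyIn E W d →ₗ[ℂ] ({n : Fin E →₀ ℕ | n.degree ≤ d} → W) :=
    { toFun := fun p n => ⟨coeff n.1 p.1, p.2.2 n.1⟩
      map_add' := fun p q => by funext n; apply Subtype.ext; simp
      map_smul' := fun c p => by funext n; apply Subtype.ext; simp }
  have hφ : Function.Bijective φ := by
    constructor
    · intro p q hpq
      apply Subtype.ext
      ext n
      by_cases hn : n.degree ≤ d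
      · exact congrArg Subtype.val (congrFun hpq ⟨n, hn⟩)
      · rw [coeff_eq_zero_of_totalDegree_lt, coeff_eq_zero_of_totalDegree_lt]
        · exact lt_of_le_of_lt q.2.1 (not_le.1 hn)
        · exact lt_of_le_of_lt p.2.1 (not_le.1 hn)
    · intro f
      classical
      have hco : ∀ n, coeff n (∑ k : {n : Fin E →₀ ℕ | n.degree ≤ d}, monomial k.1 (f k : B)) =
          if h : n.degree ≤ d then (f ⟨n, h⟩ : B) else 0 := by
        intro n
        rw [coeff_sum]
        simp only [coeff_monomial]
        split_ifs with h
        · rw [Finset.sum_eq_single ⟨n, h⟩]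
          · simp
          · intro b _ hb
            rw [if_neg]
            exact fun h' => hb (Subtype.ext h')
          · simp
        · refine Finset.sum_eq_zero fun b _ => ?_
          rw [if_neg]
          rintro rfl
          exact h b.2
      refine ⟨⟨∑ k : {n : Fin E →₀ ℕ | n.degree ≤ d}, monomial k.1 (f k : B), ?_, ?_⟩, ?_⟩
      · refine (totalDegree_finsetSum_le (d := d) fun k _ => ?_)
        exact (totalDegree_monomial_le _ _).trans k.2
      · intro n
        rw [hco]
        split_ifs with h
        · exact (f _).2
        · exact zero_mem _
      · funext n
        apply Subtype.ext
        change coeff n.1 _ = _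
        rw [hco]
        exact dif_pos n.2
  rw [(LinearEquiv.ofBijective φ hφ).finrank_eq, Module.finrank_pi_fintype, Finset.sum_const, Finset.card_univ,
    ← Nat.card_eq_fintype_card, hcard, smul_eq_mul, mul_comm]

/-- spanning family of the extended space. -/
def yExt {B ι : Type} [CommRing B] [Algebra ℂ B] (E : ℕ) (x : ι → B) :
    ι × Option (Fin E) → MvPolynomial (Fin E) B :=
  fun ij => C (x ij.1) * (ij.2.elim 1 X)

theorem yExt_span {B ι : Type} [CommRing B] [Algebra ℂ B] (E : ℕ) (x : ι → B) :
    Submodule.span ℂ (Set.range (yExt E x)) =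
      (Submodule.span ℂ (Set.range x)).map (IsScalarTower.toAlgHom ℂ B (MvPolynomial (Fin E) B)).toLinearMap *
        Submodule.span ℂ (insert 1 (Set.range (X : Fin E → MvPolynomial (Fin E) B))) := by
  rw [Submodule.map_span, Submodule.span_mul_span]
  congr 1
  ext p
  simp only [Set.mem_range, Set.mem_mul, Set.mem_image, Set.mem_insert_iff, Prod.exists]
  constructor
  · rintro ⟨i, j, rfl⟩
    refine ⟨_, ⟨_, ⟨i, rfl⟩, rfl⟩, j.elim 1 X, ?_, rfl⟩
    cases j with
    | none => left; rfl
    | some j => right; exact ⟨j, rfl⟩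
  · rintro ⟨_, ⟨_, ⟨i, rfl⟩, rfl⟩, y, hy, rfl⟩
    rcases hy with rfl | ⟨j, rfl⟩
    · exact ⟨i, none, rfl⟩
    · exact ⟨i, some j, rfl⟩

theorem yExt_pow {B ι : Type} [CommRing B] [Algebra ℂ B] (E : ℕ) (x : ι → B) 
    (h1 : (1 : B) ∈ Submodule.span ℂ (Set.range x)) (d : ℕ) :
    (Submodule.span ℂ (Set.range (yExt E x))) ^ d = polyIn E (Submodule.span ℂ (Set.range x) ^ d) d := by
  set V := Submodule.span ℂ (Set.range x) with hV
  apply le_antisymm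
  · induction d with
    | zero =>
      rw [pow_zero, pow_zero, Submodule.one_le]
      refine ⟨by simp, fun n => ?_⟩
      classical
      rw [coeff_one]
      split_ifs
      · exact Submodule.mem_one.2 ⟨1, by simp⟩
      · exact zero_mem _
    | succ d ih =>
      have h2 : Submodule.span ℂ (Set.range (yExt E x)) ≤ polyIn E V 1 := by
        rw [Submodule.span_le]
        rintro _ ⟨⟨i, j⟩, rfl⟩
        have hx : x i ∈ V := Submodule.subset_span ⟨i, rfl⟩
        classical
        cases j with
        | none =>
          simp only [yExt, Option.elim, mul_one]
          refine ⟨by simp, fun n => ?_⟩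
          rw [coeff_C]
          split_ifs
          · exact hx
          · exact zero_mem _
        | some j =>
          simp only [yExt, Option.elim]
          refine ⟨?_, fun n => ?_⟩
          · refine (totalDegree_mul _ _).trans ?_
            rw [totalDegree_C, zero_add, X]
            refine (totalDegree_monomial_le _ _).trans ?_
            simp
          · rw [coeff_C_mul, coeff_X]
            split_ifs
            · simpa using hx
            · simp
      rw [pow_succ]
      refine (mul_le_mul' ih h2).trans ?_
      rw [Submodule.mul_le]
      rintro p ⟨hp, hp'⟩ q ⟨hq, hq'⟩
      refine ⟨(totalDegree_mul _ _).trans (add_le_add hp hq), fun n => ?_⟩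
      classical
      rw [coeff_mul]
      refine Submodule.sum_mem _ fun k _ => ?_
      rw [pow_succ]
      exact Submodule.mul_mem_mul (hp' _) (hq' _)
  · rintro p ⟨hp, hp'⟩
    rw [yExt_span, mul_pow, ← Submodule.map_pow, p.as_sum]
    refine Submodule.sum_mem _ fun n hn => ?_
    have h3 : monomial n (coeff n p) = (IsScalarTower.toAlgHom ℂ B (MvPolynomial (Fin E) B)) (coeff n p) *
        (aeval X (monomial n (1 : ℂ))) := by
      rw [aeval_monomial, map_one, one_mul, monomial_eq]
      rfl
    rw [h3]
    refine Submodule.mul_mem_mul (Submodule.mem_map_of_mem (hp' n)) ?_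
    refine aeval_mem_pow _ _ (Submodule.subset_span (Set.mem_insert _ _))
      (fun i => Submodule.subset_span (Set.mem_insert_of_mem _ (Set.mem_range_self i))) d _ ?_
    refine (totalDegree_monomial_le _ _).trans ?_
    exact (le_totalDegree hn).trans hp
end
end

section
noncomputable section
open MvPolynomial

theorem noether_step {B : Type} [CommRing B] [Algebra ℂ B] {j k : ℕ} (M : Fin (j + 1) → B)
    (γ : Fin (j + 1) → ℂ) (hγl : γ (Fin.last j) = 1)
    (f : MvPolynomial (Fin (j + 1)) ℂ) (hf : aeval M f = 0) (hk : f.totalDegree = k + 1)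
    (hγ : eval γ (homogeneousComponent (k + 1) f) ≠ 0)
    (W W' : Submodule ℂ B) (hW : W = Submodule.span ℂ (insert 1 (Set.range M)))
    (hW' : W' = Submodule.span ℂ (insert 1 (Set.range fun i : Fin j => M i.castSucc - γ i.castSucc • M (Fin.last j)))) :
    W ^ (k + 1) ≤ W ^ k * W' := by
  set T := M (Fin.last j) with hT
  have h1W : (1 : B) ∈ W := by rw [hW]; exact Submodule.subset_span (Set.mem_insert _ _)
  have hMW : ∀ i, M i ∈ W := fun i => by
    rw [hW]; exact Submodule.subset_span (Set.mem_insert_of_mem _ (Set.mem_range_self i))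
  have h1W' : (1 : B) ∈ W' := by rw [hW']; exact Submodule.subset_span (Set.mem_insert _ _)
  have hdW' : ∀ i, M i - γ i • T ∈ W' := by
    intro i
    refine Fin.lastCases ?_ (fun i => ?_) i
    · rw [hγl, one_smul, sub_self]; exact zero_mem _
    · rw [hW']; exact Submodule.subset_span (Set.mem_insert_of_mem _ ⟨i, rfl⟩)
  -- monomials
  have hmon : ∀ s : Fin (j + 1) →₀ ℕ, ∀ d, s.degree = d + 1 →
      (s.prod fun i n => M i ^ n) - (s.prod fun i n => γ i ^ n) • T ^ (d + 1) ∈ W ^ d * W' := by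
    have hmem : ∀ s : Fin (j + 1) →₀ ℕ, (s.prod fun i n => M i ^ n) ∈ W ^ s.degree := by
      intro s
      have := aeval_mem_pow M W h1W hMW s.degree (monomial s (1 : ℂ)) (totalDegree_monomial_le _ _)
      rwa [aeval_monomial, map_one, one_mul] at this
    have hstep : ∀ (s : Fin (j + 1) →₀ ℕ) (i : Fin (j + 1)),
        ((∀ d, s.degree = d + 1 → (s.prod fun i n => M i ^ n) - (s.prod fun i n => γ i ^ n) • T ^ (d + 1) ∈ W ^ d * W')) →
        ∀ d, (Finsupp.single i 1 + s).degree = d + 1 →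
          ((Finsupp.single i 1 + s).prod fun i n => M i ^ n) -
            ((Finsupp.single i 1 + s).prod fun i n => γ i ^ n) • T ^ (d + 1) ∈ W ^ d * W' := by
      intro s i ih d hd
      rw [map_add, Finsupp.degree_single, add_comm, add_left_inj] at hd
      rw [Finsupp.prod_add_index' (by simp) (by intros; rw [pow_add]),
        Finsupp.prod_add_index' (by simp) (by intros; rw [pow_add]),
        Finsupp.prod_single_index (by simp), Finsupp.prod_single_index (by simp), pow_one, pow_one]
      have e : M i * (s.prod fun i n => M i ^ n) - (γ i * s.prod fun i n => γ i ^ n) • T ^ (d + 1)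
        = (s.prod fun i n => M i ^ n) * (M i - γ i • T) +
          γ i • (T * ((s.prod fun i n => M i ^ n) - (s.prod fun i n => γ i ^ n) • T ^ d)) := by
        simp only [Algebra.smul_def, map_mul]
        ring
      rw [e]
      refine add_mem (Submodule.mul_mem_mul (hd ▸ hmem s) (hdW' i)) (Submodule.smul_mem _ _ ?_)
      cases d with
      | zero =>
        have hs : s = 0 := by
          rwa [Finsupp.degree_eq_zero_iff] at hd
        subst hs
        simp
      | succ d =>
        rw [pow_succ', mul_assoc]
        exact Submodule.mul_mem_mul (hMW _) (ih d hd)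
    intro s
    induction s using Finsupp.induction with
    | zero => intro d hd; simp at hd
    | single_add a n f _ _ ih =>
      clear * - ih hstep
      induction n with
      | zero => simpa using ih
      | succ n ihn =>
        have e : Finsupp.single a (n + 1) + f = Finsupp.single a 1 + (Finsupp.single a n + f) := by
          rw [← add_assoc, ← Finsupp.single_add, add_comm 1 n]
        rw [e]
        exact hstep _ a ihn
  have hTk : T ^ (k + 1) ∈ W ^ k * W' := by
    have hle : W ^ k ≤ W ^ k * W' := by
      intro x hx
      rw [← mul_one x]
      exact Submodule.mul_mem_mul hx h1W'
    have h2 : aeval M f - (eval γ (homogeneousComponent (k + 1) f)) • T ^ (k + 1) ∈ W ^ k * W' := by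
      rw [homogeneousComponent_apply, map_sum, Finset.sum_filter, Finset.sum_smul]
      have hfs : aeval M f = ∑ s ∈ f.support, aeval M (monomial s (coeff s f)) := by
        rw [← map_sum, ← f.as_sum]
      rw [hfs]
      rw [← Finset.sum_sub_distrib]
      refine Submodule.sum_mem _ fun s hs => ?_
      rw [aeval_monomial, ← Algebra.smul_def]
      have hs' : s.degree ≤ k + 1 := hk ▸ (le_totalDegree hs)
      split_ifs with hd
      · rw [eval_monomial, mul_smul, ← smul_sub]
        exact Submodule.smul_mem _ _ (hmon s k hd)
      · rw [zero_smul, sub_zero]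
        refine Submodule.smul_mem _ _ (hle ?_)
        have := aeval_mem_pow M W h1W hMW k (monomial s (1 : ℂ))
          ((totalDegree_monomial_le _ _).trans (by change s.degree ≤ k; omega))
        rwa [aeval_monomial, map_one, one_mul] at this
    rw [hf, zero_sub, neg_mem_iff] at h2
    have h3 := Submodule.smul_mem _ (eval γ (homogeneousComponent (k + 1) f))⁻¹ h2
    rwa [smul_smul, inv_mul_cancel₀ hγ, one_smul] at h3
  have hWT : W ≤ W' ⊔ Submodule.span ℂ {T} := by
    rw [hW, Submodule.span_le]
    rintro x (rfl | ⟨i, rfl⟩)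
    · exact Submodule.mem_sup_left h1W'
    · rw [← sub_add_cancel (M i) (γ i • T)]
      exact add_mem (Submodule.mem_sup_left (hdW' i))
        (Submodule.mem_sup_right (Submodule.smul_mem _ _ (Submodule.mem_span_singleton_self T)))
  have hpow : ∀ i : ℕ, W ^ (i + 1) ≤ W ^ i * W' ⊔ Submodule.span ℂ {T ^ (i + 1)} := by
    intro i
    induction i with
    | zero => simpa using hWT
    | succ i ih =>
      rw [pow_succ' W (i + 1)]
      refine (mul_le_mul' le_rfl ih).trans ?_
      rw [Submodule.mul_sup, ← mul_assoc, ← pow_succ']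
      refine sup_le le_sup_left ((mul_le_mul' hWT le_rfl).trans ?_)
      rw [Submodule.sup_mul, Submodule.span_mul_span, Set.singleton_mul_singleton, ← pow_succ', mul_comm W']
      refine sup_le_sup_right (mul_le_mul' ?_ le_rfl) _
      rw [Submodule.span_singleton_le_iff_mem]
      exact Submodule.pow_mem_pow _ (hMW _) _
  refine (hpow k).trans (sup_le le_rfl ?_)
  rwa [Submodule.span_singleton_le_iff_mem]

theorem homog_eval {σ : Type} {p : MvPolynomial σ ℂ} {k : ℕ} (hp : p.IsHomogeneous k) (c : ℂ) (x : σ → ℂ) :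
    eval (fun i => c * x i) p = c ^ k * eval x p := by
  rw [eval_eq, eval_eq, Finset.mul_sum]
  refine Finset.sum_congr rfl fun s hs => ?_
  have h : s.degree = k := by
    rw [Finsupp.degree_eq_weight_one]
    exact hp (mem_support_iff.1 hs)
  simp only [mul_pow, Finset.prod_mul_distrib, Finset.prod_pow_eq_pow_sum]
  rw [Finsupp.degree_apply] at h
  rw [h]
  ring

theorem exists_eval_ne {σ : Type} (p : MvPolynomial σ ℂ) (hp : p ≠ 0) : ∃ x, eval x p ≠ 0 := by
  by_contra h
  push Not at h
  exact hp (MvPolynomial.funext fun x => by rw [h x, map_zero])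
end
end

section
noncomputable section
open MvPolynomial

theorem noether_density {B ι : Type} [CommRing B] [IsDomain B] [Algebra ℂ B] [Fintype ι] (y : ι → B)
    (V : Submodule ℂ B) (hV : V = Submodule.span ℂ (Set.range y)) (h1 : (1 : B) ∈ V) (D : ℕ)
    (htr : Algebra.trdeg ℂ B ≤ D) (hD : D ≤ Fintype.card ι) :
    ∀ q : MvPolynomial (Fin D × ι) ℂ, q ≠ 0 → ∃ c : Fin D × ι → ℂ, eval c q ≠ 0 ∧
      ∃ e : ℕ, V ^ (e + 1) ≤ V ^ e *
        Submodule.span ℂ (insert 1 (Set.range fun j : Fin D => ∑ i, c (j, i) • y i)) := by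
  classical
  have hyV : ∀ i, y i ∈ V := fun i => by rw [hV]; exact Submodule.subset_span (Set.mem_range_self i)
  refine Nat.decreasingInduction' (P := fun D => 
    ∀ q : MvPolynomial (Fin D × ι) ℂ, q ≠ 0 → ∃ c : Fin D × ι → ℂ, eval c q ≠ 0 ∧
      ∃ e : ℕ, V ^ (e + 1) ≤ V ^ e *
        Submodule.span ℂ (insert 1 (Set.range fun j : Fin D => ∑ i, c (j, i) • y i))) ?_ hD ?_
  · intro j _ hDj ih q hq
    obtain ⟨c, hc, e, he⟩ := ih (rename (fun p : Fin j × ι => (p.1.castSucc, p.2)) q) (by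
      rw [Ne, map_eq_zero_iff _ (rename_injective _ _)]
      · exact hq
      · rintro ⟨a, b⟩ ⟨a', b'⟩ h
        simp only [Prod.mk.injEq, Fin.castSucc_inj] at h
        exact Prod.ext h.1 h.2)
    rw [eval_rename] at hc
    set M : Fin (j + 1) → B := fun a => ∑ i, c (a, i) • y i with hM
    have hMdep : ¬ AlgebraicIndependent ℂ M := by
      intro h
      have h2 := h.cardinalMk_le_trdeg
      have h3 := h2.trans htr
      simp only [Cardinal.mk_fin, Nat.cast_le] at h3
      omega
    obtain ⟨f, hf, hf0⟩ := exists_rel M hMdep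
    obtain ⟨k, hk⟩ : ∃ k, f.totalDegree = k + 1 := by
      refine Nat.exists_eq_succ_of_ne_zero fun h => hf ?_
      rw [totalDegree_eq_zero_iff_eq_C] at h
      rw [h, aeval_C] at hf0
      rw [h, (map_eq_zero_iff _ (FaithfulSMul.algebraMap_injective ℂ B)).1 hf0, C_0]
    set F := homogeneousComponent (k + 1) f with hF
    have hFh : F.IsHomogeneous (k + 1) := homogeneousComponent_isHomogeneous _ _
    have hF0 : F ≠ 0 := by
      intro h
      obtain ⟨s, hs, hs'⟩ := Finset.exists_mem_eq_sup f.support (support_nonempty.2 hf) (fun s => s.sum fun _ e => e)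
      have h2 : s.degree = k + 1 := by
        rw [← hk]; exact hs'.symm
      have h3 := coeff_homogeneousComponent (k + 1) f s
      rw [← hF, h, coeff_zero, if_pos h2] at h3
      exact (mem_support_iff.1 hs) h3.symm
    obtain ⟨γ0, hγ0⟩ := exists_eval_ne (F * X (Fin.last j)) (mul_ne_zero hF0 (X_ne_zero _))
    rw [map_mul, eval_X] at hγ0
    have hγ1 := left_ne_zero_of_mul hγ0
    have hγ2 := right_ne_zero_of_mul hγ0
    -- polynomials in gamma
    let Q1 : MvPolynomial (Fin j) ℂ := aeval (fun a => (Fin.snoc (fun i => X i) 1 : Fin (j + 1) → MvPolynomial (Fin j) ℂ) a) F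
    let Q2 : MvPolynomial (Fin j) ℂ := aeval (fun p : Fin j × ι => C (c (p.1.castSucc, p.2)) - X p.1 * C (c (Fin.last j, p.2))) q
    have e1 : ∀ γ : Fin j → ℂ, eval γ Q1 = eval (Fin.snoc γ 1 : Fin (j + 1) → ℂ) F := by
      intro γ
      simp only [Q1]
      rw [← aeval_eq_eval, ← aeval_eq_eval, ← AlgHom.comp_apply, comp_aeval]
      congr 2
      funext a
      refine Fin.lastCases ?_ (fun i => ?_) a <;> simp
    have e2 : ∀ γ : Fin j → ℂ, eval γ Q2 = eval (fun p : Fin j × ι => c (p.1.castSucc, p.2) - γ p.1 * c (Fin.last j, p.2)) q := by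
      intro γ
      simp only [Q2]
      rw [← aeval_eq_eval, ← aeval_eq_eval, ← AlgHom.comp_apply, comp_aeval]
      congr 2
      funext a
      simp
    have hQ1 : Q1 ≠ 0 := by
      intro h
      have h2 := e1 (fun i => (γ0 (Fin.last j))⁻¹ * γ0 i.castSucc)
      rw [h, map_zero] at h2
      have h3 : (Fin.snoc (fun i => (γ0 (Fin.last j))⁻¹ * γ0 i.castSucc) 1 : Fin (j + 1) → ℂ) =
          fun i => (γ0 (Fin.last j))⁻¹ * γ0 i := by
        funext a
        refine Fin.lastCases ?_ (fun i => ?_) a <;> simp [hγ2]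
      rw [h3, homog_eval hFh] at h2
      exact mul_ne_zero (pow_ne_zero _ (inv_ne_zero hγ2)) hγ1 h2.symm
    have hQ2 : Q2 ≠ 0 := by
      intro h
      have h2 := e2 0
      rw [h, map_zero] at h2
      apply hc
      rw [h2]
      congr 2
      funext p
      simp
    obtain ⟨γ, hγ⟩ := exists_eval_ne (Q1 * Q2) (mul_ne_zero hQ1 hQ2)
    rw [map_mul, e1, e2] at hγ
    refine ⟨_, right_ne_zero_of_mul hγ, e + k, ?_⟩
    have hst := noether_step M (Fin.snoc γ 1) (by simp) f hf0 hk (left_ne_zero_of_mul hγ) _ _ rfl rfl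
    have hsub : (fun i : Fin j => M i.castSucc - (Fin.snoc γ 1 : Fin (j + 1) → ℂ) i.castSucc • M (Fin.last j)) =
        fun a : Fin j => ∑ i, (c (a.castSucc, i) - γ a * c (Fin.last j, i)) • y i := by
      funext a
      simp only [hM, Fin.snoc_castSucc, sub_smul, Finset.sum_sub_distrib, mul_smul, Finset.smul_sum]
    rw [hsub] at hst
    set W := Submodule.span ℂ (insert 1 (Set.range M)) with hW
    set W' := Submodule.span ℂ (insert 1 (Set.range fun a : Fin j => ∑ i, (c (a.castSucc, i) - γ a * c (Fin.last j, i)) • y i)) with hW'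
    have hWV : W ≤ V := by
      rw [hW, Submodule.span_le]
      rintro x (rfl | ⟨i, rfl⟩)
      · exact h1
      · exact Submodule.sum_mem _ fun i _ => Submodule.smul_mem _ _ (hyV i)
    have hpow : ∀ i : ℕ, V ^ (e + i) ≤ V ^ e * W ^ i := by
      intro i
      induction i with
      | zero => simp
      | succ i ih =>
        calc V ^ (e + (i + 1)) = V ^ i * V ^ (e + 1) := by rw [← pow_add]; congr 1; omega
          _ ≤ V ^ i * (V ^ e * W) := mul_le_mul' le_rfl he
          _ = V ^ (e + i) * W := by rw [← mul_assoc, ← pow_add, add_comm i e]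
          _ ≤ V ^ e * W ^ i * W := mul_le_mul' ih le_rfl
          _ = _ := by rw [mul_assoc, ← pow_succ]
    calc V ^ (e + k + 1) ≤ V ^ e * W ^ (k + 1) := hpow (k + 1)
      _ ≤ V ^ e * (W ^ k * W') := mul_le_mul' le_rfl hst
      _ ≤ V ^ e * (V ^ k * W') := by gcongr
      _ = _ := by rw [← mul_assoc, ← pow_add]
  · intro q hq
    let σ := (Fintype.equivFin ι)
    let G : Matrix (Fin (Fintype.card ι)) (Fin (Fintype.card ι)) (MvPolynomial (Fin (Fintype.card ι) × ι) ℂ) :=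
      Matrix.of fun a b => X (a, σ.symm b)
    have hG : ∀ c, eval c G.det = (Matrix.of fun a b => c (a, σ.symm b)).det := by
      intro c
      rw [RingHom.map_det]
      congr 1
      ext a b
      simp [G]
    have hG0 : G.det ≠ 0 := by
      intro h
      have := hG (fun p => if σ p.2 = p.1 then 1 else 0)
      rw [h, map_zero] at this
      have h2 : (Matrix.of fun a b => if σ (σ.symm b) = a then (1 : ℂ) else 0) = (1 : Matrix (Fin (Fintype.card ι)) _ ℂ) := by
        ext a b
        simp [Matrix.one_apply, eq_comm]
      simp only [h2, Matrix.det_one] at this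
      exact zero_ne_one this
    obtain ⟨c, hc⟩ := exists_eval_ne (q * G.det) (mul_ne_zero hq hG0)
    rw [map_mul, hG] at hc
    refine ⟨c, left_ne_zero_of_mul hc, 0, ?_⟩
    rw [zero_add, pow_one, pow_zero, one_mul, hV, Submodule.span_le]
    rintro _ ⟨i, rfl⟩
    set A := (Matrix.of fun a b => c (a, σ.symm b)) with hA
    have hu : IsUnit A.det := isUnit_iff_ne_zero.2 (right_ne_zero_of_mul hc)
    have e : y i = ∑ a, (A⁻¹ (σ i) a) • ∑ k, c (a, k) • y k := by
      have h3 := Matrix.nonsing_inv_mul A hu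
      have h4 : ∀ k, ∑ a, A⁻¹ (σ i) a * c (a, k) = if i = k then 1 else 0 := by
        intro k
        have := congrFun (congrFun h3 (σ i)) (σ k)
        rw [Matrix.mul_apply, Matrix.one_apply] at this
        simpa [hA] using this
      simp only [Finset.smul_sum, smul_smul]
      rw [Finset.sum_comm]
      simp only [← Finset.sum_smul, h4]
      simp
    rw [e]
    exact Submodule.sum_mem _ fun a _ => Submodule.smul_mem _ _
      (Submodule.subset_span (Set.mem_insert_of_mem _ (Set.mem_range_self a)))
end
end

section
noncomputable section
open MvPolynomial

theorem zOpen_basic {ι : Type} (p : MvPolynomial ι ℂ) : zOpen {x | eval x p ≠ 0} :=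
  TopologicalSpace.isOpen_generateFrom_of_mem ⟨p, rfl⟩

theorem zOpen_iff {ι : Type} (U : Set (ι → ℂ)) :
    zOpen U ↔ ∀ a ∈ U, ∃ p : MvPolynomial ι ℂ, eval a p ≠ 0 ∧ ∀ x, eval x p ≠ 0 → x ∈ U := by
  constructor
  · intro h
    have h' : TopologicalSpace.GenerateOpen {U | ∃ p : MvPolynomial ι ℂ, U = {x | MvPolynomial.eval x p ≠ 0}} U := h
    induction h' with
    | basic s hs =>
      obtain ⟨p, rfl⟩ := hs
      exact fun a ha => ⟨p, ha, fun x hx => hx⟩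
    | univ => exact fun a _ => ⟨1, by simp, fun _ _ => trivial⟩
    | inter s t hs ht h1 h2 =>
      rintro a ⟨ha, hb⟩
      obtain ⟨p, hp, hp'⟩ := h1 hs a ha
      obtain ⟨q, hq, hq'⟩ := h2 ht a hb
      refine ⟨p * q, by rw [map_mul]; exact mul_ne_zero hp hq, fun x hx => ?_⟩
      rw [map_mul] at hx
      exact ⟨hp' x (left_ne_zero_of_mul hx), hq' x (right_ne_zero_of_mul hx)⟩
    | sUnion S hS h1 =>
      rintro a ⟨s, hs, ha⟩
      obtain ⟨p, hp, hp'⟩ := h1 s hs (hS s hs) a ha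
      exact ⟨p, hp, fun x hx => ⟨s, hs, hp' x hx⟩⟩
  · intro h
    let _ := zTop ι
    choose! P hP hP' using h
    have : U = ⋃ a ∈ U, {x | eval x (P a) ≠ 0} := by
      ext x
      simp only [Set.mem_iUnion]
      exact ⟨fun hx => ⟨x, hx, hP x hx⟩, fun ⟨a, ha, hx⟩ => hP' a ha x hx⟩
    rw [this]
    exact isOpen_biUnion fun a _ => zOpen_basic (P a)

theorem mem_vI {ι : Type} {S : Set (ι → ℂ)} {p : MvPolynomial ι ℂ} :
    p ∈ vanishingIdealOf S ↔ ∀ x ∈ S, eval x p = 0 := Iff.rfl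

theorem mem_zClosure {ι : Type} {S : Set (ι → ℂ)} {x : ι → ℂ} :
    x ∈ zClosure S ↔ ∀ p ∈ vanishingIdealOf S, eval x p = 0 := by
  let _ := zTop ι
  constructor
  · intro hx p hp
    by_contra h
    obtain ⟨y, hy, hyS⟩ := mem_closure_iff.1 hx _ (zOpen_basic p) h
    exact hy (hp y hyS)
  · intro h
    refine mem_closure_iff.2 fun U hU hxU => ?_
    obtain ⟨p, hp, hp'⟩ := (zOpen_iff U).1 hU x hxU
    by_contra hne
    refine hp (h p fun y hy => ?_)
    by_contra hy'
    exact hne ⟨y, hp' y hy', hy⟩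

theorem zClosed_iff {ι : Type} {S : Set (ι → ℂ)} :
    zClosed S ↔ ∀ x, (∀ p ∈ vanishingIdealOf S, eval x p = 0) → x ∈ S := by
  let _ := zTop ι
  have : zClosed S ↔ zClosure S ⊆ S := ⟨fun h => (IsClosed.closure_eq h).subset, fun h => closure_subset_iff_isClosed.1 h⟩
  rw [this]
  exact ⟨fun h x hx => h (mem_zClosure.2 hx), fun h x hx => h x (mem_zClosure.1 hx)⟩

theorem zIrred_iff {ι : Type} {S : Set (ι → ℂ)} :
    zIrred S ↔ S.Nonempty ∧ ∀ p q : MvPolynomial ι ℂ, (∀ x ∈ S, eval x p * eval x q = 0) →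
      p ∈ vanishingIdealOf S ∨ q ∈ vanishingIdealOf S := by
  let _ := zTop ι
  refine and_congr Iff.rfl ?_
  constructor
  · intro h p q hpq
    by_contra hcon
    push Not at hcon
    simp only [mem_vI] at hcon
    push Not at hcon
    obtain ⟨⟨x, hx, hxp⟩, ⟨y, hy, hyq⟩⟩ := hcon
    obtain ⟨z, hz, hz1, hz2⟩ := h _ _ (zOpen_basic p) (zOpen_basic q) ⟨x, hx, hxp⟩ ⟨y, hy, hyq⟩
    exact mul_ne_zero hz1 hz2 (hpq z hz)
  · rintro h U V hU hV ⟨x, hx, hxU⟩ ⟨y, hy, hyV⟩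
    obtain ⟨p, hp, hp'⟩ := (zOpen_iff U).1 hU x hxU
    obtain ⟨q, hq, hq'⟩ := (zOpen_iff V).1 hV y hyV
    by_contra hcon
    have hh : ∀ z ∈ S, eval z p * eval z q = 0 := by
      intro z hz
      by_contra hz'
      exact hcon ⟨z, hz, hp' z (left_ne_zero_of_mul hz'), hq' z (right_ne_zero_of_mul hz')⟩
    rcases h p q hh with h1 | h1
    · exact hp (h1 x hx)
    · exact hq (h1 y hy)

theorem vI_prime {ι : Type} {S : Set (ι → ℂ)} (h : zIrred S) : (vanishingIdealOf S).IsPrime := by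
  obtain ⟨⟨x, hx⟩, h2⟩ := zIrred_iff.1 h
  refine ⟨fun h => ?_, fun {p q} hpq => h2 p q fun x hx => by rw [← map_mul]; exact hpq x hx⟩
  have : (1 : MvPolynomial ι ℂ) ∈ vanishingIdealOf S := h ▸ trivial
  simpa using this x hx

theorem vI_anti {ι : Type} {S T : Set (ι → ℂ)} (h : S ⊆ T) : vanishingIdealOf T ≤ vanishingIdealOf S :=
  fun _ hp x hx => hp x (h hx)

theorem zDense_of {ι : Type} {U : Set (ι → ℂ)} (h : ∃ q : MvPolynomial ι ℂ, q ≠ 0 ∧ ∀ x, eval x q ≠ 0 → x ∈ U) :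
    zDense U := by
  obtain ⟨q, hq, hqU⟩ := h
  intro x
  refine mem_zClosure.2 fun p hp => ?_
  have : p * q = 0 := by
    by_contra hne
    obtain ⟨y, hy⟩ := exists_eval_ne _ hne
    rw [map_mul] at hy
    exact left_ne_zero_of_mul hy (hp y (hqU y (right_ne_zero_of_mul hy)))
  rw [(mul_eq_zero.1 this).resolve_right hq, map_zero]

theorem zDense_poly {ι : Type} {U : Set (ι → ℂ)} (h : zOpen U) (hd : zDense U) : 
    ∃ q : MvPolynomial ι ℂ, q ≠ 0 ∧ ∀ x, eval x q ≠ 0 → x ∈ U := by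
  let _ := zTop ι
  have hne : U.Nonempty := by
    obtain ⟨x, hx⟩ := mem_closure_iff_nhds.1 (hd 0) Set.univ Filter.univ_mem
    exact ⟨x, hx.2⟩
  obtain ⟨a, ha⟩ := hne
  obtain ⟨p, hp, hp'⟩ := (zOpen_iff U).1 h a ha
  exact ⟨p, fun h => hp (by rw [h, map_zero]), hp'⟩

theorem zDim_le {ι : Type} (S : Set (ι → ℂ)) (D : ℕ) (h : ∀ (l : ℕ) (Y : Fin (l + 1) → Set (ι → ℂ)),
    (∀ i, Y i ⊆ S) → (∀ i, zIrred (Y i)) → StrictAnti (fun i => vanishingIdealOf (Y i)) → l ≤ D) :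
    zDim S ≤ D := by
  let _ := zTop ι
  change Order.krullDim (TopologicalSpace.IrreducibleCloseds S) ≤ _
  refine iSup_le fun c => ?_
  have := h c.length (fun i => Subtype.val '' (c i : Set S)) (fun i => by rintro _ ⟨x, _, rfl⟩; exact x.2)
    (fun i => ((c i).isIrreducible').image _ (continuous_subtype_val.continuousOn)) ?_
  · exact_mod_cast this
  · intro i j hij
    have h1 := c.strictMono hij
    refine lt_of_le_of_ne (vI_anti (Set.image_mono h1.le)) fun he => h1.not_ge ?_
    intro x hx
    have h2 : (x : ι → ℂ) ∈ zClosure (Subtype.val '' (c i : Set S)) := by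
      rw [mem_zClosure]
      intro p hp
      have hp' : p ∈ vanishingIdealOf (Subtype.val '' (c j : Set S)) := he.ge hp
      exact hp' _ ⟨x, hx, rfl⟩
    have h3 : x ∈ closure (c i : Set S) := closure_subtype.2 h2
    exact (c i).isClosed'.closure_subset h3

theorem le_zDim {ι : Type} (S : Set (ι → ℂ)) (l : ℕ) (Y : Fin (l + 1) → Set (ι → ℂ))
    (hYS : ∀ i, Y i ⊆ S) (hY : ∀ i, zIrred (Y i)) (hs : StrictAnti (fun i => vanishingIdealOf (Y i))) :
    (l : WithBot ℕ∞) ≤ zDim S := by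
  let _ := zTop ι
  change _ ≤ Order.krullDim (TopologicalSpace.IrreducibleCloseds S)
  have hirr : ∀ i, IsIrreducible ((↑) ⁻¹' (zClosure (Y i)) : Set S) := by
    intro i
    have h1 : IsIrreducible ((↑) ⁻¹' (Y i) : Set S) := by
      have h0 : Subtype.val '' ((↑) ⁻¹' (Y i) : Set S) = Y i := by
        rw [Subtype.image_preimage_coe, Set.inter_eq_right.2 (hYS i)]
      obtain ⟨⟨x, hx⟩, h2⟩ := hY i
      refine ⟨⟨⟨x, hYS i hx⟩, hx⟩, ?_⟩
      rintro _ _ ⟨U, hU, rfl⟩ ⟨V, hV, rfl⟩ ⟨u, hu, hu'⟩ ⟨v, hv, hv'⟩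
      obtain ⟨z, hz, hz'⟩ := h2 U V hU hV ⟨u, hu, hu'⟩ ⟨v, hv, hv'⟩
      exact ⟨⟨z, hYS i hz⟩, hz, hz'⟩
    have h2 : ((↑) ⁻¹' (zClosure (Y i)) : Set S) = closure ((↑) ⁻¹' (Y i) : Set S) := by
      ext x
      rw [closure_subtype, Subtype.image_preimage_coe, Set.inter_eq_right.2 (hYS i)]
      rfl
    rw [h2]
    exact h1.closure
  let f : Fin (l + 1) → TopologicalSpace.IrreducibleCloseds S := fun i =>
    ⟨(↑) ⁻¹' (zClosure (Y i)), hirr i, isClosed_closure.preimage continuous_subtype_val⟩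
  have hf : StrictMono f := by
    intro i j hij
    have h1 := hs hij
    refine lt_of_le_of_ne ?_ ?_
    · intro x hx
      exact mem_zClosure.2 fun p hp => mem_zClosure.1 hx p (h1.le hp)
    · intro he
      refine h1.not_ge fun p hp x hx => ?_
      have h2 : (⟨x, hYS j hx⟩ : S) ∈ f j := subset_closure hx
      rw [← he] at h2
      exact mem_zClosure.1 h2 p hp
  exact Order.LTSeries.length_le_krullDim (LTSeries.mk l f hf)
end
end

section
noncomputable section
open MvPolynomial

abbrev CR {ι : Type} (S : Set (ι → ℂ)) : Type := MvPolynomial ι ℂ ⧸ vanishingIdealOf S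

theorem CR_domain {ι : Type} {S : Set (ι → ℂ)} (h : zIrred S) : IsDomain (CR S) := by
  have := vI_prime h
  exact Ideal.Quotient.isDomain _

theorem exists_dvd {B τ : Type} [CommRing B] [IsDomain B] [Algebra ℂ B] [Fintype τ] (g : τ → B)
    (htr : Algebra.trdeg ℂ B ≤ Fintype.card τ) (p : B) (hp : p ≠ 0) :
    ∃ q : MvPolynomial τ ℂ, q ≠ 0 ∧ ∃ c, aeval g q = p * c := by
  by_cases hg : AlgebraicIndependent ℂ g
  · have h := isAlg_mv g hg htr
    let _ := (MvPolynomial.aeval (R := ℂ) g).toAlgebra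
    obtain ⟨r, hr, c, hc⟩ := (h.isAlgebraic p).exists_nonzero_dvd (mem_nonZeroDivisors_of_ne_zero hp)
    exact ⟨r, hr, c, hc⟩
  · obtain ⟨q, hq, hq0⟩ := exists_rel g hg
    exact ⟨q, hq, 0, by rw [hq0, mul_zero]⟩

theorem trdeg_drop {B B' : Type} [CommRing B] [IsDomain B] [Algebra ℂ B] [CommRing B'] [Algebra ℂ B']
    (f : B →ₐ[ℂ] B') (hf : Function.Surjective f) (p : B) (hp : p ≠ 0) (hfp : f p = 0) (k : ℕ)
    (g : Fin k → B') (hg : AlgebraicIndependent ℂ g) : ¬ Algebra.trdeg ℂ B ≤ k := by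
  intro h
  choose g' hg' using fun i => hf (g i)
  obtain ⟨q, hq, c, hc⟩ := exists_dvd g' (by simpa using h) p hp
  have h2 := congrArg f hc
  rw [map_mul, hfp, zero_mul, ← AlgHom.comp_apply, comp_aeval] at h2
  simp only [hg'] at h2
  exact hq ((algebraicIndependent_iff.1 hg) q h2)

theorem exists_algInd {B : Type} [CommRing B] [IsDomain B] [Algebra ℂ B] (k : ℕ) 
    (h : (k : Cardinal) ≤ Algebra.trdeg ℂ B) : ∃ g : Fin k → B, AlgebraicIndependent ℂ g := by
  obtain ⟨s, hs⟩ := exists_isTranscendenceBasis ℂ B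
  have h2 : (k : Cardinal) ≤ Cardinal.mk s := by rw [hs.cardinalMk_eq_trdeg]; exact h
  rw [← Cardinal.mk_fin, Cardinal.le_def] at h2
  obtain ⟨e⟩ := h2
  exact ⟨_, hs.1.comp e e.injective⟩

theorem zDim_le_trdeg {ι : Type} {S : Set (ι → ℂ)} (D : ℕ)
    (htr : Algebra.trdeg ℂ (CR S) ≤ D) : zDim S ≤ D := by
  refine zDim_le S D fun l Y hYS hY hs => ?_
  have key : ∀ i : ℕ, ∀ hi : i < l + 1, ∃ g : Fin i → CR (Y ⟨i, hi⟩), AlgebraicIndependent ℂ g := by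
    intro i
    induction i with
    | zero =>
      intro hi
      have := CR_domain (hY ⟨0, hi⟩)
      exact exists_algInd 0 (by simp)
    | succ i ih =>
      intro hi
      obtain ⟨g, hg⟩ := ih (by omega)
      have := CR_domain (hY ⟨i + 1, hi⟩)
      apply exists_algInd
      have hlt : vanishingIdealOf (Y ⟨i + 1, hi⟩) < vanishingIdealOf (Y ⟨i, by omega⟩) := hs (by simp)
      obtain ⟨p, hp, hp'⟩ := Set.exists_of_ssubset hlt
      have h1 := trdeg_drop (Ideal.Quotient.factorₐ ℂ hlt.le) (Ideal.Quotient.factor_surjective hlt.le)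
        (Ideal.Quotient.mk _ p) (fun h => hp' (Ideal.Quotient.eq_zero_iff_mem.1 h)) (by
          simp only [Ideal.Quotient.factorₐ_apply_mk]
          exact Ideal.Quotient.eq_zero_iff_mem.2 hp) i g hg
      rw [not_le] at h1
      have := Order.succ_le_of_lt h1
      rw [Cardinal.succ_natCast] at this
      exact_mod_cast this
  obtain ⟨g, hg⟩ := key l (by omega)
  have hle : vanishingIdealOf S ≤ vanishingIdealOf (Y ⟨l, by omega⟩) := vI_anti (hYS _)
  have hsur := Ideal.Quotient.factor_surjective hle
  choose g' hg' using fun i => hsur (g i)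
  have hg'2 : AlgebraicIndependent ℂ g' := by
    refine AlgebraicIndependent.of_comp (Ideal.Quotient.factorₐ ℂ hle) ?_
    convert! hg
    exact funext hg'
  have h3 := hg'2.cardinalMk_le_trdeg.trans htr
  simpa using h3

theorem exists_chain {ι : Type} [Finite ι] {Z : Set (ι → ℂ)} (hZ : zClosed Z) (hirr : zIrred Z) (D : ℕ)
    (htr : D ≤ Algebra.trdeg ℂ (CR Z)) : ∃ Y : Fin (D + 1) → Set (ι → ℂ), (∀ i, Y i ⊆ Z) ∧
      (∀ i, zIrred (Y i)) ∧ StrictAnti (fun i => vanishingIdealOf (Y i)) := by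
  have := CR_domain hirr
  obtain ⟨s, g, hg, h_integral⟩ := exists_integral_inj_algHom_of_fg ℂ (CR Z)
  algebraize [g.toRingHom]
  have hInt : Algebra.IsIntegral (MvPolynomial (Fin s) ℂ) (CR Z) := ⟨h_integral⟩
  have hDs : D ≤ s := by
    have h1 : Algebra.trdeg ℂ (CR Z) = Algebra.trdeg ℂ (MvPolynomial (Fin s) ℂ) := by
      have hst : IsScalarTower ℂ (MvPolynomial (Fin s) ℂ) (CR Z) := IsScalarTower.of_algebraMap_eq fun x => by
        simp [RingHom.algebraMap_toAlgebra]
      have hf : FaithfulSMul (MvPolynomial (Fin s) ℂ) (CR Z) := by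
        rw [faithfulSMul_iff_algebraMap_injective]
        exact hg
      rw [← trdeg_add_eq (R := ℂ) (S := MvPolynomial (Fin s) ℂ) (A := CR Z), trdeg_eq_zero (R := MvPolynomial (Fin s) ℂ) (A := CR Z), add_zero]
    rw [h1] at htr
    simpa using htr
  obtain ⟨l, hl⟩ : ∃ l : LTSeries (PrimeSpectrum (MvPolynomial (Fin s) ℂ)), l.length = D := by
    have h1 : ringKrullDim (MvPolynomial (Fin s) ℂ) = s := by simp
    have h2 : (D : WithBot ℕ∞) ≤ Order.krullDim (PrimeSpectrum (MvPolynomial (Fin s) ℂ)) := by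
      change _ ≤ ringKrullDim _
      rw [h1]; exact_mod_cast hDs
    exact Order.le_krullDim_iff.1 h2
  obtain ⟨Q, -, hQ, hQ2⟩ := Ideal.exists_ideal_over_prime_of_isIntegral (S := CR Z) l.head.asIdeal ⊥ (by
    rw [← RingHom.ker_eq_comap_bot, (RingHom.injective_iff_ker_eq_bot _).1 (show Function.Injective (algebraMap (MvPolynomial (Fin s) ℂ) (CR Z)) from hg)]
    exact bot_le)
  have : Q.LiesOver l.head.asIdeal := ⟨hQ2.symm⟩
  obtain ⟨L, hL, -, -⟩ := Ideal.exists_ltSeries_of_hasGoingUp l Q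
  rw [hl] at hL
  subst hL
  let P : Fin (L.length + 1) → Ideal (MvPolynomial ι ℂ) := fun i =>
    (L i.rev).asIdeal.comap (Ideal.Quotient.mk (vanishingIdealOf Z))
  have hP : ∀ i, (P i).IsPrime := fun i => Ideal.IsPrime.comap _
  have hPv : ∀ i, vanishingIdealOf (zeroLocus ℂ (P i)) = P i := by
    intro i
    have := hP i
    conv_rhs => rw [← IsPrime.vanishingIdeal_zeroLocus (K := ℂ) (P i)]
    rfl
  refine ⟨fun i => zeroLocus ℂ (P i), fun i x hx => ?_, fun i => ?_, ?_⟩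
  · refine zClosed_iff.1 hZ x fun p hp => ?_
    have := hx p (by simp [P, Ideal.mem_comap, Ideal.Quotient.eq_zero_iff_mem.2 hp])
    simpa [aeval_eq_eval] using this
  · have := hP i
    have h0 : vanishingIdealOf (zeroLocus ℂ (P i)) ≠ ⊤ := by rw [hPv]; exact this.ne_top
    refine zIrred_iff.2 ⟨?_, fun p q hpq => ?_⟩
    · by_contra hne
      apply h0
      rw [Ideal.eq_top_iff_one]
      intro x hx
      exact (hne ⟨x, hx⟩).elim
    · rw [hPv]
      apply this.mem_or_mem
      rw [← hPv]
      intro x hx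
      rw [map_mul]; exact hpq x hx
  · simp only [hPv]
    intro i j hij
    have h1 : (L j.rev).asIdeal < (L i.rev).asIdeal := L.strictMono (Fin.rev_lt_rev.2 hij)
    refine lt_of_le_of_ne (Ideal.comap_mono h1.le) fun h => h1.ne ?_
    exact Ideal.comap_injective_of_surjective _ Ideal.Quotient.mk_surjective h
end
end

section
noncomputable section
open MvPolynomial Matrix

/-- matrix-valued covariant attached to a form -/
def Gmat {R : Type} [CommRing R] [Algebra ℂ R] {n : ℕ} (f : MvPolynomial (Fin n) ℂ) (u : Fin n → ℂ)
    (A : Matrix (Fin n) (Fin n) R) : Matrix (Fin n) (Fin n) R :=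
  Polynomial.aeval A (MvPolynomial.aeval (fun i => ((A.map Polynomial.C - Matrix.scalar (Fin n) Polynomial.X).adjugate *ᵥ
    (fun j => algebraMap ℂ (Polynomial R) (u j))) i) f)

theorem Gmat_map {R S : Type} [CommRing R] [Algebra ℂ R] [CommRing S] [Algebra ℂ S] {n : ℕ}
    (f : MvPolynomial (Fin n) ℂ) (u : Fin n → ℂ) (A : Matrix (Fin n) (Fin n) R) (φ : R →ₐ[ℂ] S) :
    (Gmat f u A).map φ = Gmat f u (A.map φ) := by
  have h1 : ∀ F : Polynomial R, (Polynomial.aeval A F).map φ = Polynomial.aeval (A.map φ) (F.map (φ : R →+* S)) := by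
    intro F
    induction F using Polynomial.induction_on' with
    | add p q hp hq => simp only [map_add, Polynomial.map_add]; rw [Matrix.map_add _ (map_add φ), hp, hq]
    | monomial k a =>
      simp only [Polynomial.aeval_monomial, Polynomial.map_monomial]
      have : (algebraMap R (Matrix (Fin n) (Fin n) R) a * A ^ k).map φ =
        (φ.mapMatrix (algebraMap R (Matrix (Fin n) (Fin n) R) a * A ^ k)) := rfl
      rw [this, map_mul, map_pow]
      congr 1
      ext i j
      simp [Matrix.algebraMap_matrix_apply, apply_ite φ]
  unfold Gmat
  rw [h1]
  congr 1
  rw [← Polynomial.coe_mapAlgHom, ← AlgHom.comp_apply, comp_aeval]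
  congr 2
  funext i
  simp only [Polynomial.coe_mapAlgHom]
  have h2 := RingHom.map_mulVec (Polynomial.mapRingHom (φ : R →+* S)) ((A.map Polynomial.C - Matrix.scalar (Fin n) Polynomial.X).adjugate)
    (fun j => algebraMap ℂ (Polynomial R) (u j)) i
  simp only [Polynomial.coe_mapRingHom] at h2
  rw [h2]
  refine congrFun (congrArg₂ Matrix.mulVec ?_ ?_) i
  · have h3 := RingHom.map_adjugate (Polynomial.mapRingHom (φ : R →+* S)) (A.map Polynomial.C - Matrix.scalar (Fin n) Polynomial.X)
    simp only [RingHom.mapMatrix_apply, Polynomial.coe_mapRingHom] at h3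
    rw [h3]
    congr 1
    ext1 a b
    simp [Matrix.scalar_apply, Matrix.diagonal_apply, apply_ite (Polynomial.map (φ : R →+* S))]
  · funext j
    simp [Polynomial.algebraMap_apply]

theorem Gmat_mulVec {n : ℕ} (f : MvPolynomial (Fin n) ℂ) (u : Fin n → ℂ)
    (A : Matrix (Fin n) (Fin n) ℂ) (v : Fin n → ℂ) (lam : ℂ) (h : A *ᵥ v = lam • v) :
    Gmat f u A *ᵥ v = eval ((A - Matrix.scalar (Fin n) lam).adjugate *ᵥ u) f • v := by
  have h1 : ∀ F : Polynomial ℂ, (Polynomial.aeval A F) *ᵥ v = F.eval lam • v := by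
    intro F
    induction F using Polynomial.induction_on' with
    | add p q hp hq => simp only [map_add, Polynomial.eval_add, Matrix.add_mulVec, hp, hq, add_smul]
    | monomial k a =>
      have : ∀ k : ℕ, A ^ k *ᵥ v = lam ^ k • v := by
        intro k
        induction k with
        | zero => simp
        | succ k ih => rw [pow_succ, ← Matrix.mulVec_mulVec, h, Matrix.mulVec_smul, ih, smul_smul, pow_succ']
      simp only [Polynomial.aeval_monomial, Polynomial.eval_monomial]
      rw [← Matrix.mulVec_mulVec, this, Algebra.algebraMap_eq_smul_one, Matrix.smul_mulVec, Matrix.one_mulVec, smul_smul]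
  unfold Gmat
  rw [h1]
  congr 1
  rw [← Polynomial.coe_aeval_eq_eval]
  have : Polynomial.aeval lam ((aeval fun i ↦ ((A.map ⇑Polynomial.C - (scalar (Fin n)) Polynomial.X).adjugate *ᵥ
      fun j ↦ (algebraMap ℂ (Polynomial ℂ)) (u j)) i) f) = 
      (((Polynomial.aeval lam).restrictScalars ℂ : Polynomial ℂ →ₐ[ℂ] ℂ).comp (aeval fun i ↦ ((A.map ⇑Polynomial.C - (scalar (Fin n)) Polynomial.X).adjugate *ᵥ
      fun j ↦ (algebraMap ℂ (Polynomial ℂ)) (u j)) i)) f := rfl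
  rw [this, comp_aeval, ← aeval_eq_eval]
  congr 2
  funext i
  simp only [AlgHom.coe_restrictScalars']
  have h2 := RingHom.map_mulVec (Polynomial.evalRingHom lam) ((A.map Polynomial.C - Matrix.scalar (Fin n) Polynomial.X).adjugate)
    (fun j => algebraMap ℂ (Polynomial ℂ) (u j)) i
  simp only [Polynomial.coe_evalRingHom] at h2
  rw [Polynomial.coe_aeval_eq_eval, h2]
  refine congrFun (congrArg₂ Matrix.mulVec ?_ ?_) i
  · have h3 := RingHom.map_adjugate (Polynomial.evalRingHom lam) (A.map Polynomial.C - Matrix.scalar (Fin n) Polynomial.X)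
    simp only [RingHom.mapMatrix_apply, Polynomial.coe_evalRingHom] at h3
    rw [h3]
    congr 1
    ext1 a b
    simp [Matrix.scalar_apply, Matrix.diagonal_apply, apply_ite (Polynomial.eval lam)]
  · funext j
    simp

theorem adj_zero_of_two {n : ℕ} (M : Matrix (Fin n) (Fin n) ℂ) (v w : Fin n → ℂ) (hv : v ≠ 0) (hMv : M *ᵥ v = 0)
    (hMw : M *ᵥ w = 0) (hw : ¬ ∃ c : ℂ, w = c • v) : M.adjugate = 0 := by
  ext i j
  rw [Matrix.adjugate_apply, Matrix.zero_apply, ← Matrix.exists_mulVec_eq_zero_iff]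
  by_cases hvi : v i = 0
  · refine ⟨v, hv, ?_⟩
    funext k
    by_cases hk : k = j
    · subst hk
      simp [Matrix.mulVec, hvi]
    · simpa [Matrix.mulVec, Matrix.updateRow_ne hk] using congrFun hMv k
  · refine ⟨w - (w i / v i) • v, fun h => hw ⟨w i / v i, sub_eq_zero.1 h⟩, ?_⟩
    funext k
    by_cases hk : k = j
    · subst hk
      simp [Matrix.mulVec, hvi]
    · have : (M *ᵥ (w - (w i / v i) • v)) k = 0 := by rw [Matrix.mulVec_sub, Matrix.mulVec_smul, hMv, hMw]; simp
      simpa [Matrix.mulVec, Matrix.updateRow_ne hk] using this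

theorem Gmat_ker {n d : ℕ} (f : MvPolynomial (Fin n) ℂ) (hf : f.IsHomogeneous d) (hd : d ≠ 0) (u : Fin n → ℂ)
    (A : Matrix (Fin n) (Fin n) ℂ) (v : Fin n → ℂ) (h : IsEigenvector A v) (hfv : eval v f = 0) :
    Gmat f u A *ᵥ v = 0 := by
  obtain ⟨hv, lam, hl⟩ := h
  rw [Gmat_mulVec f u A v lam hl]
  set M := A - Matrix.scalar (Fin n) lam with hM
  have hMv : M *ᵥ v = 0 := by
    rw [hM, Matrix.sub_mulVec, hl, Matrix.scalar_apply]
    funext i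
    simp
  have h0 : eval (fun _ => (0 : ℂ)) f = 0 := by
    have := homog_eval hf 0 (fun _ => 0)
    simpa [hd] using this
  have hdet : M.det = 0 := Matrix.exists_mulVec_eq_zero_iff.1 ⟨v, hv, hMv⟩
  have hMw : M *ᵥ (M.adjugate *ᵥ u) = 0 := by
    rw [Matrix.mulVec_mulVec, Matrix.mul_adjugate, hdet]; simp
  by_cases hc : ∃ c : ℂ, M.adjugate *ᵥ u = c • v
  · obtain ⟨c, hc⟩ := hc
    have := homog_eval hf c v
    rw [hfv, mul_zero] at this
    rw [hc]
    change eval (fun i => c * v i) f • v = 0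
    rw [this, zero_smul]
  · rw [adj_zero_of_two M v _ hv hMv hMw hc, Matrix.zero_mulVec]
    change eval (fun _ => (0:ℂ)) f • v = 0
    rw [h0, zero_smul]
end
end

section
noncomputable section
open MvPolynomial Matrix

theorem exists_frame {n d : ℕ} (f : MvPolynomial (Fin n) ℂ) (hf0 : f ≠ 0) (v : Fin n → ℂ) (hv : v ≠ 0) :
    ∃ (k : Fin n) (P : Matrix (Fin n) (Fin n) ℂ), P.det ≠ 0 ∧ (∀ i, P i k = v i) ∧ 
      ∀ j, j ≠ k → eval (fun i => P i j) f ≠ 0 := by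
  obtain ⟨k, hk⟩ := Function.ne_iff.1 hv
  let W : Matrix (Fin n) (Fin n) (MvPolynomial (Fin n × Fin n) ℂ) := (Matrix.of fun i j => X (i, j)).updateCol k (fun i => C (v i))
  have hW : ∀ x : Fin n × Fin n → ℂ, eval x W.det = ((Matrix.of fun i j => x (i, j)).updateCol k v).det := by
    intro x
    rw [RingHom.map_det]
    congr 1
    ext i j
    by_cases hj : j = k
    · subst hj; simp [W]
    · simp [W, Matrix.updateCol_ne hj]
  have hW0 : W.det ≠ 0 := by
    intro h
    have h1 := hW (fun p => (1 : Matrix (Fin n) (Fin n) ℂ) p.1 p.2)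
    rw [h, map_zero] at h1
    have h2 : (Matrix.of fun i j => (1 : Matrix (Fin n) (Fin n) ℂ) i j) = 1 := rfl
    have h3 : ((1 : Matrix (Fin n) (Fin n) ℂ).updateCol k v).det = v k := by
      rw [← Matrix.cramer_apply, Matrix.cramer_one]; rfl
    simp only [h2, h3] at h1
    exact hk h1.symm
  let Fj : Fin n → MvPolynomial (Fin n × Fin n) ℂ := fun j => rename (fun i => (i, j)) f
  have hFj : ∀ j, Fj j ≠ 0 := by
    intro j h
    refine hf0 ((map_eq_zero_iff _ (rename_injective _ ?_)).1 h)
    intro a b hab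
    exact (Prod.mk.inj hab).1
  obtain ⟨x, hx⟩ := exists_eval_ne (W.det * ∏ j, Fj j) (mul_ne_zero hW0 (Finset.prod_ne_zero_iff.2 fun j _ => hFj j))
  rw [map_mul, hW, map_prod] at hx
  refine ⟨k, _, left_ne_zero_of_mul hx, fun i => by simp, fun j hj => ?_⟩
  have h4 := Finset.prod_ne_zero_iff.1 (right_ne_zero_of_mul hx) j (Finset.mem_univ _)
  simp only [Fj, eval_rename] at h4
  have h5 : eval (fun i => x (i, j)) f ≠ 0 := h4
  have h6 : (fun i => ((Matrix.of fun i j => x (i, j)).updateCol k v) i j) = fun i => x (i, j) := by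
    funext i; simp [Matrix.updateCol_ne hj]
  rw [h6]; exact h5

theorem exists_good {n d : ℕ} (f : MvPolynomial (Fin n) ℂ) (hf : f.IsHomogeneous d) (hf0 : f ≠ 0)
    (v : Fin n → ℂ) (hv : v ≠ 0) : ∃ (u a b : Fin n → ℂ) (A : Matrix (Fin n) (Fin n) ℂ),
      (∃ lam : ℂ, A *ᵥ v = lam • v) ∧ (eval v f = 0 → (Gmat f u A + Matrix.vecMulVec a b).det ≠ 0) ∧ 
      (eval v f ≠ 0 → (Gmat f u A).det ≠ 0) := by
  obtain ⟨k, P, hP, hPv, hPf⟩ := exists_frame (d := d) f hf0 v hv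
  have hu : IsUnit P.det := isUnit_iff_ne_zero.2 hP
  set Q := P⁻¹ with hQ
  have hPQ : P * Q = 1 := Matrix.mul_nonsing_inv _ hu
  have hQP : Q * P = 1 := Matrix.nonsing_inv_mul _ hu
  let μ : Fin n → ℂ := fun i => (i : ℂ)
  have hμ : ∀ i j, i ≠ j → μ i - μ j ≠ 0 := by
    intro i j hij h
    apply hij
    have : ((i : ℕ) : ℂ) = ((j : ℕ) : ℂ) := sub_eq_zero.1 h
    exact Fin.ext (by exact_mod_cast this)
  let A := P * Matrix.diagonal μ * Q
  let w : Fin n → Fin n → ℂ := fun j i => P i j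
  have hw : ∀ j, w j = P *ᵥ Pi.single j 1 := by
    intro j; rw [Matrix.mulVec_single_one]; rfl
  have hwk : w k = v := funext hPv
  have hQw : ∀ j, Q *ᵥ w j = Pi.single j 1 := by
    intro j
    rw [hw, Matrix.mulVec_mulVec, hQP, Matrix.one_mulVec]
  have hA : ∀ j, A *ᵥ w j = μ j • w j := by
    intro j
    simp only [A]
    rw [← Matrix.mulVec_mulVec, hQw, ← Matrix.mulVec_mulVec, Matrix.diagonal_mulVec_single, hw, mul_one,
      ← Matrix.mulVec_smul]
    congr 1
    rw [← Pi.single_smul, smul_eq_mul, mul_one]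
  let u : Fin n → ℂ := P *ᵥ (fun _ => 1)
  have hadj : ∀ j, (A - Matrix.scalar (Fin n) (μ j)).adjugate *ᵥ u = (∏ i ∈ Finset.univ.erase j, (μ i - μ j)) • w j := by
    intro j
    have e1 : A - Matrix.scalar (Fin n) (μ j) = P * Matrix.diagonal (fun i => μ i - μ j) * Q := by
      have : Matrix.diagonal (fun i => μ i - μ j) = Matrix.diagonal μ - Matrix.scalar (Fin n) (μ j) := by
        rw [Matrix.scalar_apply, Matrix.diagonal_sub]
      rw [this, mul_sub, sub_mul, (Matrix.scalar_commute (μ j) (fun r => mul_comm _ _) P).symm.eq, mul_assoc _ P Q, hPQ, mul_one]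
    have e2 : (A - Matrix.scalar (Fin n) (μ j)).adjugate = P * (Matrix.diagonal (fun i => μ i - μ j)).adjugate * Q := by
      have hPa : P.adjugate = P.det • Q := by
        rw [hQ, Matrix.inv_def, smul_smul, Ring.mul_inverse_cancel _ hu, one_smul]
      have hdet : P.det * Q.det = 1 := by rw [← Matrix.det_mul, hPQ, Matrix.det_one]
      have hQa : Q.adjugate = Q.det • P := by
        calc Q.adjugate = (P * Q) * Q.adjugate := by rw [hPQ, one_mul]
          _ = Q.det • P := by rw [mul_assoc, Matrix.mul_adjugate, Matrix.mul_smul, mul_one]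
      rw [e1, Matrix.adjugate_mul_distrib, Matrix.adjugate_mul_distrib, hPa, hQa, Matrix.mul_smul, Matrix.mul_smul, Matrix.smul_mul,
        smul_smul, hdet, one_smul, mul_assoc]
    rw [e2]
    simp only [u]
    rw [Matrix.mulVec_mulVec, mul_assoc, hQP, mul_one, hw, ← Matrix.mulVec_smul, ← Matrix.mulVec_mulVec]
    congr 1
    rw [Matrix.adjugate_diagonal]
    funext i
    rw [Matrix.mulVec_diagonal, mul_one]
    by_cases hij : i = j
    · subst hij; simp
    · simp only [Pi.smul_apply, Pi.single_apply, if_neg hij, smul_zero]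
      exact Finset.prod_eq_zero (Finset.mem_erase.2 ⟨fun h => hij h.symm, Finset.mem_univ j⟩) (sub_self _)
  have hG : ∀ j, Gmat f u A *ᵥ w j = ((∏ i ∈ Finset.univ.erase j, (μ i - μ j)) ^ d * eval (w j) f) • w j := by
    intro j
    rw [Gmat_mulVec f u A (w j) (μ j) (hA j), hadj]
    congr 1
    exact homog_eval hf _ (w j)
  have hc : ∀ j, (∏ i ∈ Finset.univ.erase j, (μ i - μ j)) ^ d ≠ 0 := fun j => 
    pow_ne_zero _ (Finset.prod_ne_zero_iff.2 fun i hi => hμ i j (Finset.ne_of_mem_erase hi))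
  have key : ∀ (N : Matrix (Fin n) (Fin n) ℂ) (e : Fin n → ℂ), (∀ j, e j ≠ 0) → (∀ j, N *ᵥ w j = e j • w j) → N.det ≠ 0 := by
    intro N e he hN hdet
    have h1 : N * P = P * Matrix.diagonal e := by
      ext i j
      have := congrFun (hN j) i
      rw [Matrix.mul_diagonal, mul_comm]
      simpa [w, Matrix.mulVec, dotProduct, Matrix.mul_apply] using this
    have h2 := congrArg Matrix.det h1
    rw [Matrix.det_mul, Matrix.det_mul, hdet, zero_mul, Matrix.det_diagonal] at h2
    exact mul_ne_zero hP (Finset.prod_ne_zero_iff.2 fun j _ => he j) h2.symm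
  refine ⟨u, w k, fun i => Q k i, A, ⟨μ k, by rw [← hwk]; exact hA k⟩, fun hfv => ?_, fun hfv => ?_⟩
  · refine key _ (fun j => if j = k then 1 else (∏ i ∈ Finset.univ.erase j, (μ i - μ j)) ^ d * eval (w j) f) ?_ ?_
    · intro j
      by_cases hj : j = k
      · simp [hj]
      · simp only [if_neg hj]; exact mul_ne_zero (hc j) (hPf j hj)
    · intro j
      have hb : (Q *ᵥ w j) k = (fun i => Q k i) ⬝ᵥ w j := rfl
      rw [Matrix.add_mulVec, hG, Matrix.vecMulVec_mulVec, ← hb, hQw]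
      by_cases hj : j = k
      · subst hj
        rw [hwk, hfv]; simp
      · simp [hj, Ne.symm hj]
  · refine key _ _ ?_ hG
    intro j
    refine mul_ne_zero (hc j) ?_
    by_cases hj : j = k
    · rw [hj, hwk]; exact hfv
    · exact hPf j hj

def Gpoly {n : ℕ} (f : MvPolynomial (Fin n) ℂ) (u : Fin n → ℂ) (N : Matrix (Fin n) (Fin n) ℂ) : MvPolynomial (Fin n × Fin n) ℂ :=
  (Gmat f u (Matrix.of fun i j => X (i, j)) + N.map C).det

theorem eval_Gpoly {n : ℕ} (f : MvPolynomial (Fin n) ℂ) (u : Fin n → ℂ) (N : Matrix (Fin n) (Fin n) ℂ) (A : MatSpace n) :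
    eval A (Gpoly f u N) = (Gmat f u (toMat A) + N).det := by
  unfold Gpoly
  rw [RingHom.map_det]
  congr 1
  have h := Gmat_map f u (Matrix.of fun i j => X (i, j) : Matrix (Fin n) (Fin n) (MvPolynomial (Fin n × Fin n) ℂ)) (aeval A)
  have h2 : (Matrix.of fun i j => X (i, j) : Matrix (Fin n) (Fin n) (MvPolynomial (Fin n × Fin n) ℂ)).map (aeval A : MvPolynomial (Fin n × Fin n) ℂ →ₐ[ℂ] ℂ) = toMat A := by
    ext i j; simp [toMat]
  rw [h2] at h
  rw [← h]
  ext i j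
  simp [aeval_eq_eval]

theorem F_a {n d : ℕ} (f : MvPolynomial (Fin n) ℂ) (hf : f.IsHomogeneous d) (hd : d ≠ 0)
    (v : Fin n → ℂ) (hfv : eval v f ≠ 0) : ∃ p : MvPolynomial (Fin n × Fin n) ℂ,
      (∀ (A : MatSpace n) w, IsEigenvector (toMat A) w → eval w f = 0 → eval A p = 0) ∧
      ∃ A : MatSpace n, IsEigenvector (toMat A) v ∧ eval A p ≠ 0 := by
  have hf0 : f ≠ 0 := fun h => hfv (by rw [h, map_zero])
  have hv : v ≠ 0 := by
    rintro rfl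
    have := homog_eval hf 0 (fun _ => 0)
    rw [zero_pow hd] at this
    simp only [zero_mul] at this
    exact hfv this
  obtain ⟨u, a, b, A, hA, -, h2⟩ := exists_good f hf hf0 v hv
  refine ⟨Gpoly f u 0, fun A w hw hfw => ?_, fun ij => A ij.1 ij.2, ⟨hv, hA⟩, ?_⟩
  · rw [eval_Gpoly, add_zero]
    exact Matrix.exists_mulVec_eq_zero_iff.1 ⟨w, hw.1, Gmat_ker f hf hd u _ w hw hfw⟩
  · rw [eval_Gpoly, add_zero]
    exact h2 hfv

theorem F_b {n d : ℕ} (f : MvPolynomial (Fin n) ℂ) (hf : f.IsHomogeneous d) (hd : d ≠ 0) (hf0 : f ≠ 0)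
    (v : Fin n → ℂ) (hv : v ≠ 0) (hfv : eval v f = 0) : ∃ p : MvPolynomial (Fin n × Fin n) ℂ,
      (∀ (A : MatSpace n) w w', IsEigenvector (toMat A) w → IsEigenvector (toMat A) w' → eval w f = 0 → eval w' f = 0 → 
        eval A p ≠ 0 → ∃ c : ℂ, w' = c • w) ∧
      ∃ A : MatSpace n, IsEigenvector (toMat A) v ∧ eval A p ≠ 0 := by
  obtain ⟨u, a, b, A, hA, h2, -⟩ := exists_good f hf hf0 v hv
  refine ⟨Gpoly f u (vecMulVec a b), fun A w w' hw hw' hfw hfw' => ?_, fun ij => A ij.1 ij.2, ⟨hv, hA⟩, ?_⟩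
  · rw [eval_Gpoly]
    intro hdet
    by_contra hcon
    apply hdet
    rw [← Matrix.exists_mulVec_eq_zero_iff]
    have k1 := Gmat_ker f hf hd u _ w hw hfw
    have k2 := Gmat_ker f hf hd u _ w' hw' hfw'
    by_cases hbw : b ⬝ᵥ w = 0
    · exact ⟨w, hw.1, by rw [Matrix.add_mulVec, k1, Matrix.vecMulVec_mulVec, hbw]; simp⟩
    · refine ⟨w' - ((b ⬝ᵥ w') / (b ⬝ᵥ w)) • w, fun h => hcon ⟨_, sub_eq_zero.1 h⟩, ?_⟩
      rw [Matrix.add_mulVec, Matrix.vecMulVec_mulVec, Matrix.mulVec_sub, Matrix.mulVec_smul, k1, k2, dotProduct_sub, dotProduct_smul]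
      simp [hbw]
  · rw [eval_Gpoly]
    exact h2 hfv
end
end

section
noncomputable section
open MvPolynomial Matrix

def ptHom {ι : Type} {S : Set (ι → ℂ)} (x : ι → ℂ) (hx : x ∈ S) : CR S →ₐ[ℂ] ℂ :=
  Ideal.Quotient.liftₐ _ (aeval x) (fun p hp => by rw [aeval_eq_eval]; exact mem_vI.1 hp x hx)

def yC {ι : Type} (S : Set (ι → ℂ)) (i : ι) : CR S := Ideal.Quotient.mkₐ ℂ _ (X i)

theorem ptHom_mk {ι : Type} {S : Set (ι → ℂ)} (x : ι → ℂ) (hx : x ∈ S) (p : MvPolynomial ι ℂ) :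
    ptHom x hx (Ideal.Quotient.mkₐ ℂ _ p) = eval x p := by
  rw [← aeval_eq_eval]; rfl

theorem ptHom_y {ι : Type} {S : Set (ι → ℂ)} (x : ι → ℂ) (hx : x ∈ S) (i : ι) :
    ptHom x hx (yC S i) = x i := by
  rw [yC, ptHom_mk, eval_X]

theorem exists_pt {ι : Type} {S : Set (ι → ℂ)} (r : CR S) (hr : r ≠ 0) :
    ∃ x, ∃ hx : x ∈ S, ptHom x hx r ≠ 0 := by
  obtain ⟨p, rfl⟩ := Ideal.Quotient.mkₐ_surjective ℂ _ r
  by_contra hcon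
  push Not at hcon
  apply hr
  rw [Ideal.Quotient.mkₐ_eq_mk, Ideal.Quotient.eq_zero_iff_mem, mem_vI]
  intro x hx
  rw [← ptHom_mk x hx]; exact hcon x hx

theorem aeval_yC {ι : Type} (S : Set (ι → ℂ)) (p : MvPolynomial ι ℂ) :
    aeval (yC S) p = Ideal.Quotient.mkₐ ℂ (vanishingIdealOf S) p := by
  have : (aeval (yC S) : MvPolynomial ι ℂ →ₐ[ℂ] CR S) = Ideal.Quotient.mkₐ ℂ (vanishingIdealOf S) := by
    ext i; simp [yC]
  rw [this]

theorem hom_mem {ι : Type} {S : Set (ι → ℂ)} (hS : zClosed S) (χ : CR S →ₐ[ℂ] ℂ) :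
    (fun i => χ (yC S i)) ∈ S := by
  refine zClosed_iff.1 hS _ fun p hp => ?_
  rw [← alghom_aeval, aeval_yC, Ideal.Quotient.mkₐ_eq_mk, Ideal.Quotient.eq_zero_iff_mem.2 hp, map_zero]

theorem hom_ext_y {ι : Type} {S : Set (ι → ℂ)} {R : Type} [CommRing R] [Algebra ℂ R] (χ χ' : CR S →ₐ[ℂ] R) (h : ∀ i, χ (yC S i) = χ' (yC S i)) :
    χ = χ' := by
  apply Ideal.Quotient.algHom_ext
  ext i
  exact h i

def prodHom {B σ : Type} [CommRing B] [Algebra ℂ B] (χ : B →ₐ[ℂ] ℂ) (t : σ → ℂ) : MvPolynomial σ B →ₐ[ℂ] ℂ :=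
  (aeval t : MvPolynomial σ ℂ →ₐ[ℂ] ℂ).comp (mapAlgHom χ)

section
variable {B σ : Type} [CommRing B] [Algebra ℂ B] (χ : B →ₐ[ℂ] ℂ) (t : σ → ℂ)
@[simp] theorem prodHom_C (b : B) : prodHom χ t (C b) = χ b := by simp [prodHom]
@[simp] theorem prodHom_X (i : σ) : prodHom χ t (X i) = t i := by simp [prodHom]

def resHom (ξ : MvPolynomial σ B →ₐ[ℂ] ℂ) : B →ₐ[ℂ] ℂ := ξ.comp (IsScalarTower.toAlgHom ℂ B (MvPolynomial σ B))

@[simp] theorem resHom_apply (ξ : MvPolynomial σ B →ₐ[ℂ] ℂ) (b : B) : resHom ξ b = ξ (C b) := rfl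

theorem eq_prodHom (ξ : MvPolynomial σ B →ₐ[ℂ] ℂ) : ξ = prodHom (resHom ξ) (fun i => ξ (X i)) := by
  apply MvPolynomial.algHom_ext'
  · ext b
    change ξ (C b) = prodHom (resHom ξ) _ (C b)
    simp
  · intro i; simp

theorem prodHom_ext (ξ ξ' : MvPolynomial σ B →ₐ[ℂ] ℂ) (h1 : ∀ b, ξ (C b) = ξ' (C b)) (h2 : ∀ i, ξ (X i) = ξ' (X i)) : ξ = ξ' := by
  apply MvPolynomial.algHom_ext'
  · ext b
    exact h1 b
  · exact h2
end

theorem exists_pt2 {ι σ : Type} {S : Set (ι → ℂ)} (r : MvPolynomial σ (CR S)) (hr : r ≠ 0) :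
    ∃ x, ∃ hx : x ∈ S, ∃ t : σ → ℂ, prodHom (ptHom x hx) t r ≠ 0 := by
  obtain ⟨s, hs⟩ := MvPolynomial.ne_zero_iff.1 hr
  obtain ⟨x, hx, h⟩ := exists_pt _ hs
  have h2 : mapAlgHom (ptHom x hx) r ≠ 0 := by
    rw [MvPolynomial.ne_zero_iff]
    refine ⟨s, ?_⟩
    rw [mapAlgHom_apply, coeff_map]
    exact h
  obtain ⟨t, ht⟩ := exists_eval_ne _ h2
  refine ⟨x, hx, t, ?_⟩
  rw [prodHom, AlgHom.comp_apply, aeval_eq_eval]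
  exact ht

theorem irred_image {ι ι' σ : Type} {S : Set (ι → ℂ)} (hS : zIrred S) (h : MvPolynomial σ (CR S)) (hh : h ≠ 0)
    (F : ι' → MvPolynomial σ (CR S)) : zIrred {z : ι' → ℂ | ∃ x, ∃ hx : x ∈ S, ∃ t : σ → ℂ,
      prodHom (ptHom x hx) t h ≠ 0 ∧ z = fun i => prodHom (ptHom x hx) t (F i)} := by
  have := CR_domain hS
  have key : ∀ r : MvPolynomial σ (CR S), (∀ x, ∀ hx : x ∈ S, ∀ t : σ → ℂ,
      prodHom (ptHom x hx) t h ≠ 0 → prodHom (ptHom x hx) t r = 0) → r = 0 := by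
    intro r hr
    by_contra hcon
    obtain ⟨x, hx, t, hne⟩ := exists_pt2 (h * r) (mul_ne_zero hh hcon)
    rw [map_mul] at hne
    exact right_ne_zero_of_mul hne (hr x hx t (left_ne_zero_of_mul hne))
  rw [zIrred_iff]
  constructor
  · obtain ⟨x, hx, t, hne⟩ := exists_pt2 h hh
    exact ⟨_, x, hx, t, hne, rfl⟩
  · intro p q hpq
    have h1 : aeval F p * aeval F q = 0 := by
      apply key
      intro x hx t hne
      rw [map_mul, alghom_aeval, alghom_aeval]
      exact hpq _ ⟨x, hx, t, hne, rfl⟩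
    rcases mul_eq_zero.1 h1 with h2 | h2
    · left
      rw [mem_vI]
      rintro z ⟨x, hx, t, hne, rfl⟩
      rw [← alghom_aeval, h2, map_zero]
    · right
      rw [mem_vI]
      rintro z ⟨x, hx, t, hne, rfl⟩
      rw [← alghom_aeval, h2, map_zero]
end
end

section
noncomputable section
open MvPolynomial Matrix

/-- parametrization used for irreducibility -/
def iF {n : ℕ} {R : Type} [CommRing R] (v φ : Fin n → R) (M : Fin n → Fin n → R) (l : R) (ij : Fin n × Fin n) : R :=
  (if ij.1 = ij.2 then l else 0) + (∑ k, φ k * v k) * M ij.1 ij.2 - (∑ k, M ij.1 k * v k) * φ ij.2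

theorem iF_map {n : ℕ} {R : Type} [CommRing R] [Algebra ℂ R] (χ : R →ₐ[ℂ] ℂ) (v φ : Fin n → R) (M : Fin n → Fin n → R) (l : R) (ij : Fin n × Fin n) :
    χ (iF v φ M l ij) = iF (fun i => χ (v i)) (fun i => χ (φ i)) (fun i j => χ (M i j)) (χ l) ij := by
  simp only [iF, map_sub, map_add, map_mul, map_sum]
  split_ifs <;> simp

theorem iF_eig {n : ℕ} (v φ : Fin n → ℂ) (M : Fin n → Fin n → ℂ) (l : ℂ) : 
    (toMat (iF v φ M l)) *ᵥ v = l • v := by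
  ext i
  simp only [toMat, Matrix.mulVec, dotProduct, of_apply, iF, Pi.smul_apply, smul_eq_mul]
  simp only [sub_mul, add_mul, Finset.sum_sub_distrib, Finset.sum_add_distrib, ite_mul, zero_mul, Finset.sum_ite_eq, Finset.mem_univ, if_true]
  have h1 : ∑ x, (∑ k, φ k * v k) * M i x * v x = (∑ k, φ k * v k) * ∑ k, M i k * v k := by
    rw [Finset.mul_sum]; exact Finset.sum_congr rfl fun x _ => by ring
  have h2 : ∑ x, (∑ k, M i k * v k) * φ x * v x = (∑ k, M i k * v k) * ∑ k, φ k * v k := by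
    simp only [mul_assoc, ← Finset.mul_sum]
  rw [h1, h2]; ring

theorem iF_surj {n : ℕ} (A : MatSpace n) (v φ : Fin n → ℂ) (l : ℂ) (h : (toMat A) *ᵥ v = l • v) (hφ : ∑ k, φ k * v k = 1) :
    A = iF v φ (fun i j => A (i, j) - if i = j then l else 0) l := by
  funext ⟨i, j⟩
  have h1 := congrFun h i
  simp only [toMat, Matrix.mulVec, dotProduct, of_apply, Pi.smul_apply, smul_eq_mul] at h1
  simp only [iF, hφ, sub_mul, Finset.sum_sub_distrib, h1]
  simp

theorem kalman_irred {n : ℕ} {Y : Set (Fin n → ℂ)} (hY : zIrred Y) (hne : ∃ v ∈ Y, v ≠ 0) : zIrred (kalmanCone Y) := by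
  let σ := Fin n ⊕ (Fin n × Fin n) ⊕ Unit
  let v : Fin n → MvPolynomial σ (CR Y) := fun i => C (yC Y i)
  let φ : Fin n → MvPolynomial σ (CR Y) := fun i => X (Sum.inl i)
  let M : Fin n → Fin n → MvPolynomial σ (CR Y) := fun i j => X (Sum.inr (Sum.inl (i, j)))
  let l : MvPolynomial σ (CR Y) := X (Sum.inr (Sum.inr ()))
  have hev : ∀ x (hx : x ∈ Y) (t : σ → ℂ), prodHom (ptHom x hx) t (∑ k, φ k * v k) = ∑ k, t (Sum.inl k) * x k := by
    intro x hx t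
    simp [φ, v, map_sum, ptHom_y]
  have hF : ∀ x (hx : x ∈ Y) (t : σ → ℂ), (fun ij => prodHom (ptHom x hx) t (iF v φ M l ij)) =
      iF x (fun i => t (Sum.inl i)) (fun i j => t (Sum.inr (Sum.inl (i, j)))) (t (Sum.inr (Sum.inr ()))) := by
    intro x hx t
    funext ij
    rw [iF_map]
    simp [φ, v, M, l, ptHom_y]
  have hphi : ∀ w : Fin n → ℂ, w ≠ 0 → ∃ f : Fin n → ℂ, ∑ k, f k * w k = 1 := by
    intro w hw
    obtain ⟨k, hk⟩ := Function.ne_iff.1 hw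
    refine ⟨Pi.single k (w k)⁻¹, ?_⟩
    rw [Finset.sum_eq_single k (fun b _ hb => by simp [hb]) (by simp)]
    simp only [Pi.single_eq_same]
    exact inv_mul_cancel₀ hk
  have hh : (∑ k, φ k * v k) ≠ 0 := by
    intro h0
    obtain ⟨w, hw, hw0⟩ := hne
    obtain ⟨f, hf⟩ := hphi w hw0
    have := hev w hw (Sum.elim f 0)
    rw [h0, map_zero] at this
    simp only [Sum.elim_inl, hf] at this
    exact zero_ne_one this
  convert! irred_image hY _ hh (iF v φ M l) using 1
  ext A
  constructor
  · rintro ⟨w, hw, hw0, lam, hl⟩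
    obtain ⟨f, hf⟩ := hphi w hw0
    refine ⟨w, hw, Sum.elim f (Sum.elim (fun ij => A ij - if ij.1 = ij.2 then lam else 0) (fun _ => lam)), ?_, ?_⟩
    · rw [hev]; simp [hf]
    · rw [hF]
      exact iF_surj A w f lam hl hf
  · rintro ⟨w, hw, t, h1, rfl⟩
    refine ⟨w, hw, ?_, t (Sum.inr (Sum.inr ())), ?_⟩
    · rintro rfl
      rw [hev] at h1; simp at h1
    · rw [hF]
      exact iF_eig _ _ _ _

/-- linear form as a polynomial -/
def linP {n : ℕ} (ψ : Fin n → ℂ) : MvPolynomial (Fin n) ℂ := ∑ i, C (ψ i) * X i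

theorem eval_linP {n : ℕ} (ψ x : Fin n → ℂ) : eval x (linP ψ) = ∑ i, ψ i * x i := by simp [linP, map_sum]

theorem linP_homog {n : ℕ} (ψ : Fin n → ℂ) : (linP ψ).IsHomogeneous 1 := by
  apply IsHomogeneous.sum
  intro i _
  have := (isHomogeneous_C (Fin n) (ψ i)).mul (isHomogeneous_X ℂ i)
  simpa using this

/-- The affine chart of the cone. -/
def chart {n : ℕ} (X : Set (Fin n → ℂ)) (ψ : Fin n → ℂ) : Set (Fin n → ℂ) := {x | x ∈ X ∧ ∑ i, ψ i * x i = 1}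

theorem eig_smul {n : ℕ} {A : Matrix (Fin n) (Fin n) ℂ} {v : Fin n → ℂ} (h : IsEigenvector A v) {c : ℂ} (hc : c ≠ 0) :
    IsEigenvector A (c • v) := by
  obtain ⟨h1, l, hl⟩ := h
  exact ⟨smul_ne_zero hc h1, l, by rw [Matrix.mulVec_smul, hl, smul_comm]⟩

theorem chart_scale {n : ℕ} {X : Set (Fin n → ℂ)} (hX : IsCone X) {ψ v : Fin n → ℂ} (hv : v ∈ X) (h : ∑ i, ψ i * v i ≠ 0) :
    (∑ i, ψ i * v i)⁻¹ • v ∈ chart X ψ := by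
  refine ⟨hX _ _ hv, ?_⟩
  have : ∀ i, ψ i * ((∑ i, ψ i * v i)⁻¹ • v) i = (∑ i, ψ i * v i)⁻¹ * (ψ i * v i) := by
    intro i; simp only [Pi.smul_apply, smul_eq_mul]; ring
  simp only [this, ← Finset.mul_sum]
  exact inv_mul_cancel₀ h

/-- the polynomial that cuts the matrices with an eigenvector at infinity -/
theorem exists_inf_poly {n : ℕ} {X : Set (Fin n → ℂ)} {ψ : Fin n → ℂ} (hne : (chart X ψ).Nonempty) :
    ∃ p : MvPolynomial (Fin n × Fin n) ℂ, (∀ (A : MatSpace n) w, IsEigenvector (toMat A) w → ∑ i, ψ i * w i = 0 → eval A p = 0) ∧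
      p ∉ vanishingIdealOf (kalmanCone X) := by
  obtain ⟨v, hv, hv1⟩ := hne
  obtain ⟨p, h1, A, h2, h3⟩ := F_a (linP ψ) (linP_homog ψ) one_ne_zero v (by rw [eval_linP, hv1]; exact one_ne_zero)
  refine ⟨p, fun A w hw h => h1 A w hw (by rw [eval_linP, h]), fun h => h3 (mem_vI.1 h A ⟨v, hv, h2⟩)⟩

theorem vI_chart {n : ℕ} {X : Set (Fin n → ℂ)} (hX : IsCone X) (hirr : zIrred X) {ψ : Fin n → ℂ} (hne : (chart X ψ).Nonempty) :
    vanishingIdealOf (kalmanCone (chart X ψ)) = vanishingIdealOf (kalmanCone X) := by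
  have hv : ∃ v ∈ X, v ≠ 0 := by
    obtain ⟨v, hv, h1⟩ := hne
    exact ⟨v, hv, by rintro rfl; simp at h1⟩
  apply le_antisymm
  · intro p hp
    obtain ⟨p', h1, h2⟩ := exists_inf_poly hne
    refine ((zIrred_iff.1 (kalman_irred hirr hv)).2 p p' ?_).resolve_right h2
    rintro A ⟨w, hw, hA⟩
    by_cases h0 : ∑ i, ψ i * w i = 0
    · rw [h1 A w hA h0, mul_zero]
    · rw [mem_vI.1 hp A ⟨_, chart_scale hX hw h0, eig_smul hA (inv_ne_zero h0)⟩, zero_mul]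
  · exact vI_anti fun A ⟨w, hw, h⟩ => ⟨w, hw.1, h⟩

/-- a homogeneous polynomial vanishing on X -/
theorem exists_homog {n : ℕ} {X : Set (Fin n → ℂ)} (hX : IsCone X) (hcl : zClosed X) (hne : X.Nonempty) (hproper : X ≠ Set.univ) :
    ∃ (d : ℕ) (f : MvPolynomial (Fin n) ℂ), d ≠ 0 ∧ f ≠ 0 ∧ f.IsHomogeneous d ∧ ∀ x ∈ X, eval x f = 0 := by
  have h1 : ∃ f ∈ vanishingIdealOf X, f ≠ 0 := by
    by_contra hcon
    push Not at hcon
    apply hproper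
    rw [Set.eq_univ_iff_forall]
    intro x
    refine zClosed_iff.1 hcl x fun p hp => by rw [hcon p hp, map_zero]
  obtain ⟨f, hf, hf0⟩ := h1
  have h2 : ∀ k, ∀ x ∈ X, eval x (homogeneousComponent k f) = 0 := by
    intro k x hx
    -- polynomial in t
    let P : Polynomial ℂ := ∑ i ∈ Finset.range (f.totalDegree + 1), Polynomial.C (eval x (homogeneousComponent i f)) * Polynomial.X ^ i
    have hP : P = 0 := by
      apply Polynomial.funext
      intro t
      have h3 := mem_vI.1 hf _ (hX t x hx)
      rw [← sum_homogeneousComponent f, map_sum] at h3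
      simp only [P, Polynomial.eval_finsetSum, Polynomial.eval_mul, Polynomial.eval_C, Polynomial.eval_pow, Polynomial.eval_X, Polynomial.eval_zero]
      rw [← h3]
      refine Finset.sum_congr rfl fun i _ => ?_
      have := homog_eval (homogeneousComponent_isHomogeneous i f) t x
      rw [mul_comm, ← this]; rfl
    by_cases hk : k < f.totalDegree + 1
    · have h4 := congrArg (fun p => Polynomial.coeff p k) hP
      simpa [P, Polynomial.finsetSum_coeff, Polynomial.coeff_C_mul, Polynomial.coeff_X_pow, hk, Nat.lt_succ_iff.1 hk] using h4
    · rw [homogeneousComponent_eq_zero _ _ (by omega), map_zero]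
  have h3 : ∃ k, homogeneousComponent k f ≠ 0 := by
    by_contra hcon
    push Not at hcon
    apply hf0
    rw [← sum_homogeneousComponent f]
    exact Finset.sum_eq_zero fun i _ => hcon i
  obtain ⟨k, hk⟩ := h3
  refine ⟨k, _, ?_, hk, homogeneousComponent_isHomogeneous k f, h2 k⟩
  rintro rfl
  obtain ⟨x, hx⟩ := hne
  have h4 := h2 0 x hx
  rw [homogeneousComponent_zero, eval_C] at h4
  apply hk
  rw [homogeneousComponent_zero, h4, map_zero]

theorem exists_uniq_poly {n : ℕ} {X : Set (Fin n → ℂ)} (hX : IsCone X) (hcl : zClosed X) (hne : ∃ v ∈ X, v ≠ 0) (hproper : X ≠ Set.univ) :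
    ∃ p : MvPolynomial (Fin n × Fin n) ℂ, p ∉ vanishingIdealOf (kalmanCone X) ∧ 
     ∀ (A : MatSpace n), eval A p ≠ 0 → ∀ v w, v ∈ X → w ∈ X → IsEigenvector (toMat A) v → IsEigenvector (toMat A) w →
       ∃ c : ℂ, w = c • v := by
  obtain ⟨v, hv, hv0⟩ := hne
  obtain ⟨d, f, hd, hf0, hf, hfX⟩ := exists_homog hX hcl ⟨v, hv⟩ hproper
  obtain ⟨p, h1, A, h2, h3⟩ := F_b f hf hd hf0 v hv0 (hfX v hv)
  exact ⟨p, fun h => h3 (mem_vI.1 h A ⟨v, hv, h2⟩), fun A hA v w hv hw hAv hAw => h1 A v w hAv hAw (hfX v hv) (hfX w hw) hA⟩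

theorem part4 {n : ℕ} {X : Set (Fin n → ℂ)} (hX : IsCone X) (hcl : zClosed X) (hirr : zIrred X) (hne : ∃ v ∈ X, v ≠ 0) (hproper : X ≠ Set.univ) :
  ∃ U : Set (MatSpace n), zOpen U ∧
      zClosure (kalmanCone X ∩ U) = zClosure (kalmanCone X) ∧
      ∀ A ∈ kalmanCone X ∩ U, ∀ v w, v ∈ X → w ∈ X →
        IsEigenvector (toMat A) v → IsEigenvector (toMat A) w → ∃ c : ℂ, w = c • v := by
  obtain ⟨p, hp, h⟩ := exists_uniq_poly hX hcl hne hproper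
  refine ⟨_, zOpen_basic p, ?_, fun A hA => h A hA.2⟩
  have hI : vanishingIdealOf (kalmanCone X ∩ {x | eval x p ≠ 0}) = vanishingIdealOf (kalmanCone X) := by
    apply le_antisymm
    · intro q hq
      refine ((zIrred_iff.1 (kalman_irred hirr hne)).2 q p ?_).resolve_right hp
      intro A hA
      by_cases h0 : eval A p = 0
      · rw [h0, mul_zero]
      · rw [mem_vI.1 hq A ⟨hA, h0⟩, zero_mul]
    · exact vI_anti Set.inter_subset_left
  ext x
  rw [mem_zClosure, mem_zClosure, hI]
end
end

section
noncomputable section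
open MvPolynomial Matrix

theorem trdeg_mv {B σ : Type} [CommRing B] [IsDomain B] [Algebra ℂ B] [FaithfulSMul ℂ B] [Fintype σ] (D : ℕ) (h : Algebra.trdeg ℂ B = D) :
    Algebra.trdeg ℂ (MvPolynomial σ B) = (D + Fintype.card σ : ℕ) := by
  rw [← trdeg_add_eq (R := ℂ) (S := B) (A := MvPolynomial σ B), h, MvPolynomial.trdeg_of_isDomain]
  simp

theorem trdeg_nat {B : Type} [CommRing B] [IsDomain B] [Algebra ℂ B] (m : ℕ) (h1 : ¬ ((m + 1 : ℕ) : Cardinal) ≤ Algebra.trdeg ℂ B)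
   (h2 : ∀ k : ℕ, k < m → ¬ Algebra.trdeg ℂ B ≤ k) : Algebra.trdeg ℂ B = m := by
  have h3 : Algebra.trdeg ℂ B < Cardinal.aleph0 := (not_le.1 h1).trans (Cardinal.natCast_lt_aleph0)
  obtain ⟨k, hk⟩ := Cardinal.lt_aleph0.1 h3
  rw [hk] at h1 h2 ⊢
  norm_cast at h1 ⊢
  by_contra hcon
  exact h2 k (by omega) le_rfl

theorem trdeg_cone {ι : Type} [Finite ι] {X : Set (ι → ℂ)} (hcl : zClosed X) (hirr : zIrred X) (m : ℕ) (hdim : zDim X = (m : WithBot ℕ∞)) :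
    Algebra.trdeg ℂ (CR X) = m := by
  have := CR_domain hirr
  apply trdeg_nat
  · intro h
    obtain ⟨Y, h1, h2, h3⟩ := exists_chain hcl hirr (m + 1) h
    have h4 := le_zDim X (m + 1) Y h1 h2 h3
    rw [hdim] at h4
    have h5 : m + 1 ≤ m := by exact_mod_cast h4
    omega
  · intro k hk h
    have h4 := zDim_le_trdeg k h
    rw [hdim] at h4
    have h5 : m ≤ k := by exact_mod_cast h4
    omega

theorem homogenize {n : ℕ} (ψ : Fin n → ℂ) (p : MvPolynomial (Fin n) ℂ) : ∃ (d : ℕ) (P : MvPolynomial (Fin n) ℂ), d ≠ 0 ∧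
    P.IsHomogeneous d ∧ ∀ x : Fin n → ℂ, ∑ i, ψ i * x i = 1 → eval x P = eval x p := by
  refine ⟨p.totalDegree + 1, ∑ k ∈ Finset.range (p.totalDegree + 1), homogeneousComponent k p * linP ψ ^ (p.totalDegree + 1 - k), by omega, ?_, ?_⟩
  · apply IsHomogeneous.sum
    intro k hk
    rw [Finset.mem_range] at hk
    have h := (homogeneousComponent_isHomogeneous k p).mul ((linP_homog ψ).pow (p.totalDegree + 1 - k))
    have h2 : k + 1 * (p.totalDegree + 1 - k) = p.totalDegree + 1 := by omega
    rwa [h2] at h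
  · intro x hx
    conv_rhs => rw [← sum_homogeneousComponent p]
    simp [map_sum, eval_linP, hx]

theorem homog_chart {n d : ℕ} (ψ : Fin n → ℂ) (P : MvPolynomial (Fin n) ℂ) (hP : P.IsHomogeneous d) {X : Set (Fin n → ℂ)} (hX : IsCone X)
    (h : ∀ x ∈ chart X ψ, eval x P = 0) (x : Fin n → ℂ) (hx : x ∈ X) (h0 : ∑ i, ψ i * x i ≠ 0) : eval x P = 0 := by
  have h1 := h _ (chart_scale hX hx h0)
  have h2 := homog_eval hP (∑ i, ψ i * x i)⁻¹ x
  have h3 : eval ((∑ i, ψ i * x i)⁻¹ • x) P = (∑ i, ψ i * x i)⁻¹ ^ d * eval x P := h2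
  rw [h1] at h3
  exact (mul_eq_zero.1 h3.symm).resolve_left (pow_ne_zero _ (inv_ne_zero h0))

theorem linP_notMem {n : ℕ} {X : Set (Fin n → ℂ)} {ψ : Fin n → ℂ} (hne : (chart X ψ).Nonempty) : linP ψ ∉ vanishingIdealOf X := by
  obtain ⟨v, hv, h1⟩ := hne
  intro h
  have := mem_vI.1 h v hv
  rw [eval_linP, h1] at this
  exact one_ne_zero this

theorem chart_irred {n : ℕ} {X : Set (Fin n → ℂ)} (hX : IsCone X) (hirr : zIrred X) {ψ : Fin n → ℂ} (hne : (chart X ψ).Nonempty) :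
    zIrred (chart X ψ) := by
  rw [zIrred_iff]
  refine ⟨hne, fun p q hpq => ?_⟩
  obtain ⟨d, P, hd, hP, hPp⟩ := homogenize ψ p
  obtain ⟨e, Q, he, hQ, hQq⟩ := homogenize ψ q
  have h1 : P * Q * linP ψ ∈ vanishingIdealOf X := by
    rw [mem_vI]
    intro x hx
    rw [map_mul, eval_linP]
    by_cases h0 : ∑ i, ψ i * x i = 0
    · rw [h0, mul_zero]
    · rw [homog_chart ψ (P * Q) (hP.mul hQ) hX ?_ x hx h0, zero_mul]
      intro y hy
      rw [map_mul, hPp y hy.2, hQq y hy.2]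
      exact hpq y hy
  have := vI_prime hirr
  rcases this.mem_or_mem h1 with h2 | h2
  · rcases this.mem_or_mem h2 with h3 | h3
    · left
      rw [mem_vI]
      intro x hx
      rw [← hPp x hx.2]; exact mem_vI.1 h3 x hx.1
    · right
      rw [mem_vI]
      intro x hx
      rw [← hQq x hx.2]; exact mem_vI.1 h3 x hx.1
  · exact absurd h2 (linP_notMem hne)

theorem chart_closed {n : ℕ} {X : Set (Fin n → ℂ)} (hcl : zClosed X) (ψ : Fin n → ℂ) : zClosed (chart X ψ) := by
  rw [zClosed_iff]
  intro x hx
  refine ⟨zClosed_iff.1 hcl x fun p hp => hx p (vI_anti (fun y hy => hy.1) hp), ?_⟩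
  have := hx (linP ψ - 1) (by
    rw [mem_vI]
    intro y hy
    rw [map_sub, eval_linP, hy.2, map_one, sub_self])
  rw [map_sub, eval_linP, map_one, sub_eq_zero] at this
  exact this

theorem trdeg_chart {n m : ℕ} {X : Set (Fin n → ℂ)} (hX : IsCone X) (hirr : zIrred X) {ψ : Fin n → ℂ} (hne : (chart X ψ).Nonempty)
    (hm : 1 ≤ m) (h : Algebra.trdeg ℂ (CR X) = m) : Algebra.trdeg ℂ (CR (chart X ψ)) = (m - 1 : ℕ) := by
  have := CR_domain hirr
  have := CR_domain (chart_irred hX hirr hne)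
  apply trdeg_nat
  · intro h1
    have hmm : m - 1 + 1 = m := by omega
    rw [hmm] at h1
    obtain ⟨g, hg⟩ := exists_algInd m h1
    have hle : vanishingIdealOf X ≤ vanishingIdealOf (chart X ψ) := vI_anti fun y hy => hy.1
    refine trdeg_drop (Ideal.Quotient.factorₐ ℂ hle) (Ideal.Quotient.factor_surjective hle) (Ideal.Quotient.mkₐ ℂ _ (linP ψ - 1)) ?_ ?_ m g hg h.le
    · intro h0
      rw [Ideal.Quotient.mkₐ_eq_mk, Ideal.Quotient.eq_zero_iff_mem, mem_vI] at h0
      obtain ⟨v, hv, -⟩ := hne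
      have h2 := h0 _ (hX 0 v hv)
      rw [map_sub, eval_linP, map_one] at h2
      simp at h2
    · change Ideal.Quotient.mk _ _ = 0
      rw [Ideal.Quotient.eq_zero_iff_mem, mem_vI]
      intro y hy
      rw [map_sub, eval_linP, hy.2, map_one, sub_self]
  · intro k hk hle
    -- embedding of CR X in CR X1 [T]
    let F : MvPolynomial (Fin n) ℂ →ₐ[ℂ] MvPolynomial Unit (CR (chart X ψ)) := aeval fun i => C (yC _ i) * MvPolynomial.X ()
    have hF : ∀ p, F p = 0 ↔ p ∈ vanishingIdealOf X := by
      intro p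
      have hev : ∀ x (hx : x ∈ chart X ψ) (t : Unit → ℂ), prodHom (ptHom x hx) t (F p) = eval (t () • x) p := by
        intro x hx t
        rw [alghom_aeval]
        congr 2
        funext i
        simp [ptHom_y, mul_comm]
      constructor
      · intro h0
        refine ((vI_prime hirr).mem_or_mem (?_ : p * linP ψ ∈ _)).resolve_right (linP_notMem hne)
        rw [mem_vI]
        intro x hx
        rw [map_mul, eval_linP]
        by_cases h1 : ∑ i, ψ i * x i = 0
        · rw [h1, mul_zero]
        · have h2 := hev _ (chart_scale hX hx h1) (fun _ => ∑ i, ψ i * x i)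
          rw [h0, map_zero, smul_smul, mul_inv_cancel₀ h1, one_smul] at h2
          rw [← h2, zero_mul]
      · intro hp
        by_contra hcon
        obtain ⟨x, hx, t, h1⟩ := exists_pt2 _ hcon
        rw [hev] at h1
        exact h1 (mem_vI.1 hp _ (hX _ _ hx.1))
    let F' : CR X →ₐ[ℂ] MvPolynomial Unit (CR (chart X ψ)) := Ideal.Quotient.liftₐ _ F fun p hp => (hF p).2 hp
    have hinj : Function.Injective F' := by
      rw [injective_iff_map_eq_zero]
      intro r hr
      obtain ⟨p, rfl⟩ := Ideal.Quotient.mkₐ_surjective ℂ _ r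
      rw [Ideal.Quotient.mkₐ_eq_mk, Ideal.Quotient.eq_zero_iff_mem]
      exact (hF p).1 hr
    have h1 : Algebra.trdeg ℂ (CR X) ≤ Algebra.trdeg ℂ (MvPolynomial Unit (CR (chart X ψ))) := trdeg_le_of_injective (R := ℂ) (A := CR X) F' hinj
    obtain ⟨k', hk'⟩ := Cardinal.lt_aleph0.1 (hle.trans_lt (Cardinal.natCast_lt_aleph0))
    rw [h, trdeg_mv k' hk'] at h1
    rw [hk'] at hle
    norm_cast at h1 hle
    simp at h1
    omega
end
end

section
noncomputable section
open MvPolynomial Matrix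

abbrev KI (n : ℕ) (k : Fin n) := Option (Fin n × {j : Fin n // j ≠ k})

theorem card_KI (n : ℕ) (k : Fin n) : Fintype.card (KI n k) = n * (n - 1) + 1 := by
  simp [Fintype.card_option, Fintype.card_subtype_compl]

def kB {n : ℕ} {R : Type} [CommRing R] (k : Fin n) (b : KI n k → R) (i j : Fin n) : R :=
  if h : j ≠ k then b (some (i, ⟨j, h⟩)) else 0

def kF {n : ℕ} {R : Type} [CommRing R] [Algebra ℂ R] (ψ : Fin n → ℂ) (k : Fin n) (v : Fin n → R) (b : KI n k → R) (ij : Fin n × Fin n) : R :=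
  (if ij.1 = ij.2 then b none else 0) + kB k b ij.1 ij.2 - (∑ l, kB k b ij.1 l * v l) * algebraMap ℂ R (ψ ij.2)

theorem kB_map {n : ℕ} {R : Type} [CommRing R] [Algebra ℂ R] (χ : R →ₐ[ℂ] ℂ) (k : Fin n) (b : KI n k → R) (i j : Fin n) :
    χ (kB k b i j) = kB k (fun s => χ (b s)) i j := by
  simp only [kB]
  split_ifs <;> simp

theorem kF_map {n : ℕ} {R : Type} [CommRing R] [Algebra ℂ R] (χ : R →ₐ[ℂ] ℂ) (ψ : Fin n → ℂ) (k : Fin n) (v : Fin n → R) (b : KI n k → R) (ij : Fin n × Fin n) :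
    χ (kF ψ k v b ij) = kF ψ k (fun i => χ (v i)) (fun s => χ (b s)) ij := by
  simp only [kF, map_sub, map_add, map_mul, map_sum, kB_map, AlgHom.commutes]
  split_ifs <;> simp

theorem kF_eig {n : ℕ} (ψ : Fin n → ℂ) (k : Fin n) (v : Fin n → ℂ) (hv : ∑ i, ψ i * v i = 1) (b : KI n k → ℂ) :
    (toMat (kF ψ k v b)) *ᵥ v = b none • v := by
  ext i
  simp only [toMat, Matrix.mulVec, dotProduct, of_apply, kF, Pi.smul_apply, smul_eq_mul, Algebra.algebraMap_self, RingHom.id_apply]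
  simp only [sub_mul, add_mul, Finset.sum_sub_distrib, Finset.sum_add_distrib, ite_mul, zero_mul, Finset.sum_ite_eq, Finset.mem_univ, if_true]
  have h2 : ∑ x, (∑ l, kB k b i l * v l) * ψ x * v x = (∑ l, kB k b i l * v l) * ∑ x, ψ x * v x := by
    simp only [mul_assoc, ← Finset.mul_sum]
  rw [h2, hv]; ring

theorem kF_inj {n : ℕ} (ψ : Fin n → ℂ) (k : Fin n) (hk : ψ k ≠ 0) (v : Fin n → ℂ) (hv : ∑ i, ψ i * v i = 1) (b b' : KI n k → ℂ)
    (h : kF ψ k v b = kF ψ k v b') : b = b' := by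
  have hv0 : v ≠ 0 := by rintro rfl; simp at hv
  have h0 : b none = b' none := by
    have h1 := kF_eig ψ k v hv b
    rw [h, kF_eig ψ k v hv b'] at h1
    exact (smul_left_injective ℂ hv0 h1).symm
  have hw : ∀ i, ∑ l, kB k b i l * v l = ∑ l, kB k b' i l * v l := by
    intro i
    have h1 := congrFun h (i, k)
    simp only [kF, h0, Algebra.algebraMap_self, RingHom.id_apply] at h1
    have h2 : kB k b i k = 0 := by simp [kB]
    have h3 : kB k b' i k = 0 := by simp [kB]
    rw [h2, h3] at h1
    exact mul_right_cancel₀ hk (sub_right_injective h1)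
  funext s
  rcases s with _ | ⟨i, j, hj⟩
  · exact h0
  · have h1 := congrFun h (i, j)
    simp only [kF, h0, hw] at h1
    simpa [kB, hj] using h1

theorem kF_surj {n : ℕ} (ψ : Fin n → ℂ) (k : Fin n) (hk : ψ k ≠ 0) (v : Fin n → ℂ) (hv : ∑ i, ψ i * v i = 1) (A : MatSpace n)
    (hA : IsEigenvector (toMat A) v) : ∃ b, A = kF ψ k v b := by
  obtain ⟨-, l, hl⟩ := hA
  let w : Fin n → ℂ := fun i => ((if i = k then l else 0) - A (i, k)) / ψ k
  let b : KI n k → ℂ := fun s => s.elim l fun s => A (s.1, s.2.1) - (if s.1 = s.2.1 then l else 0) + w s.1 * ψ s.2.1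
  have hB : ∀ i j, kB k b i j = A (i, j) - (if i = j then l else 0) + w i * ψ j := by
    intro i j
    by_cases hj : j = k
    · subst hj
      simp only [kB, w, ne_eq, not_true_eq_false, dite_false]
      field_simp
      ring
    · simp [kB, hj, b]
  have hBv : ∀ i, ∑ j, kB k b i j * v j = w i := by
    intro i
    have h1 := congrFun hl i
    simp only [toMat, Matrix.mulVec, dotProduct, of_apply, Pi.smul_apply, smul_eq_mul] at h1
    simp only [hB, sub_mul, add_mul, Finset.sum_sub_distrib, Finset.sum_add_distrib, h1, mul_assoc, ← Finset.mul_sum, hv]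
    simp
  refine ⟨b, ?_⟩
  funext ⟨i, j⟩
  simp only [kF]
  rw [hBv i]
  simp only [hB, Algebra.algebraMap_self, RingHom.id_apply]
  have : b none = l := rfl
  rw [this]; ring

/-- the generic matrix -/
def gF {n : ℕ} (X1 : Set (Fin n → ℂ)) (ψ : Fin n → ℂ) (k : Fin n) : Fin n × Fin n → MvPolynomial (KI n k) (CR X1) :=
  kF ψ k (fun i => C (yC X1 i)) X

theorem gF_eval {n : ℕ} (X1 : Set (Fin n → ℂ)) (ψ : Fin n → ℂ) (k : Fin n) (ξ : MvPolynomial (KI n k) (CR X1) →ₐ[ℂ] ℂ) :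
   (fun ij => ξ (gF X1 ψ k ij)) = kF ψ k (fun i => ξ (C (yC X1 i))) (fun s => ξ (X s)) := by
  funext ij
  exact kF_map (R := MvPolynomial (KI n k) (CR X1)) ξ ψ k _ _ ij

theorem gF_ker {n : ℕ} {X : Set (Fin n → ℂ)} (hX : IsCone X) (hirr : zIrred X) (ψ : Fin n → ℂ) (hne : (chart X ψ).Nonempty) (k : Fin n)
    (hk : ψ k ≠ 0) (p : MvPolynomial (Fin n × Fin n) ℂ) :
    aeval (gF (chart X ψ) ψ k) p = 0 ↔ p ∈ vanishingIdealOf (kalmanCone X) := by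
  rw [← vI_chart hX hirr hne]
  constructor
  · intro h
    rw [mem_vI]
    rintro A ⟨v, hv, hA⟩
    obtain ⟨b, rfl⟩ := kF_surj ψ k hk v hv.2 A hA
    have := alghom_aeval (gF (chart X ψ) ψ k) (prodHom (ptHom v hv) b) p
    rw [h, map_zero, gF_eval] at this
    simp only [prodHom_C, prodHom_X, ptHom_y] at this
    exact this.symm
  · intro h
    by_contra hcon
    obtain ⟨v, hv, b, h1⟩ := exists_pt2 _ hcon
    rw [alghom_aeval, gF_eval] at h1
    simp only [prodHom_C, prodHom_X, ptHom_y] at h1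
    refine h1 (mem_vI.1 h _ ⟨v, hv, ?_, b none, kF_eig ψ k v hv.2 b⟩)
    rintro rfl
    have := hv.2
    simp at this

theorem trdeg_K {n m : ℕ} (hm : 1 ≤ m) (hmn : m ≤ n) {X : Set (Fin n → ℂ)} (hX : IsCone X) (hirr : zIrred X) (ψ : Fin n → ℂ) (hne : (chart X ψ).Nonempty) (k : Fin n)
    (hk : ψ k ≠ 0) (h : Algebra.trdeg ℂ (CR X) = m) : Algebra.trdeg ℂ (CR (kalmanCone X)) ≤ (n ^ 2 - (n - m) : ℕ) ∧ 
      Algebra.trdeg ℂ (MvPolynomial (KI n k) (CR (chart X ψ))) = (n ^ 2 - (n - m) : ℕ) := by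
  have := CR_domain (chart_irred hX hirr hne)
  have h2 : Algebra.trdeg ℂ (MvPolynomial (KI n k) (CR (chart X ψ))) = (n ^ 2 - (n - m) : ℕ) := by
    rw [trdeg_mv (m - 1) (trdeg_chart hX hirr hne hm h), card_KI]
    norm_cast
    obtain ⟨n, rfl⟩ : ∃ n', n = n' + 1 := ⟨n - 1, by omega⟩
    obtain ⟨m, rfl⟩ : ∃ n', m = n' + 1 := ⟨m - 1, by omega⟩
    obtain ⟨d, rfl⟩ : ∃ d, n = m + d := ⟨n - m, by omega⟩
    have : m + d + 1 - (m + 1) = d := by omega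
    rw [this]
    simp only [Nat.add_sub_cancel]
    apply Nat.eq_sub_of_add_eq
    ring
  refine ⟨?_, h2⟩
  rw [← h2]
  let F' : CR (kalmanCone X) →ₐ[ℂ] MvPolynomial (KI n k) (CR (chart X ψ)) := 
    Ideal.Quotient.liftₐ _ (aeval (gF (chart X ψ) ψ k)) fun p hp => (gF_ker hX hirr ψ hne k hk p).2 hp
  have hinj : Function.Injective F' := by
    rw [injective_iff_map_eq_zero]
    intro r hr
    obtain ⟨p, rfl⟩ := Ideal.Quotient.mkₐ_surjective ℂ _ r
    rw [Ideal.Quotient.mkₐ_eq_mk, Ideal.Quotient.eq_zero_iff_mem]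
    exact (gF_ker hX hirr ψ hne k hk p).1 hr
  exact trdeg_le_of_injective (R := ℂ) (A := CR (kalmanCone X)) F' hinj
end
end

section
noncomputable section
open MvPolynomial Matrix

theorem irred_submodule {ι : Type} (L : Submodule ℂ (ι → ℂ)) : zIrred (L : Set (ι → ℂ)) := by
  rw [zIrred_iff]
  refine ⟨⟨0, L.zero_mem⟩, fun p q hpq => ?_⟩
  by_contra hcon
  rw [not_or] at hcon
  obtain ⟨hp, hq⟩ := hcon
  simp only [mem_vI] at hp hq
  push Not at hp hq
  obtain ⟨x, hx, hpx⟩ := hp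
  obtain ⟨y, hy, hqy⟩ := hq
  let g : ι → Polynomial ℂ := fun i => Polynomial.C (x i) + Polynomial.X * Polynomial.C (y i - x i)
  have hev : ∀ (t : ℂ) (r : MvPolynomial ι ℂ), Polynomial.eval t (aeval g r) = eval (x + t • (y - x)) r := by
    intro t r
    have h1 := alghom_aeval g (Polynomial.aeval t) r
    rw [Polynomial.coe_aeval_eq_eval] at h1
    rw [h1]
    congr 2
    funext i
    simp [g]
  have h1 : aeval g p * aeval g q = 0 := by
    apply Polynomial.funext
    intro t
    rw [Polynomial.eval_mul, hev, hev, Polynomial.eval_zero]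
    exact hpq _ (L.add_mem hx (L.smul_mem _ (L.sub_mem hy hx)))
  rcases mul_eq_zero.1 h1 with h2 | h2
  · apply hpx
    have := hev 0 p
    rw [h2] at this
    simpa using this.symm
  · apply hqy
    have := hev 1 q
    rw [h2] at this
    simpa using this.symm

theorem vI_submodule {ι : Type} [Fintype ι] (L L' : Submodule ℂ (ι → ℂ)) (h : L < L') :
    vanishingIdealOf (L' : Set (ι → ℂ)) < vanishingIdealOf (L : Set (ι → ℂ)) := by
  classical
  refine lt_of_le_not_ge (vI_anti h.le) fun hcon => ?_
  obtain ⟨x, hx', hx⟩ := Set.exists_of_ssubset h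
  obtain ⟨f, hf, hfL⟩ := Submodule.exists_le_ker_of_notMem hx
  let p : MvPolynomial ι ℂ := ∑ i, C (f (Pi.single i 1)) * X i
  have hp : ∀ z, eval z p = f z := by
    intro z
    simp only [p, map_sum, map_mul, eval_C, eval_X]
    conv_rhs => rw [← Finset.univ_sum_single z, map_sum]
    refine Finset.sum_congr rfl fun i _ => ?_
    have : (Pi.single i (z i) : ι → ℂ) = z i • Pi.single i 1 := by
      rw [← Pi.single_smul]; simp
    rw [this, map_smul, smul_eq_mul, mul_comm]
  have h1 : p ∈ vanishingIdealOf (L : Set (ι → ℂ)) := by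
    rw [mem_vI]
    intro z hz
    rw [hp]; exact hfL hz
  have := mem_vI.1 (hcon h1) x hx'
  rw [hp] at this
  exact hf this

theorem zClosure_props {ι : Type} {Y Z : Set (ι → ℂ)} (hY : zIrred Y) (hZ : zClosed Z) (h : Y ⊆ Z) :
    zIrred (zClosure Y) ∧ zClosure Y ⊆ Z ∧ vanishingIdealOf (zClosure Y) = vanishingIdealOf Y := by
  refine ⟨?_, ?_, ?_⟩
  · let _ := zTop ι
    exact IsIrreducible.closure hY
  · intro x hx
    exact zClosed_iff.1 hZ x fun p hp => mem_zClosure.1 hx p (vI_anti h hp)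
  · ext p
    constructor
    · intro hp
      rw [mem_vI]
      intro x hx
      exact mem_vI.1 hp x (mem_zClosure.2 fun q hq => mem_vI.1 hq x hx)
    · intro hp
      rw [mem_vI]
      intro x hx
      exact mem_zClosure.1 hx p hp

theorem kalman_strict {n : ℕ} {ψ : Fin n → ℂ} (Y Y' : Set (Fin n → ℂ)) (hY : ∀ v ∈ Y, ∑ i, ψ i * v i = 1) (hY' : ∀ v ∈ Y', ∑ i, ψ i * v i = 1) 
    (hsub : Y ⊆ Y') (h : vanishingIdealOf Y' < vanishingIdealOf Y) :
    vanishingIdealOf (kalmanCone Y') < vanishingIdealOf (kalmanCone Y) := by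
  refine lt_of_le_not_ge (vI_anti fun A ⟨v, hv, h⟩ => ⟨v, hsub hv, h⟩) fun hcon => ?_
  obtain ⟨f, hf, hf'⟩ := Set.exists_of_ssubset h
  rw [SetLike.mem_coe, mem_vI] at hf'
  push Not at hf'
  obtain ⟨v, hv, hfv⟩ := hf'
  obtain ⟨d, P, hd, hP, hPf⟩ := homogenize ψ f
  obtain ⟨p, h1, A, h2, h3⟩ := F_a P hP hd v (by rw [hPf v (hY' v hv)]; exact hfv)
  have h4 : p ∈ vanishingIdealOf (kalmanCone Y) := by
    rw [mem_vI]
    rintro B ⟨w, hw, hB⟩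
    exact h1 B w hB (by rw [hPf w (hY w hw)]; exact mem_vI.1 hf w hw)
  exact h3 (mem_vI.1 (hcon h4) A ⟨v, hv, h2⟩)

def kLin {n : ℕ} (ψ : Fin n → ℂ) (k : Fin n) (v : Fin n → ℂ) : (KI n k → ℂ) →ₗ[ℂ] MatSpace n where
  toFun := kF ψ k v
  map_add' b b' := by
    have : ∀ i j, kB k (b + b') i j = kB k b i j + kB k b' i j := by
      intro i j; simp only [kB]; split_ifs <;> simp
    funext ⟨i, j⟩
    simp only [kF, Pi.add_apply, this, add_mul, Finset.sum_add_distrib]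
    split_ifs <;> ring
  map_smul' c b := by
    have : ∀ i j, kB k (c • b) i j = c * kB k b i j := by
      intro i j; simp only [kB]; split_ifs <;> simp
    funext ⟨i, j⟩
    simp only [kF, Pi.smul_apply, this, mul_assoc, ← Finset.mul_sum, smul_eq_mul, RingHom.id_apply]
    split_ifs <;> ring

theorem dim_lower {n m : ℕ} (hm : 1 ≤ m) {X : Set (Fin n → ℂ)} (hX : IsCone X) (hcl : zClosed X) (hirr : zIrred X) (ψ : Fin n → ℂ) (hne : (chart X ψ).Nonempty) (k : Fin n)
    (hk : ψ k ≠ 0) (h : Algebra.trdeg ℂ (CR X) = m) : ((n * (n - 1) + 1 + (m - 1) : ℕ) : WithBot ℕ∞) ≤ zDim (kalmanCone X) := by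
  obtain ⟨Y0, hY0, hY0i, hY0s⟩ := exists_chain (chart_closed hcl ψ) (chart_irred hX hirr hne) (m - 1) (trdeg_chart hX hirr hne hm h).ge
  let Y := fun i => zClosure (Y0 i)
  have hYp := fun i => zClosure_props (hY0i i) (chart_closed hcl ψ) (hY0 i)
  have hYs : StrictAnti fun i => vanishingIdealOf (Y i) := by
    intro i j hij
    have := hY0s hij
    simp only [Y, (hYp _).2.2] 
    exact this
  have hYm : ∀ i j, i ≤ j → Y i ⊆ Y j := by
    intro i j hij x hx
    have h1 := hYs.antitone hij
    simp only [Y, (hYp _).2.2] at h1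
    exact mem_zClosure.2 fun p hp => mem_zClosure.1 hx p (h1 hp)
  have hY1 : ∀ i, ∀ v ∈ Y i, ∑ l, ψ l * v l = 1 := fun i v hv => ((hYp i).2.1 hv).2
  have hYne : ∀ i, ∃ v ∈ Y i, v ≠ 0 := by
    intro i
    obtain ⟨v, hv⟩ := (hYp i).1.1
    exact ⟨v, hv, by rintro rfl; simpa using hY1 i _ hv⟩
  obtain ⟨v, hv, hv0⟩ := hYne 0
  have hψv := hY1 0 v hv
  -- the flag
  set N := n * (n - 1) + 1 with hN
  let e : KI n k ≃ Fin N := Fintype.equivFinOfCardEq (card_KI n k)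
  let bs : Module.Basis (Fin N) ℂ (KI n k → ℂ) := (Pi.basisFun ℂ (KI n k)).reindex e
  have hinj : Function.Injective (kLin ψ k v) := fun b b' hb => kF_inj ψ k hk v hψv b b' hb
  let L : Fin (N + 1) → Submodule ℂ (MatSpace n) := fun i => (bs.flag i).map (kLin ψ k v)
  have hL : StrictMono L := fun i j hij => (Submodule.map_strictMono_of_injective hinj) (bs.flag_strictMono hij)
  have hLK : ∀ i, (L i : Set (MatSpace n)) ⊆ kalmanCone (Y 0) := by
    rintro i A ⟨b, -, rfl⟩
    exact ⟨v, hv, hv0, b none, kF_eig ψ k v hψv b⟩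
  let Z : Fin (N + (m - 1) + 1) → Set (MatSpace n) := fun i =>
    if h : i.1 ≤ N then L ⟨i.1, by omega⟩ else kalmanCone (Y ⟨i.1 - N, by omega⟩)
  refine le_zDim _ (N + (m - 1)) Z ?_ ?_ ?_
  · intro i
    simp only [Z]
    have hYK : ∀ j, kalmanCone (Y j) ⊆ kalmanCone X := fun j A ⟨v, hv, hA⟩ => ⟨v, ((hYp j).2.1 hv).1, hA⟩
    split_ifs with hi
    · exact (hLK _).trans (hYK 0)
    · exact hYK _
  · intro i
    simp only [Z]
    split_ifs with hi
    · exact irred_submodule _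
    · exact kalman_irred (hYp _).1 (hYne _)
  · intro i j hij
    have hij' : i.1 < j.1 := hij
    simp only [Z]
    split_ifs with hj hi hi
    · exact vI_submodule _ _ (hL (by exact hij))
    · omega
    · refine lt_of_lt_of_le (kalman_strict (Y 0) _ (hY1 _) (hY1 _) (hYm _ _ (Fin.zero_le _)) (hYs ?_)) (vI_anti (hLK _))
      rw [Fin.lt_def]
      simp
      omega
    · have hlt : (⟨i.1 - N, by omega⟩ : Fin (m - 1 + 1)) < ⟨j.1 - N, by omega⟩ := by
        rw [Fin.lt_def]; simp; omega
      exact kalman_strict _ _ (hY1 _) (hY1 _) (hYm _ _ hlt.le) (hYs hlt)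

theorem dim_K {n m : ℕ} (hm : 1 ≤ m) (hmn : m ≤ n) {X : Set (Fin n → ℂ)} (hX : IsCone X) (hcl : zClosed X) (hirr : zIrred X) (ψ : Fin n → ℂ) (hne : (chart X ψ).Nonempty) (k : Fin n)
    (hk : ψ k ≠ 0) (h : Algebra.trdeg ℂ (CR X) = m) : zDim (kalmanCone X) = ((n ^ 2 - (n - m) : ℕ) : WithBot ℕ∞) := by
  apply le_antisymm
  · exact zDim_le_trdeg _ (trdeg_K hm hmn hX hirr ψ hne k hk h).1
  · have h1 := dim_lower hm hX hcl hirr ψ hne k hk h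
    have h2 : n * (n - 1) + 1 + (m - 1) = n ^ 2 - (n - m) := by
      obtain ⟨n, rfl⟩ : ∃ n', n = n' + 1 := ⟨n - 1, by omega⟩
      obtain ⟨m, rfl⟩ : ∃ n', m = n' + 1 := ⟨m - 1, by omega⟩
      obtain ⟨d, rfl⟩ : ∃ d, n = m + d := ⟨n - m, by omega⟩
      have : m + d + 1 - (m + 1) = d := by omega
      rw [this]
      simp only [Nat.add_sub_cancel]
      apply Nat.eq_sub_of_add_eq
      ring
    rwa [h2] at h1
end
end

section
noncomputable section
open MvPolynomial

theorem mem_pow_of_adjoin {B ι : Type} [CommRing B] [Algebra ℂ B] (y : ι → B) (hgen : Algebra.adjoin ℂ (Set.range y) = ⊤)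
    (V : Submodule ℂ B) (hy : ∀ i, y i ∈ V) (h1 : (1 : B) ∈ V) (x : B) : ∃ s : ℕ, x ∈ V ^ s := by
  have hmono : ∀ a b : ℕ, a ≤ b → V ^ a ≤ V ^ b := fun a b hab =>
    pow_le_pow_right₀ (by rwa [Submodule.one_le]) hab
  have hx : x ∈ Algebra.adjoin ℂ (Set.range y) := by rw [hgen]; trivial
  induction hx using Algebra.adjoin_induction with
  | mem x hx => obtain ⟨i, rfl⟩ := hx; exact ⟨1, by rw [pow_one]; exact hy i⟩
  | algebraMap r => exact ⟨0, by rw [pow_zero]; exact Submodule.algebraMap_mem r⟩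
  | add x y _ _ hx hy =>
    obtain ⟨s, hs⟩ := hx
    obtain ⟨t, ht⟩ := hy
    exact ⟨s + t, (V ^ (s + t)).add_mem (hmono _ _ (by omega) hs) (hmono _ _ (by omega) ht)⟩
  | mul x y _ _ hx hy =>
    obtain ⟨s, hs⟩ := hx
    obtain ⟨t, ht⟩ := hy
    exact ⟨s + t, by rw [pow_add]; exact Submodule.mul_mem_mul hs ht⟩

theorem algInd_of_noether {B : Type} [CommRing B] [IsDomain B] [Algebra ℂ B] {D : ℕ} 
    (V : Submodule ℂ B) [FiniteDimensional ℂ V] (h1 : (1 : B) ∈ V) (hgen : ∀ x : B, ∃ s : ℕ, x ∈ V ^ s)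
    (g : Fin D → B) (htr : (D : Cardinal) ≤ Algebra.trdeg ℂ B) (e : ℕ)
    (hW : V ^ (e + 1) ≤ V ^ e * Submodule.span ℂ (insert 1 (Set.range g))) : AlgebraicIndependent ℂ g := by
  have hmono : ∀ a b : ℕ, a ≤ b → V ^ a ≤ V ^ b := fun a b hab =>
    pow_le_pow_right₀ (by rwa [Submodule.one_le]) hab
  let A := Algebra.adjoin ℂ (Set.range g)
  have hWA : Submodule.span ℂ (insert 1 (Set.range g)) ≤ Subalgebra.toSubmodule A := by
    rw [Submodule.span_le]
    rintro x (rfl | hx)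
    · exact A.one_mem
    · exact Algebra.subset_adjoin hx
  have h2 : ∀ k, V ^ (e + k) ≤ V ^ e * Subalgebra.toSubmodule A := by
    intro k
    induction k with
    | zero =>
      intro x hx
      have := Submodule.mul_mem_mul hx (show (1 : B) ∈ Subalgebra.toSubmodule A from A.one_mem)
      rwa [mul_one] at this
    | succ k ih =>
      calc V ^ (e + (k + 1)) = V ^ (e + k) * V := by rw [← add_assoc, pow_succ]
        _ ≤ (V ^ e * Subalgebra.toSubmodule A) * V := mul_le_mul' ih le_rfl
        _ = V ^ (e + 1) * Subalgebra.toSubmodule A := by rw [pow_succ]; ring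
        _ ≤ (V ^ e * Subalgebra.toSubmodule A) * Subalgebra.toSubmodule A := mul_le_mul' (hW.trans (mul_le_mul' le_rfl hWA)) le_rfl
        _ = V ^ e * Subalgebra.toSubmodule A := by
          rw [mul_assoc, (A.isIdempotentElem_toSubmodule).eq]
  have h3 : ∀ x : B, x ∈ V ^ e * Subalgebra.toSubmodule A := by
    intro x
    obtain ⟨s, hs⟩ := hgen x
    exact h2 s (hmono _ _ (by omega) hs)
  have hfg : (V ^ e).FG := (Module.Finite.iff_fg.1 ‹_›).pow e
  obtain ⟨S, hS⟩ := hfg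
  have hfin : Module.Finite A B := by
    refine ⟨⟨S, ?_⟩⟩
    rw [eq_top_iff]
    intro x _
    refine Submodule.mul_induction_on (h3 x) ?_ (fun a b ha hb => Submodule.add_mem _ ha hb)
    intro a ha b hb
    rw [mul_comm]
    have ha' : a ∈ Submodule.span A (S : Set B) := by
      rw [← hS] at ha
      exact Submodule.span_le_restrictScalars ℂ A (S : Set B) ha
    exact Submodule.smul_mem (Submodule.span A (S : Set B)) (⟨b, hb⟩ : A) ha'
  have h_integral : Algebra.IsIntegral A B := Algebra.IsIntegral.of_finite A B
  have halg : Algebra.IsAlgebraic A B := h_integral.isAlgebraic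
  exact (Algebra.IsAlgebraic.isTranscendenceBasis_of_le_trdeg_of_finite ℂ g (by simpa using htr)).1

theorem deg_core {B ι : Type} [CommRing B] [IsDomain B] [Algebra ℂ B] [Algebra.FiniteType ℂ B] [Fintype ι] (y : ι → B)
    (ψ : ι → ℂ) (h1 : ∑ i, ψ i • y i = 1) (hgen : Algebra.adjoin ℂ (Set.range y) = ⊤) (D : ℕ)
    (htr : Algebra.trdeg ℂ B = D) (q : MvPolynomial (Fin D × ι) ℂ) (hq : q ≠ 0) :
    ∃ (c : Fin D × ι → ℂ) (δ s : ℕ), eval c q ≠ 0 ∧ 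
      Nat.card {χ : B →ₐ[ℂ] ℂ // ∀ j, ∑ i, c (j, i) * χ (y i) = 0} = δ ∧
      ∀ k : ℕ, δ * (k + D).choose D ≤ Module.finrank ℂ ((Submodule.span ℂ (Set.range y)) ^ (k + s) : Submodule ℂ B) ∧
      Module.finrank ℂ ((Submodule.span ℂ (Set.range y)) ^ k : Submodule ℂ B) ≤ δ * (k + s + D).choose D := by
  set V := Submodule.span ℂ (Set.range y) with hV
  have hyV : ∀ i, y i ∈ V := fun i => Submodule.subset_span (Set.mem_range_self i)
  have h1V : (1 : B) ∈ V := by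
    rw [← h1]
    exact V.sum_mem fun i _ => V.smul_mem _ (hyV i)
  have hfd : FiniteDimensional ℂ V := FiniteDimensional.span_of_finite ℂ (Set.finite_range y)
  have hgen' := mem_pow_of_adjoin y hgen V hyV h1V
  have hD : D ≤ Fintype.card ι := by
    have hsurj : Function.Surjective (aeval (R := ℂ) y) := by
      rw [← AlgHom.range_eq_top, ← Algebra.adjoin_range_eq_range_aeval, hgen]
    have := trdeg_le_of_surjective (R := ℂ) _ hsurj
    rw [htr, MvPolynomial.trdeg_of_isDomain] at this
    simpa using this
  obtain ⟨c, hc, e, hce⟩ := noether_density y V hV h1V D htr.le hD q hq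
  set g : Fin D → B := fun j => ∑ i, c (j, i) • y i with hg
  have hgV : ∀ j, g j ∈ V := fun j => V.sum_mem fun i _ => V.smul_mem _ (hyV i)
  have hAI := algInd_of_noether V h1V hgen' g htr.ge e hce
  obtain ⟨δ, q1, hq1, hcard, hb⟩ := gfc g (by simpa using htr.le)
  obtain ⟨b, hb, hb'⟩ := hb hAI
  obtain ⟨s, hs⟩ := hilb V h1V hgen' g hAI hgV e hce b hb hb'
  let Q : MvPolynomial (Fin D) ℂ := aeval (fun ji : Fin D × ι => C (c ji) - X ji.1 * C (ψ ji.2)) q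
  have hQ : ∀ a, eval a Q = eval (fun ji => c ji - a ji.1 * ψ ji.2) q := by
    intro a
    have h2 := alghom_aeval (fun ji : Fin D × ι => (C (c ji) - X ji.1 * C (ψ ji.2) : MvPolynomial (Fin D) ℂ)) (aeval a) q
    rw [aeval_eq_eval] at h2
    change eval a Q = _ at h2
    rw [h2]
    simp
  have hQ0 : Q ≠ 0 := by
    intro h0
    have := hQ 0
    rw [h0, map_zero] at this
    simp only [Pi.zero_apply, zero_mul, sub_zero] at this
    exact hc this.symm
  obtain ⟨a, ha⟩ := exists_eval_ne (q1 * Q) (mul_ne_zero hq1 hQ0)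
  rw [map_mul, hQ] at ha
  refine ⟨_, δ, s, right_ne_zero_of_mul ha, ?_, hs⟩
  rw [← hcard a (left_ne_zero_of_mul ha)]
  have : ∀ χ : B →ₐ[ℂ] ℂ, (∀ j, ∑ i, (c (j, i) - a j * ψ i) * χ (y i) = 0) ↔ ∀ j, χ (g j) = a j := by
    intro χ
    refine forall_congr' fun j => ?_
    have h2 := congrArg χ h1
    simp only [map_sum, map_smul, smul_eq_mul, map_one] at h2
    simp only [hg, map_sum, map_smul, smul_eq_mul, sub_mul, Finset.sum_sub_distrib, mul_assoc, ← Finset.mul_sum, h2, mul_one, sub_eq_zero]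
  simp only [this]
end
end

section
noncomputable section
open MvPolynomial

theorem deg_ext {B ι : Type} [CommRing B] [IsDomain B] [Algebra ℂ B] [Algebra.FiniteType ℂ B] [Fintype ι] (y : ι → B)
    (ψ : ι → ℂ) (h1 : ∑ i, ψ i • y i = 1) (hgen : Algebra.adjoin ℂ (Set.range y) = ⊤) (D : ℕ)
    (htr : Algebra.trdeg ℂ B = D) (δ : ℕ) (q0 : MvPolynomial (Fin D × ι) ℂ) (hq0 : q0 ≠ 0)
    (hδ : ∀ c, eval c q0 ≠ 0 → Nat.card {χ : B →ₐ[ℂ] ℂ // ∀ j, ∑ i, c (j, i) * χ (y i) = 0} = δ) (E : ℕ)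
    (q : MvPolynomial (Fin (D + E) × (ι × Option (Fin E))) ℂ) (hq : q ≠ 0) :
    ∃ c, eval c q ≠ 0 ∧ Nat.card {χ : MvPolynomial (Fin E) B →ₐ[ℂ] ℂ // ∀ j, ∑ io, c (j, io) * χ (yExt E y io) = 0} = δ * (D + E).choose D := by
  obtain ⟨c0, δ0, s, hc0, hcard0, hs⟩ := deg_core y ψ h1 hgen D htr q0 hq0
  rw [hδ c0 hc0] at hcard0
  subst hcard0
  have hyV : ∀ i, y i ∈ Submodule.span ℂ (Set.range y) := fun i => Submodule.subset_span (Set.mem_range_self i)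
  have h1V : (1 : B) ∈ Submodule.span ℂ (Set.range y) := by
    rw [← h1]
    exact Submodule.sum_mem _ fun i _ => Submodule.smul_mem _ _ (hyV i)
  have hCs : ∀ (a : ℂ) (b : B), (C (a • b) : MvPolynomial (Fin E) B) = a • C b := fun a b =>
    map_smul (IsScalarTower.toAlgHom ℂ B (MvPolynomial (Fin E) B)) a b
  let ψ' : ι × Option (Fin E) → ℂ := fun io => io.2.elim (ψ io.1) fun _ => 0
  have h1' : ∑ io, ψ' io • yExt E y io = 1 := by
    rw [Fintype.sum_prod_type]
    simp only [Fintype.sum_option, ψ', Option.elim, zero_smul, Finset.sum_const_zero, add_zero, yExt, mul_one]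
    have := congrArg (C : B → MvPolynomial (Fin E) B) h1
    simpa only [map_sum, hCs, map_one] using this
  have hC : ∀ b : B, C b ∈ Algebra.adjoin ℂ (Set.range (yExt E y)) := by
    intro b
    have hb : b ∈ Algebra.adjoin ℂ (Set.range y) := by rw [hgen]; trivial
    induction hb using Algebra.adjoin_induction with
    | mem x hx =>
      obtain ⟨i, rfl⟩ := hx
      refine Algebra.subset_adjoin ⟨(i, none), ?_⟩
      simp [yExt]
    | algebraMap r => exact Subalgebra.algebraMap_mem _ r
    | add x y _ _ hx hy => rw [map_add]; exact Subalgebra.add_mem _ hx hy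
    | mul x y _ _ hx hy => rw [map_mul]; exact Subalgebra.mul_mem _ hx hy
  have hX : ∀ o, X o ∈ Algebra.adjoin ℂ (Set.range (yExt E y)) := by
    intro o
    have h2 : (X o : MvPolynomial (Fin E) B) = ∑ i, ψ i • yExt E y (i, some o) := by
      have := congrArg (fun b : B => (C b * X o : MvPolynomial (Fin E) B)) h1
      simp only [map_sum, map_one, one_mul, Finset.sum_mul] at this
      rw [← this]
      refine Finset.sum_congr rfl fun i _ => ?_
      simp only [yExt, hCs, smul_mul_assoc, Option.elim]
    rw [h2]
    exact Subalgebra.sum_mem _ fun i _ => Subalgebra.smul_mem _ (Algebra.subset_adjoin (Set.mem_range_self _)) _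
  have hgen' : Algebra.adjoin ℂ (Set.range (yExt E y)) = ⊤ := by
    rw [eq_top_iff]
    intro p _
    induction p using MvPolynomial.induction_on with
    | C a => exact hC a
    | add p q hp hq => exact Subalgebra.add_mem _ (hp trivial) (hq trivial)
    | mul_X p i hp => exact Subalgebra.mul_mem _ (hp trivial) (hX i)
  have htr' : Algebra.trdeg ℂ (MvPolynomial (Fin E) B) = (D + E : ℕ) := by
    rw [trdeg_mv D htr, Fintype.card_fin]
  have hft : Algebra.FiniteType ℂ (MvPolynomial (Fin E) B) := Algebra.FiniteType.trans (S := B) inferInstance inferInstance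
  obtain ⟨c, δ', s', hc, hcard, hs'⟩ := deg_core (yExt E y) ψ' h1' hgen' (D + E) htr' q hq
  refine ⟨c, hc, ?_⟩
  rw [hcard]
  have hfd : FiniteDimensional ℂ (Submodule.span ℂ (Set.range y)) := FiniteDimensional.span_of_finite ℂ (Set.finite_range y)
  have hfd' : ∀ d : ℕ, FiniteDimensional ℂ ((Submodule.span ℂ (Set.range y)) ^ d : Submodule ℂ B) := fun d =>
    Module.Finite.iff_fg.2 ((Module.Finite.iff_fg.1 hfd).pow d)
  have hf : ∀ d : ℕ, Module.finrank ℂ ((Submodule.span ℂ (Set.range (yExt E y))) ^ d : Submodule ℂ _) =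
      Module.finrank ℂ ((Submodule.span ℂ (Set.range y)) ^ d : Submodule ℂ B) * (d + E).choose E := fun d => by
    have := hfd' d
    rw [yExt_pow E y h1V, finrank_polyIn]
  simp only [hf] at hs'
  refine deg_compare δ δ' D E (s + s') ?_ ?_
  · intro k
    refine (hs' k).1.trans ?_
    refine Nat.mul_le_mul ?_ (Nat.choose_le_choose _ (by omega))
    refine (hs (k + s')).2.trans ?_
    have : k + s' + s + D = k + (s + s') + D := by omega
    rw [this]
  · intro k
    have h2 := (hs' (k + s)).2
    have : k + s + s' + (D + E) = k + (s + s') + (D + E) := by omega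
    rw [this] at h2
    refine le_trans ?_ h2
    exact Nat.mul_le_mul (hs k).1 (Nat.choose_le_choose _ (by omega))
end
end

section
noncomputable section
open MvPolynomial

theorem eval_bind {σ τ : Type} (g : σ → MvPolynomial τ ℂ) (M : τ → ℂ) (q : MvPolynomial σ ℂ) :
    eval M (bind₁ g q) = eval (fun p => eval M (g p)) q := by
  simp only [← MvPolynomial.coe_aeval_eq_eval]
  exact aeval_bind₁ _ _ _

theorem choose_psi {n d : ℕ} (X : Set (Fin n → ℂ)) (hX : IsCone X) (hne : ∃ v ∈ X, v ≠ 0)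
    (degX : ℕ) (hdeg : hasConeDegree X d degX) :
    ∃ ψ : Fin n → ℂ, (chart X ψ).Nonempty ∧ ∃ q : MvPolynomial (Fin d × Fin n) ℂ, q ≠ 0 ∧
      ∀ M, eval M q ≠ 0 → {x | x ∈ chart X ψ ∧ ∀ j, ∑ i, M (j, i) * x i = 0}.ncard = degX := by
  classical
  obtain ⟨U, hUo, hUd, hU⟩ := hdeg
  obtain ⟨qX, hqX, hqU⟩ := zDense_poly hUo hUd
  obtain ⟨v0, hv0, hv0'⟩ := hne
  obtain ⟨i0, hi0⟩ := Function.ne_iff.1 hv0'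
  have hi0' : v0 i0 ≠ 0 := hi0
  let L : MvPolynomial (Fin (d + 1) × Option (Fin n)) ℂ := ∑ i, C (v0 i) * MvPolynomial.X (Fin.last d, some i)
  have hL : L ≠ 0 := by
    intro h
    have := congrArg (eval (fun p => if p = (Fin.last d, some i0) then (1 : ℂ) else 0)) h
    simp [L] at this
    exact hi0' this
  obtain ⟨a0, ha0⟩ := exists_eval_ne (qX * MvPolynomial.X (Fin.last d, none) * L)
    (mul_ne_zero (mul_ne_zero hqX (X_ne_zero _)) hL)
  simp only [map_mul, eval_X] at ha0
  have hA : eval a0 qX ≠ 0 := fun h => ha0 (by simp [h])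
  have hB : a0 (Fin.last d, none) ≠ 0 := fun h => ha0 (by simp [h])
  have hCC : eval a0 L ≠ 0 := fun h => ha0 (by simp [h])
  simp only [L, map_sum, map_mul, eval_C, eval_X] at hCC
  set s : ℂ := a0 (Fin.last d, none) with hs
  let ψ : Fin n → ℂ := fun i => - a0 (Fin.last d, some i) / s
  have hψ : ∀ x : Fin n → ℂ, s + ∑ i, a0 (Fin.last d, some i) * x i = 0 ↔ ∑ i, ψ i * x i = 1 := by
    intro x
    have : ∑ i, ψ i * x i = - (∑ i, a0 (Fin.last d, some i) * x i) / s := by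
      rw [neg_div, Finset.sum_div, ← Finset.sum_neg_distrib]
      refine Finset.sum_congr rfl fun i _ => ?_
      simp only [ψ]; ring
    rw [this, div_eq_one_iff_eq hB]
    constructor
    · intro h; linear_combination (-1 : ℂ) * h
    · intro h; linear_combination (-1 : ℂ) * h
  have hψv : ∑ i, ψ i * v0 i ≠ 0 := by
    intro h
    apply hCC
    have : ∑ i, ψ i * v0 i = - (∑ i, v0 i * a0 (Fin.last d, some i)) / s := by
      rw [neg_div, Finset.sum_div, ← Finset.sum_neg_distrib]
      refine Finset.sum_congr rfl fun i _ => ?_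
      simp only [ψ]; ring
    rw [this, div_eq_zero_iff] at h
    exact neg_eq_zero.1 (h.resolve_right hB)
  refine ⟨ψ, ⟨_, chart_scale hX hv0 hψv⟩, ?_⟩
  let g : Fin (d + 1) × Option (Fin n) → MvPolynomial (Fin d × Fin n) ℂ := fun p =>
    match p with
    | (j, none) => C (a0 (j, none))
    | (j, some i) => Fin.lastCases (motive := fun _ => MvPolynomial (Fin d × Fin n) ℂ) (C (a0 (Fin.last d, some i)))
        (fun k => MvPolynomial.X (k, i) - C (a0 (k.castSucc, none) * ψ i)) j
  have hg : ∀ M : Fin d × Fin n → ℂ, eval M (bind₁ g qX) = eval (fun p => eval M (g p)) qX := by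
    intro M
    exact eval_bind g M qX
  refine ⟨bind₁ g qX, ?_, ?_⟩
  · intro h
    apply hA
    have := hg (fun ki => a0 (ki.1.castSucc, some ki.2) + a0 (ki.1.castSucc, none) * ψ ki.2)
    rw [h, map_zero] at this
    rw [this]
    congr 2
    funext ⟨j, o⟩
    cases o with
    | none => simp [g]
    | some i =>
      induction j using Fin.lastCases with
      | last => simp [g]
      | cast k => simp [g]
  · intro M hM
    rw [hg] at hM
    rw [← hU _ (hqU _ hM)]
    congr 1
    ext x
    have h1 : ∀ j : Fin (d+1), j = Fin.last d → (eval M (g (j, none)) + ∑ i, eval M (g (j, some i)) * x i =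
       s + ∑ i, a0 (Fin.last d, some i) * x i) := by
      rintro j rfl
      simp [g, hs]
    have h2 : ∀ k : Fin d, eval M (g (k.castSucc, none)) + ∑ i, eval M (g (k.castSucc, some i)) * x i =
       a0 (k.castSucc, none) * (1 - ∑ i, ψ i * x i) + ∑ i, M (k, i) * x i := by
      intro k
      simp only [g, Fin.lastCases_castSucc, map_sub, eval_X, eval_C, sub_mul, Finset.sum_sub_distrib, mul_sub, Finset.mul_sum, mul_assoc]
      ring
    constructor
    · rintro ⟨⟨hx, hx1⟩, hx2⟩
      refine ⟨hx, fun j => ?_⟩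
      induction j using Fin.lastCases with
      | last => rw [h1 _ rfl]; exact (hψ x).2 hx1
      | cast k => rw [h2, hx1, hx2]; ring
    · rintro ⟨hx, hx2⟩
      have hx1 : ∑ i, ψ i * x i = 1 := by
        rw [← hψ, ← h1 _ rfl]; exact hx2 _
      refine ⟨⟨hx, hx1⟩, fun k => ?_⟩
      have := hx2 k.castSucc
      rw [h2, hx1] at this
      simpa using this

theorem card_chart {ι : Type} [Fintype ι] (S : Set (ι → ℂ)) (hS : zClosed S) (P : (ι → ℂ) → Prop) :
    Nat.card {χ : CR S →ₐ[ℂ] ℂ // P (fun i => χ (yC S i))} = {x | x ∈ S ∧ P x}.ncard := by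
  rw [← Nat.card_coe_set_eq]
  refine Nat.card_congr ⟨fun χ => ⟨fun i => χ.1 (yC S i), hom_mem hS χ.1, χ.2⟩,
    fun x => ⟨ptHom x.1 x.2.1, ?_⟩, ?_, ?_⟩
  · simp only [ptHom_y]; exact x.2.2
  · intro χ
    apply Subtype.ext
    apply hom_ext_y
    intro i
    simp only [ptHom_y]
  · intro x
    apply Subtype.ext
    funext i
    simp only [ptHom_y]

theorem yC_adjoin {ι : Type} (S : Set (ι → ℂ)) : Algebra.adjoin ℂ (Set.range (yC S)) = ⊤ := by
  rw [Algebra.adjoin_range_eq_range_aeval, AlgHom.range_eq_top]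
  intro b
  obtain ⟨p, rfl⟩ := Ideal.Quotient.mkₐ_surjective ℂ _ b
  exact ⟨p, aeval_yC S p⟩

theorem chart_sum_y {n : ℕ} (X : Set (Fin n → ℂ)) (ψ : Fin n → ℂ) :
    ∑ i, ψ i • yC (chart X ψ) i = 1 := by
  have h : (Ideal.Quotient.mkₐ ℂ (vanishingIdealOf (chart X ψ))) (∑ i, ψ i • MvPolynomial.X i - 1) = 0 := by
    rw [Ideal.Quotient.mkₐ_eq_mk, Ideal.Quotient.eq_zero_iff_mem, mem_vI]
    intro x hx
    simp only [map_sub, map_sum, smul_eval, eval_X, map_one]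
    rw [hx.2, sub_self]
  rw [map_sub, map_sum, map_one, sub_eq_zero] at h
  rw [← h]
  refine Finset.sum_congr rfl fun i _ => ?_
  rw [map_smul, ← aeval_yC, aeval_X]
end
end

section
noncomputable section
open MvPolynomial

def slG {R ι : Type} [CommRing R] [Fintype ι] (N : ℕ) (F : ι → R) : Fin N × Option ι → MvPolynomial (Fin N × ι) R :=
  fun jp => match jp with
  | (j, none) => - ∑ p, X (j, p) * C (F p)
  | (j, some p) => X (j, p)

theorem slG_prod {R ι : Type} [CommRing R] [Algebra ℂ R] [Fintype ι] (N : ℕ) (F : ι → R)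
    (χ : R →ₐ[ℂ] ℂ) (a : Fin N × Option ι → ℂ) (t : Fin N × ι → ℂ) :
    (∀ jp, prodHom χ t (slG N F jp) = a jp) ↔ (t = fun jp => a (jp.1, some jp.2)) ∧ (fun p => χ (F p)) ∈ affSlice a := by
  constructor
  · intro h
    have ht : t = fun jp => a (jp.1, some jp.2) := by
      funext ⟨j, p⟩
      have := h (j, some p)
      simpa [slG] using this
    refine ⟨ht, fun j => ?_⟩
    have := h (j, none)
    simp only [slG, map_neg, map_sum, map_mul, prodHom_X, prodHom_C, ht] at this
    rw [← this]; simp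
  · rintro ⟨rfl, h⟩ ⟨j, o⟩
    cases o with
    | none =>
      have := h j
      simp only [slG, map_neg, map_sum, map_mul, prodHom_X, prodHom_C]
      linear_combination (-1 : ℂ) * this
    | some p => simp [slG]

theorem trdeg_sl {R ι : Type} [CommRing R] [IsDomain R] [Algebra ℂ R] [Fintype ι] (N : ℕ)
    (h : Algebra.trdeg ℂ R ≤ N) : Algebra.trdeg ℂ (MvPolynomial (Fin N × ι) R) ≤ Fintype.card (Fin N × Option ι) := by
  obtain ⟨k, hk⟩ := Cardinal.lt_aleph0.1 (h.trans_lt Cardinal.natCast_lt_aleph0)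
  rw [trdeg_mv k hk]
  rw [hk] at h
  have h' : k ≤ N := by exact_mod_cast h
  rw [Fintype.card_prod, Fintype.card_prod, Fintype.card_option, Fintype.card_fin, mul_add, mul_one]
  exact_mod_cast (by omega)

theorem slice_a {R ι : Type} [CommRing R] [IsDomain R] [Algebra ℂ R] [Fintype ι] (N : ℕ) (F : ι → R)
    (h : Algebra.trdeg ℂ R ≤ N) (p : R) (hp : p ≠ 0) :
    ∃ q : MvPolynomial (Fin N × Option ι) ℂ, q ≠ 0 ∧ ∀ a, eval a q ≠ 0 → ∀ χ : R →ₐ[ℂ] ℂ,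
      (fun i => χ (F i)) ∈ affSlice a → χ p ≠ 0 := by
  obtain ⟨q, hq, hq'⟩ := gfc_a (slG N F) (trdeg_sl N h) (C p) (by simpa using hp)
  refine ⟨q, hq, fun a ha χ hχ => ?_⟩
  have h1 := (slG_prod N F χ a (fun jp => a (jp.1, some jp.2))).2 ⟨rfl, hχ⟩
  have := hq' (prodHom χ (fun jp => a (jp.1, some jp.2))) (by simp only [h1]; exact ha)
  simpa using this

theorem slice_b {R ι : Type} [CommRing R] [IsDomain R] [Algebra ℂ R] [Algebra.FiniteType ℂ R] [Fintype ι] (N : ℕ) (F : ι → R)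
    (h : Algebra.trdeg ℂ R ≤ N) :
    ∃ (δ : ℕ) (q : MvPolynomial (Fin N × Option ι) ℂ), q ≠ 0 ∧ ∀ a, eval a q ≠ 0 → 
      Nat.card {χ : R →ₐ[ℂ] ℂ // (fun i => χ (F i)) ∈ affSlice a} = δ := by
  have hft : Algebra.FiniteType ℂ (MvPolynomial (Fin N × ι) R) := Algebra.FiniteType.trans (S := R) inferInstance inferInstance
  obtain ⟨δ, q, hq, hq', -⟩ := gfc (slG N F) (trdeg_sl N h)
  refine ⟨δ, q, hq, fun a ha => ?_⟩
  rw [← hq' a ha]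
  refine Nat.card_congr ⟨fun χ => ⟨prodHom χ.1 (fun jp => a (jp.1, some jp.2)), (slG_prod N F χ.1 a _).2 ⟨rfl, χ.2⟩⟩,
    fun ξ => ⟨resHom ξ.1, ?_⟩, ?_, ?_⟩
  · have := ξ.2
    rw [eq_prodHom ξ.1] at this
    exact ((slG_prod N F _ a _).1 this).2
  · intro χ
    apply Subtype.ext
    ext b
    simp [resHom_apply]
  · intro ξ
    apply Subtype.ext
    have := ξ.2
    rw [eq_prodHom ξ.1] at this
    have h2 := ((slG_prod N F _ a _).1 this).1
    conv_rhs => rw [eq_prodHom ξ.1, h2]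
end
end

section
noncomputable section
open MvPolynomial

def eigPairs {n : ℕ} (X : Set (Fin n → ℂ)) (ψ : Fin n → ℂ) (S : Set (MatSpace n)) : Set ((Fin n → ℂ) × MatSpace n) :=
  {p | p.1 ∈ chart X ψ ∧ p.2 ∈ S ∧ IsEigenvector (toMat p.2) p.1}

theorem pairs_card {n : ℕ} {X : Set (Fin n → ℂ)} (hcl : zClosed X) (ψ : Fin n → ℂ) (k : Fin n) (hk : ψ k ≠ 0) (S : Set (MatSpace n)) :
    Nat.card {χ : MvPolynomial (KI n k) (CR (chart X ψ)) →ₐ[ℂ] ℂ // (fun ij => χ (gF (chart X ψ) ψ k ij)) ∈ S} = 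
      Nat.card (eigPairs X ψ S) := by
  have hch : ∀ ξ : MvPolynomial (KI n k) (CR (chart X ψ)) →ₐ[ℂ] ℂ, (fun i => ξ (C (yC (chart X ψ) i))) ∈ chart X ψ := by
    intro ξ
    have := hom_mem (chart_closed hcl ψ) (resHom ξ)
    simpa only [resHom_apply] using this
  refine Nat.card_congr (Equiv.ofBijective (fun χ => ⟨(fun i => χ.1 (C (yC (chart X ψ) i)), fun ij => χ.1 (gF (chart X ψ) ψ k ij)),
    hch χ.1, χ.2, ?_⟩) ⟨?_, ?_⟩)
  · simp only
    rw [gF_eval]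
    refine ⟨?_, _, kF_eig ψ k _ (hch χ.1).2 _⟩
    intro h
    have := (hch χ.1).2
    rw [h] at this
    simp at this
  · intro χ χ' h
    have h' := congrArg Subtype.val h
    have h1 := congrArg Prod.fst h'
    have h2 := congrArg Prod.snd h'
    simp only at h1 h2
    rw [gF_eval, gF_eval, h1] at h2
    have h3 := kF_inj ψ k hk _ (hch χ'.1).2 _ _ h2
    apply Subtype.ext
    apply prodHom_ext
    · intro b
      have : resHom χ.1 = resHom χ'.1 := by
        apply hom_ext_y
        intro i
        simp only [resHom_apply]
        exact congrFun h1 i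
      have := DFunLike.congr_fun this b
      simpa only [resHom_apply] using this
    · exact fun i => congrFun h3 i
  · rintro ⟨⟨v, A⟩, hv, hA, hvA⟩
    obtain ⟨b, hb⟩ := kF_surj ψ k hk v hv.2 A hvA
    have h1 : (fun ij => prodHom (ptHom v hv) b (gF (chart X ψ) ψ k ij)) = A := by
      rw [gF_eval, hb]
      simp only [prodHom_C, prodHom_X, ptHom_y]
    refine ⟨⟨prodHom (ptHom v hv) b, ?_⟩, ?_⟩
    · rw [h1]; exact hA
    · apply Subtype.ext
      simp only [h1, prodHom_C, ptHom_y]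

theorem K_slice {n m : ℕ} (hm : 1 ≤ m) (hmn : m ≤ n) {X : Set (Fin n → ℂ)} (hX : IsCone X) (hcl : zClosed X) (hirr : zIrred X)
    (hXne : ∃ v ∈ X, v ≠ 0) (hproper : X ≠ Set.univ) (ψ : Fin n → ℂ) (hne : (chart X ψ).Nonempty) (k : Fin n)
    (hk : ψ k ≠ 0) (h : Algebra.trdeg ℂ (CR X) = m) (N : ℕ) (hN : N = n ^ 2 - (n - m)) :
    ∃ (δ : ℕ) (q : MvPolynomial (Fin N × Option (Fin n × Fin n)) ℂ), q ≠ 0 ∧ ∀ a, eval a q ≠ 0 →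
      Nat.card (eigPairs X ψ (affSlice a)) = δ ∧ (kalmanCone X ∩ affSlice a).ncard = δ := by
  subst hN
  have hd1 := CR_domain (chart_irred hX hirr hne)
  have hd2 := CR_domain (kalman_irred hirr hXne)
  obtain ⟨t1, t2⟩ := trdeg_K hm hmn hX hirr ψ hne k hk h
  have hft : Algebra.FiniteType ℂ (MvPolynomial (KI n k) (CR (chart X ψ))) :=
    Algebra.FiniteType.trans (S := CR (chart X ψ)) inferInstance inferInstance
  obtain ⟨δ, q1, hq1, hδ⟩ := slice_b (R := MvPolynomial (KI n k) (CR (chart X ψ))) _ (gF (chart X ψ) ψ k) t2.le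
  obtain ⟨p1, hp1, hp1'⟩ := exists_uniq_poly hX hcl hXne hproper
  obtain ⟨p2, hp2', hp2⟩ := exists_inf_poly hne
  have hp : Ideal.Quotient.mkₐ ℂ (vanishingIdealOf (kalmanCone X)) (p1 * p2) ≠ 0 := by
    rw [map_mul]
    refine mul_ne_zero ?_ ?_
    · rwa [Ideal.Quotient.mkₐ_eq_mk, Ne, Ideal.Quotient.eq_zero_iff_mem]
    · rwa [Ideal.Quotient.mkₐ_eq_mk, Ne, Ideal.Quotient.eq_zero_iff_mem]
  obtain ⟨q2, hq2, hq2'⟩ := slice_a (R := CR (kalmanCone X)) _ (yC (kalmanCone X)) t1 _ hp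
  refine ⟨δ, q1 * q2, mul_ne_zero hq1 hq2, fun a ha => ?_⟩
  rw [map_mul] at ha
  have e1 : Nat.card (eigPairs X ψ (affSlice a)) = δ := by
    rw [← pairs_card hcl ψ k hk]
    exact hδ a (left_ne_zero_of_mul ha)
  refine ⟨e1, ?_⟩
  rw [← e1, ← Nat.card_coe_set_eq]
  have hkey : ∀ A ∈ kalmanCone X ∩ affSlice a, eval A p1 ≠ 0 ∧ eval A p2 ≠ 0 := by
    intro A hA
    have := hq2' a (right_ne_zero_of_mul ha) (ptHom A hA.1) (by simp only [ptHom_y]; exact hA.2)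
    rw [ptHom_mk, map_mul] at this
    exact ⟨left_ne_zero_of_mul this, right_ne_zero_of_mul this⟩
  symm
  refine Nat.card_congr (Equiv.ofBijective (fun p => ⟨p.1.2, ⟨p.1.1, p.2.1.1, p.2.2.2⟩, p.2.2.1⟩) ⟨?_, ?_⟩)
  · rintro ⟨⟨v, A⟩, hv, hA, hvA⟩ ⟨⟨w, B⟩, hw, hB, hwB⟩ hh
    have h1 : A = B := congrArg Subtype.val hh
    subst h1
    obtain ⟨c, hc⟩ := hp1' A (hkey A ⟨⟨v, hv.1, hvA⟩, hA⟩).1 v w hv.1 hw.1 hvA hwB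
    have h1 : ∑ i, ψ i * w i = 1 := hw.2
    have hv2 : ∑ i, ψ i * v i = 1 := hv.2
    replace hc : w = c • v := hc
    rw [hc] at h1
    have h2 : ∑ i, ψ i * (c • v) i = c * ∑ i, ψ i * v i := by
      rw [Finset.mul_sum]
      refine Finset.sum_congr rfl fun i _ => ?_
      simp only [Pi.smul_apply, smul_eq_mul]; ring
    rw [h2, hv2, mul_one] at h1
    rw [h1, one_smul] at hc
    apply Subtype.ext
    exact Prod.ext hc.symm rfl
  · rintro ⟨A, hA⟩
    obtain ⟨v, hv, hvA⟩ := hA.1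
    have h0 : ∑ i, ψ i * v i ≠ 0 := fun h0 => (hkey A hA).2 (hp2' A v hvA h0)
    exact ⟨⟨⟨_, A⟩, chart_scale hX hv h0, hA.2, eig_smul hvA (inv_ne_zero h0)⟩, rfl⟩
end
end

section
noncomputable section
open MvPolynomial Matrix

theorem claimO {ι : Type} [Fintype ι] [DecidableEq ι] (N r : ℕ) (e : ι ≃ Fin N ⊕ Fin r) (q3 : MvPolynomial (Fin N × Option ι) ℂ)
    (hq3 : q3 ≠ 0) : ∃ qO : MvPolynomial (Option (Fin r) × ι) ℂ, qO ≠ 0 ∧ ∀ A, eval A qO ≠ 0 → ∃ a, eval a q3 ≠ 0 ∧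
      (∀ x, x ∈ affSlice a ↔ ∃ t : Fin r → ℂ, x = fun i => A (none, i) + ∑ o, t o * A (some o, i)) ∧
      (∀ t t' : Fin r → ℂ, (∀ i, ∑ o, t o * A (some o, i) = ∑ o, t' o * A (some o, i)) → t = t') := by
  -- generic square matrix extending the slice equations
  let Gp : Matrix (Fin N ⊕ Fin r) (Fin N ⊕ Fin r) (MvPolynomial (Fin N × Option ι) ℂ) :=
    Matrix.of fun s t => s.elim (fun j => X (j, some (e.symm t))) (fun o => if t = Sum.inr o then 1 else 0)
  have hGp : Gp.det ≠ 0 := by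
    intro h
    have h1 := congrArg (eval (fun p : Fin N × Option ι => p.2.elim (0 : ℂ) fun i => if e i = Sum.inl p.1 then 1 else 0)) h
    rw [RingHom.map_det, map_zero] at h1
    have h2 : (eval (fun p : Fin N × Option ι => p.2.elim (0 : ℂ) fun i => if e i = Sum.inl p.1 then 1 else 0)).mapMatrix Gp = 1 := by
      ext s t
      rcases s with j | o
      · simp [Gp, Matrix.one_apply, eq_comm]
      · by_cases ht : t = Sum.inr o
        · subst ht; simp [Gp]
        · have : Sum.inr o ≠ t := fun h => ht h.symm
          simp [Gp, ht, this]
    rw [h2, det_one] at h1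
    exact one_ne_zero h1
  obtain ⟨a0, ha0⟩ := exists_eval_ne (Gp.det * q3) (mul_ne_zero hGp hq3)
  rw [map_mul] at ha0
  set G0 : Matrix (Fin N ⊕ Fin r) (Fin N ⊕ Fin r) ℂ := (eval a0).mapMatrix Gp with hG0
  have hdet0 : G0.det ≠ 0 := by
    rw [hG0, ← RingHom.map_det]; exact left_ne_zero_of_mul ha0
  have hG0u : IsUnit G0.det := isUnit_iff_ne_zero.2 hdet0
  let H0 := G0⁻¹
  have hH0d : H0.det ≠ 0 := by
    simp only [H0, Matrix.det_nonsing_inv, Ring.inverse_eq_inv']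
    exact inv_ne_zero hdet0
  have hadj0 : ∀ s t, H0.det⁻¹ * H0.adjugate s t = G0 s t := by
    intro s t
    have h1 := Matrix.nonsing_inv_nonsing_inv G0 hG0u
    rw [Matrix.inv_def (G0⁻¹)] at h1
    rw [← h1, Ring.inverse_eq_inv']
    rfl
  let Hp : Matrix (Fin N ⊕ Fin r) (Fin N ⊕ Fin r) (MvPolynomial (Option (Fin r) × ι) ℂ) :=
    Matrix.of fun s t => t.elim (fun l => C (H0 s (Sum.inl l))) (fun o => X (some o, e.symm s))
  let ap0 : Fin N → ι → MvPolynomial (Option (Fin r) × ι) ℂ := fun j i => C (H0.det⁻¹) * Hp.adjugate (Sum.inl j) (e i)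
  let ap : Fin N × Option ι → MvPolynomial (Option (Fin r) × ι) ℂ := fun p =>
    p.2.elim (- ∑ i, ap0 p.1 i * X (none, i)) (fun i => ap0 p.1 i)
  have hap0 : ∀ A j i, eval A (ap0 j i) = H0.det⁻¹ * ((eval A).mapMatrix Hp).adjugate (Sum.inl j) (e i) := by
    intro A j i
    simp only [ap0, map_mul, eval_C, ← RingHom.map_adjugate]
    rfl
  refine ⟨Hp.det * bind₁ ap q3, ?_, ?_⟩
  · intro h
    let A0 : Option (Fin r) × ι → ℂ := fun p => p.1.elim (- ∑ l, H0 (e p.2) (Sum.inl l) * a0 (l, none)) (fun o => H0 (e p.2) (Sum.inr o))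
    have hH : (eval A0).mapMatrix Hp = H0 := by
      ext s t
      rcases t with l | o
      · simp [Hp]
      · simp [Hp, A0]
    have h1 := congrArg (eval A0) h
    rw [map_mul, RingHom.map_det, hH, map_zero, eval_bind] at h1
    have h2 := (mul_eq_zero.1 h1).resolve_left hH0d
    apply right_ne_zero_of_mul ha0
    rw [← h2]
    congr 2
    have hs : ∀ j i, eval A0 (ap0 j i) = a0 (j, some i) := by
      intro j i
      rw [hap0, hH, hadj0]
      simp [hG0, Gp]
    funext ⟨j, o⟩
    cases o with
    | some i => simp only [ap, Option.elim]; rw [hs]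
    | none =>
      simp only [ap, Option.elim, map_neg, map_sum, map_mul, hs, eval_X]
      have h3 : ∀ l, ∑ i, a0 (j, some i) * H0 (e i) (Sum.inl l) = if j = l then 1 else 0 := by
        intro l
        have h4 : (G0 * H0) (Sum.inl j) (Sum.inl l) = (1 : Matrix (Fin N ⊕ Fin r) (Fin N ⊕ Fin r) ℂ) (Sum.inl j) (Sum.inl l) := by
          rw [Matrix.mul_nonsing_inv _ hG0u]
        rw [Matrix.mul_apply, ← Equiv.sum_comp e] at h4
        simpa [hG0, Gp, Matrix.one_apply] using h4
      simp only [A0, Option.elim, mul_neg, Finset.sum_neg_distrib, neg_neg, Finset.mul_sum, ← mul_assoc]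
      rw [Finset.sum_comm]
      simp only [← Finset.sum_mul, h3]
      simp
  · intro A hA
    rw [map_mul, RingHom.map_det, eval_bind] at hA
    set H := (eval A).mapMatrix Hp with hH
    have hHd : H.det ≠ 0 := left_ne_zero_of_mul hA
    have hcol : ∀ (t : Fin r → ℂ) i, (H *ᵥ (Sum.elim 0 t)) (e i) = ∑ o, t o * A (some o, i) := by
      intro t i
      simp [mulVec, dotProduct, hH, Hp, mul_comm]
    have hadj : ∀ u, H.adjugate *ᵥ (H *ᵥ u) = H.det • u := by
      intro u
      rw [mulVec_mulVec, adjugate_mul, smul_mulVec, one_mulVec]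
    have hadj' : ∀ u, H *ᵥ (H.adjugate *ᵥ u) = H.det • u := by
      intro u
      rw [mulVec_mulVec, mul_adjugate, smul_mulVec, one_mulVec]
    refine ⟨_, right_ne_zero_of_mul hA, ?_, ?_⟩
    · intro x
      have hx : ∀ j, eval A (ap (j, none)) + ∑ i, eval A (ap (j, some i)) * x i = 
          H0.det⁻¹ * (H.adjugate *ᵥ (fun s => x (e.symm s) - A (none, e.symm s))) (Sum.inl j) := by
        intro j
        simp only [ap, Option.elim, map_neg, map_sum, map_mul, hap0, eval_X, mulVec, dotProduct]
        rw [← Equiv.sum_comp e, Finset.mul_sum, neg_add_eq_sub, ← Finset.sum_sub_distrib]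
        refine Finset.sum_congr rfl fun i _ => ?_
        rw [Equiv.symm_apply_apply]
        ring
      have hx' : x ∈ affSlice (fun p => eval A (ap p)) ↔ ∀ j, (H.adjugate *ᵥ (fun s => x (e.symm s) - A (none, e.symm s))) (Sum.inl j) = 0 := by
        refine forall_congr' fun j => ?_
        rw [hx, mul_eq_zero]
        exact or_iff_right (inv_ne_zero hH0d)
      rw [hx']
      constructor
      · intro h
        set u := H.adjugate *ᵥ (fun s => x (e.symm s) - A (none, e.symm s)) with hu
        refine ⟨fun o => H.det⁻¹ * u (Sum.inr o), ?_⟩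
        funext i
        rw [← hcol]
        have h1 : (Sum.elim 0 (fun o => H.det⁻¹ * u (Sum.inr o)) : Fin N ⊕ Fin r → ℂ) = H.det⁻¹ • u := by
          funext s
          rcases s with j | o
          · simp [h j]
          · simp
        rw [h1, mulVec_smul, hu, hadj', smul_smul, inv_mul_cancel₀ hHd, one_smul]
        simp
      · rintro ⟨t, ht⟩ j
        have h1 : (fun s => x (e.symm s) - A (none, e.symm s)) = H *ᵥ (Sum.elim 0 t) := by
          funext s
          obtain ⟨i, rfl⟩ := e.surjective s
          rw [hcol, ht]
          simp
        rw [h1, hadj]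
        simp
    · intro t t' h
      have h1 : H *ᵥ (Sum.elim 0 t) = H *ᵥ (Sum.elim 0 t') := by
        funext s
        obtain ⟨i, rfl⟩ := e.surjective s
        rw [hcol, hcol, h]
      have h2 := congrArg (H.adjugate *ᵥ ·) h1
      simp only [hadj] at h2
      have h3 := smul_right_injective _ hHd h2
      funext o
      exact congrFun h3 (Sum.inr o)
end
end

section
noncomputable section
open MvPolynomial Matrix

theorem key_eig {n r : ℕ} (c : Fin n × (Fin n × Option (Fin (r + 1))) → ℂ) (P : Matrix (Fin n) (Fin n) ℂ)
    (hP : P = Matrix.of fun j i => c (j, (i, some (Fin.last r)))) (hdet : P.det ≠ 0)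
    (A' : Option (Fin r) × (Fin n × Fin n) → ℂ)
    (hA' : ∀ o j i, A' (o, (j, i)) = ∑ l, P.adjugate j l * c (l, (i, o.map Fin.castSucc)))
    (v : Fin n → ℂ) (t : Fin r → ℂ) (lam : ℂ) :
    (∀ j, ∑ i, (c (j, (i, none)) + ∑ o, t o * c (j, (i, some (Fin.castSucc o))) + lam * c (j, (i, some (Fin.last r)))) * v i = 0) ↔
     toMat (fun ji => A' (none, ji) + ∑ o, t o * A' (some o, ji)) *ᵥ v = (- (lam * P.det)) • v := by
  set W : Matrix (Fin n) (Fin n) ℂ := Matrix.of fun j i => c (j, (i, none)) + ∑ o, t o * c (j, (i, some (Fin.castSucc o))) with hW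
  have h1 : toMat (fun ji => A' (none, ji) + ∑ o, t o * A' (some o, ji)) = P.adjugate * W := by
    ext j i
    simp only [toMat, of_apply, mul_apply, hW, hA', mul_add, Finset.sum_add_distrib, Finset.mul_sum, Option.map]
    congr 1
    rw [Finset.sum_comm]
    refine Finset.sum_congr rfl fun l _ => Finset.sum_congr rfl fun o _ => ?_
    ring
  have h2 : (∀ j, ∑ i, (c (j, (i, none)) + ∑ o, t o * c (j, (i, some (Fin.castSucc o))) + lam * c (j, (i, some (Fin.last r)))) * v i = 0) ↔
      (W + lam • P) *ᵥ v = 0 := by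
    rw [funext_iff]
    refine forall_congr' fun j => ?_
    simp [mulVec, dotProduct, hW, hP]
  rw [h2, h1]
  have h3 : P.adjugate *ᵥ ((W + lam • P) *ᵥ v) = (P.adjugate * W) *ᵥ v + (lam * P.det) • v := by
    rw [mulVec_mulVec, mul_add, add_mulVec, mul_smul_comm, adjugate_mul, smul_smul, smul_mulVec, one_mulVec]
  have h4 : (W + lam • P) *ᵥ v = 0 ↔ P.adjugate *ᵥ ((W + lam • P) *ᵥ v) = 0 := by
    constructor
    · intro h; rw [h, mulVec_zero]
    · intro h
      have := congrArg (P *ᵥ ·) h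
      simp only [mulVec_zero] at this
      rw [mulVec_mulVec _ P P.adjugate, mul_adjugate, smul_mulVec, one_mulVec] at this
      exact (smul_eq_zero.1 this).resolve_left hdet
  rw [h4, h3, neg_smul, ← add_eq_zero_iff_eq_neg]

theorem eval_deg {D r : ℕ} {X : Set (Fin (D + (r + 1)) → ℂ)} (hX : IsCone X) (hcl : zClosed X) (hirr : zIrred X)
    (ψ : Fin (D + (r + 1)) → ℂ) (hne : (chart X ψ).Nonempty) (htr : Algebra.trdeg ℂ (CR (chart X ψ)) = D)
    (degX : ℕ) (q0 : MvPolynomial (Fin D × Fin (D + (r + 1))) ℂ) (hq0 : q0 ≠ 0)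
    (hdeg : ∀ M, eval M q0 ≠ 0 → {x | x ∈ chart X ψ ∧ ∀ j, ∑ i, M (j, i) * x i = 0}.ncard = degX)
    (N : ℕ) (e : Fin (D + (r + 1)) × Fin (D + (r + 1)) ≃ Fin N ⊕ Fin r)
    (q3 : MvPolynomial (Fin N × Option (Fin (D + (r + 1)) × Fin (D + (r + 1)))) ℂ) (hq3 : q3 ≠ 0) :
    ∃ a, eval a q3 ≠ 0 ∧ Nat.card (eigPairs X ψ (affSlice a)) = degX * (D + (r + 1)).choose D := by
  obtain ⟨qO, hqO, hO⟩ := claimO N r e q3 hq3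
  have hdom := CR_domain (chart_irred hX hirr hne)
  let Pp : Matrix (Fin (D + (r + 1))) (Fin (D + (r + 1))) (MvPolynomial (Fin (D + (r + 1)) × (Fin (D + (r + 1)) × Option (Fin (r + 1)))) ℂ) :=
    Matrix.of fun j i => MvPolynomial.X (j, (i, some (Fin.last r)))
  let g : Option (Fin r) × (Fin (D + (r + 1)) × Fin (D + (r + 1))) → MvPolynomial (Fin (D + (r + 1)) × (Fin (D + (r + 1)) × Option (Fin (r + 1)))) ℂ :=
    fun p => ∑ l, Pp.adjugate p.2.1 l * MvPolynomial.X (l, (p.2.2, p.1.map Fin.castSucc))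
  have hg : ∀ c p, eval c (g p) = ∑ l, ((eval c).mapMatrix Pp).adjugate p.2.1 l * c (l, (p.2.2, p.1.map Fin.castSucc)) := by
    intro c p
    simp only [g, map_sum, map_mul, eval_X, ← RingHom.map_adjugate]
    rfl
  have hq : Pp.det * bind₁ g qO ≠ 0 := by
    intro h
    obtain ⟨A, hA⟩ := exists_eval_ne qO hqO
    let c : Fin (D + (r + 1)) × (Fin (D + (r + 1)) × Option (Fin (r + 1))) → ℂ := fun p =>
      p.2.2.elim (A (none, (p.1, p.2.1))) fun o => Fin.lastCases (motive := fun _ => ℂ) (if p.1 = p.2.1 then 1 else 0) 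
        (fun o => A (some o, (p.1, p.2.1))) o
    have h1 : (eval c).mapMatrix Pp = 1 := by
      ext j i
      simp [Pp, c, Matrix.one_apply]
    have h2 := congrArg (eval c) h
    rw [map_mul, RingHom.map_det, h1, det_one, one_mul, eval_bind, map_zero] at h2
    apply hA
    rw [← h2]
    congr 2
    funext ⟨o, j, i⟩
    rw [hg, h1, adjugate_one]
    cases o with
    | none => simp [c, Matrix.one_apply]
    | some o => simp [c, Matrix.one_apply]
  obtain ⟨c, hc, hcard⟩ := deg_ext (yC (chart X ψ)) ψ (chart_sum_y X ψ) (yC_adjoin _) D htr degX q0 hq0 (by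
    intro M hM
    rw [← hdeg M hM]
    exact card_chart (chart X ψ) (chart_closed hcl ψ) (fun x => ∀ j, ∑ i, M (j, i) * x i = 0)) (r + 1) _ hq
  rw [map_mul, RingHom.map_det, eval_bind] at hc
  set P := (eval c).mapMatrix Pp with hP
  have hP' : P = Matrix.of fun j i => c (j, (i, some (Fin.last r))) := by
    ext j i
    simp [hP, Pp]
  have hdet := left_ne_zero_of_mul hc
  obtain ⟨a, ha, hsl, hinj⟩ := hO _ (right_ne_zero_of_mul hc)
  refine ⟨a, ha, ?_⟩
  rw [← hcard]
  symm
  have hkey := key_eig c P hP' hdet (fun p => eval c (g p)) (fun o j i => hg c (o, (j, i)))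
  have hsum : ∀ (χ : MvPolynomial (Fin (r + 1)) (CR (chart X ψ)) →ₐ[ℂ] ℂ) j, ∑ io, c (j, io) * χ (yExt (r + 1) (yC (chart X ψ)) io) = 
      ∑ i, (c (j, (i, none)) + ∑ o : Fin r, χ (MvPolynomial.X o.castSucc) * c (j, (i, some (Fin.castSucc o))) + 
        χ (MvPolynomial.X (Fin.last r)) * c (j, (i, some (Fin.last r)))) * χ (C (yC (chart X ψ) i)) := by
    intro χ j
    rw [Fintype.sum_prod_type]
    refine Finset.sum_congr rfl fun i _ => ?_
    rw [Fintype.sum_option, Fin.sum_univ_castSucc]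
    simp only [yExt, Option.elim, map_mul, mul_one, add_mul, Finset.sum_mul]
    rw [add_assoc]
    congr 1
    congr 1
    · refine Finset.sum_congr rfl fun o _ => ?_
      ring
    · ring
  have hch : ∀ ξ : MvPolynomial (Fin (r + 1)) (CR (chart X ψ)) →ₐ[ℂ] ℂ, (fun i => ξ (C (yC (chart X ψ) i))) ∈ chart X ψ := by
    intro ξ
    have := hom_mem (chart_closed hcl ψ) (resHom ξ)
    simpa only [resHom_apply] using this
  have hch0 : ∀ v ∈ chart X ψ, v ≠ 0 := by
    rintro v hv rfl
    have := hv.2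
    simp at this
  simp only [hsum]
  refine Nat.card_congr (Equiv.ofBijective (fun χ => ⟨(fun i => χ.1 (C (yC (chart X ψ) i)), 
    fun ji => eval c (g (none, ji)) + ∑ o : Fin r, χ.1 (MvPolynomial.X o.castSucc) * eval c (g (some o, ji))),
    hch χ.1, (hsl _).2 ⟨_, rfl⟩, hch0 _ (hch χ.1), _, (hkey _ _ _).1 χ.2⟩) ⟨?_, ?_⟩)
  · intro χ χ' h
    have h' := congrArg Subtype.val h
    have h1 : (fun i => χ.1 (C (yC (chart X ψ) i))) = fun i => χ'.1 (C (yC (chart X ψ) i)) := congrArg Prod.fst h'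
    have h2 := congrArg Prod.snd h'
    simp only at h2
    have h3 := hinj (fun o => χ.1 (MvPolynomial.X o.castSucc)) (fun o => χ'.1 (MvPolynomial.X o.castSucc)) (fun i => by
      have := congrFun h2 i
      exact add_left_cancel this)
    have h4 := (hkey _ (fun o => χ.1 (MvPolynomial.X o.castSucc)) _).1 χ.2
    have h5 := (hkey _ (fun o => χ'.1 (MvPolynomial.X o.castSucc)) _).1 χ'.2
    rw [h2, h1, h5] at h4
    have h6 := smul_left_injective ℂ (hch0 _ (hch χ'.1)) h4
    have h7 : χ.1 (MvPolynomial.X (Fin.last r)) = χ'.1 (MvPolynomial.X (Fin.last r)) :=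
      (mul_right_cancel₀ hdet (neg_injective h6)).symm
    apply Subtype.ext
    apply prodHom_ext
    · intro b
      have : resHom χ.1 = resHom χ'.1 := by
        apply hom_ext_y
        intro i
        simp only [resHom_apply]
        exact congrFun h1 i
      have := DFunLike.congr_fun this b
      simpa only [resHom_apply] using this
    · intro i
      induction i using Fin.lastCases with
      | last => exact h7
      | cast o => exact congrFun h3 o
  · rintro ⟨⟨v, A⟩, hv, hA, hvA⟩
    replace hv : v ∈ chart X ψ := hv
    obtain ⟨t, ht⟩ := (hsl A).1 hA
    obtain ⟨-, l, hl⟩ := hvA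
    replace hl : toMat A *ᵥ v = l • v := hl
    let ξ := prodHom (ptHom v hv) (Fin.snoc (α := fun _ => ℂ) t (- l / P.det))
    have e1 : ∀ i, ξ (C (yC (chart X ψ) i)) = v i := by
      intro i; simp only [ξ, prodHom_C, ptHom_y]
    have e2 : ∀ o : Fin r, ξ (MvPolynomial.X o.castSucc) = t o := by
      intro o; simp only [ξ, prodHom_X, Fin.snoc_castSucc]
    have e3 : ξ (MvPolynomial.X (Fin.last r)) = - l / P.det := by
      simp only [ξ, prodHom_X, Fin.snoc_last]
    refine ⟨⟨ξ, ?_⟩, ?_⟩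
    · simp only [e1, e2, e3]
      refine (hkey _ _ _).2 ?_
      have : - (- l / P.det * P.det) = l := by rw [div_mul_cancel₀ _ hdet, neg_neg]
      rw [this, ← hl, ht]
    · apply Subtype.ext
      simp only [e1, e2]
      rw [ht]
end
end

section
noncomputable section
open MvPolynomial

theorem kalman_aux (D r : ℕ) 
    (X : Set (Fin (D + (r + 1)) → ℂ)) (hXcone : IsCone X) (hXcl : zClosed X) (hXirr : zIrred X)
    (hXne : ∃ v ∈ X, v ≠ 0) (hXproper : X ≠ Set.univ)
    (hXdim : zDim X = ((D + 1 : ℕ) : WithBot ℕ∞))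
    (degX : ℕ) (hdegX : hasConeDegree X D degX) :
    zDim (kalmanCone X) = (((D + (r + 1)) ^ 2 - (D + (r + 1) - (D + 1)) : ℕ) : WithBot ℕ∞) ∧
    hasConeDegree (kalmanCone X) ((D + (r + 1)) ^ 2 - 1 - (D + (r + 1) - (D + 1))) (degX * Nat.choose (D + (r + 1)) D) := by
  have htrX := trdeg_cone hXcl hXirr (D + 1) hXdim
  obtain ⟨ψ, hne, q0, hq0, hdeg⟩ := choose_psi X hXcone hXne degX hdegX
  have hk : ∃ k, ψ k ≠ 0 := by
    by_contra hcon
    push Not at hcon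
    obtain ⟨v, hv, hv1⟩ := hne
    simp [hcon] at hv1
  obtain ⟨k, hk⟩ := hk
  have hm : 1 ≤ D + 1 := by omega
  have hmn : D + 1 ≤ D + (r + 1) := by omega
  refine ⟨dim_K hm hmn hXcone hXcl hXirr ψ hne k hk htrX, ?_⟩
  have hsq : (r + 1) ≤ (D + (r + 1)) ^ 2 := by nlinarith
  have hN : (D + (r + 1)) ^ 2 - 1 - (D + (r + 1) - (D + 1)) + 1 = (D + (r + 1)) ^ 2 - (D + (r + 1) - (D + 1)) := by omega
  have hc : Fintype.card (Fin (D + (r + 1)) × Fin (D + (r + 1))) = 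
      Fintype.card (Fin ((D + (r + 1)) ^ 2 - 1 - (D + (r + 1) - (D + 1)) + 1) ⊕ Fin r) := by
    simp only [Fintype.card_prod, Fintype.card_sum, Fintype.card_fin]
    rw [hN, ← sq]; omega
  let e := Fintype.equivOfCardEq hc
  obtain ⟨δ, q, hq, h⟩ := K_slice hm hmn hXcone hXcl hXirr hXne hXproper ψ hne k hk htrX _ hN
  obtain ⟨a, ha, hcard⟩ := eval_deg hXcone hXcl hXirr ψ hne (trdeg_chart hXcone hXirr hne hm htrX) degX q0 hq0 hdeg _ e q hq
  rw [(h a ha).1] at hcard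
  subst hcard
  exact ⟨_, zOpen_basic q, zDense_of ⟨q, hq, fun x hx => hx⟩, fun a ha => (h a ha).2⟩

theorem kalman_irreducible_dim_degree' (n m : ℕ) (hm : 1 ≤ m) (hmn : m ≤ n)
    (X : Set (Fin n → ℂ)) (hXcone : IsCone X) (hXcl : zClosed X) (hXirr : zIrred X)
    (hXne : ∃ v ∈ X, v ≠ 0) (hXproper : X ≠ Set.univ)
    (hXdim : zDim X = (m : WithBot ℕ∞))
    (degX : ℕ) (hdegX : hasConeDegree X (m - 1) degX) :
    zIrred (kalmanCone X) ∧
    zDim (kalmanCone X) = ((n ^ 2 - (n - m) : ℕ) : WithBot ℕ∞) ∧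
    hasConeDegree (kalmanCone X) (n ^ 2 - 1 - (n - m)) (degX * Nat.choose n (m - 1)) ∧
    ∃ U : Set (MatSpace n), zOpen U ∧
      zClosure (kalmanCone X ∩ U) = zClosure (kalmanCone X) ∧
      ∀ A ∈ kalmanCone X ∩ U, ∀ v w, v ∈ X → w ∈ X →
        IsEigenvector (toMat A) v → IsEigenvector (toMat A) w → ∃ c : ℂ, w = c • v := by
  refine ⟨kalman_irred hXirr hXne, ?_⟩
  rw [← and_assoc]
  refine ⟨?_, part4 hXcone hXcl hXirr hXne hXproper⟩
  obtain ⟨D, rfl⟩ : ∃ D, m = D + 1 := ⟨m - 1, by omega⟩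
  obtain ⟨r, rfl⟩ : ∃ r, n = D + (r + 1) := ⟨n - (D + 1), by omega⟩
  exact kalman_aux D r X hXcone hXcl hXirr hXne hXproper hXdim degX hdegX
end
end

/-- Let `X ⊆ ℙ^{n-1}` be an irreducible complex projective variety of
projective dimension `m - 1` (affine cone of dimension `m`) with `X ≠ ℙ^{n-1}`. Then the
Kalman variety `𝒦(X) ⊆ ℙ^{n²-1}` is irreducible, has codimension `n - m`, and has degree
`deg X · binom(n, m-1)`; moreover a generic `[A] ∈ 𝒦(X)` admits exactly one eigenpoint on
`X` (so the projection from the incidence variety onto `𝒦(X)` is birational). -/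
theorem kalman_irreducible_dim_degree (n m : ℕ) (hm : 1 ≤ m) (hmn : m ≤ n)
    (X : Set (Fin n → ℂ)) (hXcone : IsCone X) (hXcl : zClosed X) (hXirr : zIrred X)
    (hXne : ∃ v ∈ X, v ≠ 0) (hXproper : X ≠ Set.univ)
    (hXdim : zDim X = (m : WithBot ℕ∞))
    (degX : ℕ) (hdegX : hasConeDegree X (m - 1) degX) :
    zIrred (kalmanCone X) ∧
    zDim (kalmanCone X) = ((n ^ 2 - (n - m) : ℕ) : WithBot ℕ∞) ∧
    hasConeDegree (kalmanCone X) (n ^ 2 - 1 - (n - m)) (degX * Nat.choose n (m - 1)) ∧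
    ∃ U : Set (MatSpace n), zOpen U ∧
      zClosure (kalmanCone X ∩ U) = zClosure (kalmanCone X) ∧
      ∀ A ∈ kalmanCone X ∩ U, ∀ v w : Fin n → ℂ, v ∈ X → w ∈ X →
        IsEigenvector (toMat A) v → IsEigenvector (toMat A) w → ∃ c : ℂ, w = c • v := by
  exact kalman_irreducible_dim_degree' n m hm hmn X hXcone hXcl hXirr hXne hXproper hXdim degX hdegX

end
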